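/- arXiv:2104.04476 — 2 statements merged into one kernel-verified Lean document; each statement's English description precedes it below -/
import Mathlib

section
/- A PL (d-1)-ball Δ with n vertices is i_0-neighborly (i.e., every set of at most i_0 vertices is a face) if and only if h_i(Δ) = binom(n-d+i-1, i) for all i ≤ i_0. -/
/-- An (abstract) simplicial complex: a family of finite sets closed under subsets. -/
def IsComplex (K : Set (Finset ℕ)) : Prop :=
  ∀ s ∈ K, ∀ t ⊆ s, t ∈ K

/-- The geometric realization of a family of finite subsets of `ℕ`:
convex combinations of vertices supported on a face. -/
def spaceOf (K : Set (Finset ℕ)) : Set (ℕ → ℝ) :=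
  {f | (∀ i, 0 ≤ f i) ∧ ∃ s ∈ K, (∀ i, f i ≠ 0 → i ∈ s) ∧ ∑ i ∈ s, f i = 1}

/-- `K` is a (topological/PL) `d`-ball: its realization is homeomorphic to the
closed unit ball in `ℝ^d`. -/
def IsBall (d : ℕ) (K : Set (Finset ℕ)) : Prop :=
  Nonempty (spaceOf K ≃ₜ (Metric.closedBall (0 : EuclideanSpace ℝ (Fin d)) 1))

/-- `K` is a (topological/PL) `d`-sphere: its realization is homeomorphic to the
unit sphere in `ℝ^{d+1}`. -/
def IsSphere (d : ℕ) (K : Set (Finset ℕ)) : Prop :=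
  Nonempty (spaceOf K ≃ₜ (Metric.sphere (0 : EuclideanSpace ℝ (Fin (d + 1))) 1))

/-- The boundary complex of a pure `d`-dimensional ball (facets have `d+1`
vertices): faces contained in a `d`-element face lying in exactly one facet. -/
def bdry (d : ℕ) (K : Set (Finset ℕ)) : Set (Finset ℕ) :=
  {τ | ∃ ρ ∈ K, τ ⊆ ρ ∧ ρ.card = d ∧ ∃! F, F ∈ K ∧ F.card = d + 1 ∧ ρ ⊆ F}

/-- A `d`-ball `K` is `i`-stacked if all faces of dimension `≤ d - i - 1`
(i.e. with at most `d - i` vertices) lie in the boundary. -/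
def IsStacked (i d : ℕ) (K : Set (Finset ℕ)) : Prop :=
  ∀ τ ∈ K, τ.card + i ≤ d → τ ∈ bdry d K

/-- The vertex set of a complex. -/
def vertexSet (K : Set (Finset ℕ)) : Set ℕ := {v | {v} ∈ K}

/-- `K` is `s`-neighborly w.r.t. `V`: every subset of `V` with at most `s`
elements is a face. -/
def Nbrly (s : ℕ) (V : Set ℕ) (K : Set (Finset ℕ)) : Prop :=
  ∀ τ : Finset ℕ, ↑τ ⊆ V → τ.card ≤ s → τ ∈ K

/-- `fnum K i` is the number of faces of `K` with `i` vertices, i.e. `f_{i-1}`. -/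
noncomputable def fnum (K : Set (Finset ℕ)) (i : ℕ) : ℕ :=
  Nat.card {s : Finset ℕ // s ∈ K ∧ s.card = i}

/-- The `h`-numbers of a `(d-1)`-dimensional complex:
`h_j = ∑_{i=0}^{j} (-1)^{j-i} C(d-i, j-i) f_{i-1}`. -/
noncomputable def hnum (d : ℕ) (K : Set (Finset ℕ)) (j : ℕ) : ℤ :=
  ∑ i ∈ Finset.range (j + 1),
    (-1) ^ (j - i) * (Nat.choose (d - i) (j - i)) * (fnum K i : ℤ)

/-- The join of two complexes on disjoint vertex sets. -/
def joinC (K1 K2 : Set (Finset ℕ)) : Set (Finset ℕ) :=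
  {u | ∃ s ∈ K1, ∃ t ∈ K2, u = s ∪ t}

open Polynomial in
theorem exists_polynomial_eval_eq_det_id_add_smul {E : Type*} [NormedAddCommGroup E]
    [NormedSpace ℝ E] [FiniteDimensional ℝ E] (A : E →L[ℝ] E) :
    ∃ p : ℝ[X], p.natDegree ≤ Module.finrank ℝ E ∧
      ∀ t : ℝ, p.eval t = (ContinuousLinearMap.id ℝ E + t • A).det := by
  set b := Module.finBasis ℝ E
  set M := LinearMap.toMatrix b b (A : E →ₗ[ℝ] E) with hM
  refine ⟨((X : ℝ[X]) • M.map C + (1 : Matrix _ _ ℝ).map C).det, ?_, fun t ↦ ?_⟩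
  · simpa using natDegree_det_X_add_C_le M 1
  · rw [ContinuousLinearMap.det, ← LinearMap.det_toMatrix b, ← coe_evalRingHom, RingHom.map_det]
    congr 1
    ext i j
    simp [hM, Matrix.one_apply, LinearMap.toMatrix_apply, Finsupp.single_apply, eq_comm,
      apply_ite (eval t), add_comm]
    exact mul_comm _ _

theorem det_id_add_ne_zero {E : Type*} [NormedAddCommGroup E] [NormedSpace ℝ E]
    [FiniteDimensional ℝ E] {A : E →L[ℝ] E} (hA : ‖A‖ < 1) :
    (ContinuousLinearMap.id ℝ E + A).det ≠ 0 := by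
  intro h
  obtain ⟨v, hv, hv0⟩ := (Submodule.ne_bot_iff _).1 (LinearMap.bot_lt_ker_of_det_eq_zero h).ne'
  have hv' : v + A v = 0 := by simpa using hv
  have h1 : ‖v‖ = ‖A v‖ := by
    rw [← norm_neg (A v), ← eq_neg_of_add_eq_zero_left hv']
  have h2 := A.le_opNorm v
  have h3 : 0 < ‖v‖ := norm_pos_iff.2 hv0
  nlinarith

theorem det_id_add_pos {E : Type*} [NormedAddCommGroup E] [NormedSpace ℝ E]
    [FiniteDimensional ℝ E] {A : E →L[ℝ] E} (hA : ‖A‖ < 1) :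
    0 < (ContinuousLinearMap.id ℝ E + A).det := by
  by_contra! h
  have hc : Continuous fun s : ℝ ↦ (ContinuousLinearMap.id ℝ E + s • A).det :=
    ContinuousLinearMap.continuous_det.comp (by fun_prop)
  have h0 : (0 : ℝ) ∈ Set.Icc ((ContinuousLinearMap.id ℝ E + (1 : ℝ) • A).det)
      ((ContinuousLinearMap.id ℝ E + (0 : ℝ) • A).det) := by
    refine ⟨by simpa using h, ?_⟩
    simp [ContinuousLinearMap.det]
  obtain ⟨s, hs, hs0⟩ := intermediate_value_Icc' zero_le_one hc.continuousOn h0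
  refine det_id_add_ne_zero ?_ hs0
  rw [norm_smul, Real.norm_of_nonneg hs.1]
  nlinarith [hs.1, hs.2, norm_nonneg A]

theorem ContractingWith.bijective_add {E : Type*} [NormedAddCommGroup E] [CompleteSpace E]
    {c : NNReal} {u : E → E} (hu : ContractingWith c u) :
    Function.Bijective fun x ↦ x + u x := by
  refine ⟨fun x y hxy ↦ ?_, fun y ↦ ?_⟩
  · have h1 : dist x y = dist (u x) (u y) := by
      have : x - y = u y - u x := by
        have : x + u x = y + u y := hxy
        rw [sub_eq_sub_iff_add_eq_add, this, add_comm]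
      rw [dist_eq_norm, this, ← dist_eq_norm, dist_comm]
    have h2 := hu.2.dist_le_mul x y
    have h3 : (c : ℝ) < 1 := hu.1
    have h4 : 0 ≤ dist x y := dist_nonneg
    exact dist_le_zero.1 (by nlinarith)
  · have hv : ContractingWith c fun x ↦ y - u x :=
      ⟨hu.1, LipschitzWith.of_dist_le_mul fun a b ↦ by
        rw [dist_sub_left]
        exact hu.2.dist_le_mul a b⟩
    refine ⟨hv.fixedPoint, ?_⟩
    have := hv.fixedPoint_isFixedPt
    exact eq_sub_iff_add_eq.1 this.eq.symm

theorem LipschitzOnWith.indicator_closedBall {E F : Type*} [NormedAddCommGroup E]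
    [NormedSpace ℝ E] [NormedAddCommGroup F] {C : NNReal} {k : E → F} {R : ℝ}
    (hk : LipschitzOnWith C k (Metric.closedBall 0 R)) (h0 : ∀ x, ‖x‖ = R → k x = 0) :
    LipschitzWith C ((Metric.closedBall 0 R).indicator k) := by
  have key : ∀ x y : E, ‖x‖ ≤ R → R < ‖y‖ →
      dist ((Metric.closedBall 0 R).indicator k x) ((Metric.closedBall 0 R).indicator k y)
        ≤ C * dist x y := by
    intro x y hx hy
    have hc : Continuous fun s : ℝ ↦ ‖AffineMap.lineMap (k := ℝ) x y s‖ := by fun_prop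
    obtain ⟨s, hs, hsR⟩ := intermediate_value_Icc zero_le_one hc.continuousOn
      (show R ∈ Set.Icc _ _ by simpa using ⟨hx, hy.le⟩)
    have hz : k (AffineMap.lineMap x y s) = 0 := h0 _ hsR
    have h1 := hk.dist_le_mul x (by simpa using hx) (AffineMap.lineMap x y s)
      (by simpa using hsR.le)
    rw [hz, dist_left_lineMap, Real.norm_of_nonneg hs.1] at h1
    rw [Set.indicator_of_mem (by simpa using hx), Set.indicator_of_notMem (by simpa using hy)]
    refine h1.trans ?_
    gcongr
    exact mul_le_of_le_one_left dist_nonneg hs.2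
  refine LipschitzWith.of_dist_le_mul fun x y ↦ ?_
  rcases le_or_gt ‖x‖ R with hx | hx <;> rcases le_or_gt ‖y‖ R with hy | hy
  · rw [Set.indicator_of_mem (by simpa using hx), Set.indicator_of_mem (by simpa using hy)]
    exact hk.dist_le_mul x (by simpa using hx) y (by simpa using hy)
  · exact key x y hx hy
  · rw [dist_comm, dist_comm x]
    exact key y x hy hx
  · rw [Set.indicator_of_notMem (by simpa using hx), Set.indicator_of_notMem (by simpa using hy)]
    simp only [dist_self]
    positivity

open MeasureTheory in
theorem exists_forall_setIntegral_det_id_add_smul_fderiv {E : Type*} [NormedAddCommGroup E]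
    [NormedSpace ℝ E] [FiniteDimensional ℝ E] [MeasurableSpace E] [BorelSpace E]
    (μ : Measure E) [μ.IsAddHaarMeasure] {k : E → E} {R : ℝ} (hk : ContDiff ℝ 1 k)
    (h0 : ∀ x, ‖x‖ = R → k x = 0) :
    ∃ t₀ > 0, ∀ t ∈ Set.Icc (0 : ℝ) t₀,
      ∫ x in Metric.closedBall 0 R, (ContinuousLinearMap.id ℝ E + t • fderiv ℝ k x).det ∂μ =
        μ.real (Metric.closedBall 0 R) := by
  set B := Metric.closedBall (0 : E) R
  have hcont : Continuous (fderiv ℝ k) := hk.continuous_fderiv one_ne_zero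
  obtain ⟨C, hC⟩ := (isCompact_closedBall (0 : E) R).exists_bound_of_continuousOn
    hcont.continuousOn
  have hC' : ∀ x ∈ B, ‖fderiv ℝ k x‖ ≤ C.toNNReal := fun x hx ↦
    (hC x hx).trans (Real.le_coe_toNNReal C)
  have hlip : LipschitzOnWith C.toNNReal k B :=
    (convex_closedBall (0 : E) R).lipschitzOnWith_of_nnnorm_fderiv_le
      (fun x _ ↦ hk.differentiable one_ne_zero x) hC'
  refine ⟨1 / (C.toNNReal + 1), by positivity, fun t ht ↦ ?_⟩
  have htC : t * C.toNNReal < 1 := by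
    have := ht.2
    rw [le_div_iff₀ (by positivity)] at this
    rcases ht.1.eq_or_lt with h | h
    · simp [← h]
    · linarith
  have hcontr : ContractingWith (t.toNNReal * C.toNNReal) fun x ↦ t • B.indicator k x := by
    constructor
    · rw [← NNReal.coe_lt_coe]
      simpa [Real.coe_toNNReal t ht.1] using htC
    · refine LipschitzWith.of_dist_le_mul fun x y ↦ ?_
      rw [dist_smul₀, Real.norm_of_nonneg ht.1, NNReal.coe_mul, Real.coe_toNNReal t ht.1, mul_assoc]
      exact mul_le_mul_of_nonneg_left ((hlip.indicator_closedBall h0).dist_le_mul x y) ht.1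
  obtain ⟨hinj, hsurj⟩ := hcontr.bijective_add
  set G : E → E := fun x ↦ x + t • B.indicator k x
  have hGout : ∀ x ∉ B, G x = x := fun x hx ↦ by simp [G, hx]
  have hGin : Set.EqOn G (fun x ↦ x + t • k x) B := fun x hx ↦ by simp [G, hx]
  have himg : (fun x ↦ x + t • k x) '' B = B := by
    rw [← hGin.image_eq]
    ext y
    constructor
    · rintro ⟨x, hx, rfl⟩
      by_contra h
      exact h (by rwa [hinj (hGout _ h)])
    · intro hy
      obtain ⟨x, rfl⟩ := hsurj y
      refine ⟨x, ?_, rfl⟩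
      by_contra h
      exact h (by rwa [← hGout x h])
  have hcv := integral_image_eq_integral_abs_det_fderiv_smul μ
    (f := fun x ↦ x + t • k x) (f' := fun x ↦ ContinuousLinearMap.id ℝ E + t • fderiv ℝ k x)
    (s := B) Metric.isClosed_closedBall.measurableSet
    (fun x _ ↦ ((hasFDerivAt_id x).add
      ((hk.differentiable one_ne_zero x).hasFDerivAt.const_smul t)).hasFDerivWithinAt)
    ((hinj.injOn).congr hGin) (fun _ ↦ (1 : ℝ))
  rw [himg] at hcv
  rw [setIntegral_const, smul_eq_mul, mul_one] at hcv
  rw [hcv]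
  refine setIntegral_congr_fun Metric.isClosed_closedBall.measurableSet fun x hx ↦ ?_
  have hpos : 0 < (ContinuousLinearMap.id ℝ E + t • fderiv ℝ k x).det := by
    refine det_id_add_pos (lt_of_le_of_lt ?_ htC)
    rw [norm_smul, Real.norm_of_nonneg ht.1]
    exact mul_le_mul_of_nonneg_left (hC' x hx) ht.1
  simp [abs_of_pos hpos]

open MeasureTheory in
theorem not_exists_contDiff_retraction_sphere {E : Type*} [NormedAddCommGroup E]
    [InnerProductSpace ℝ E] [FiniteDimensional ℝ E] {r : E → E} (hr : ContDiff ℝ 1 r)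
    (hnorm : ∀ x, ‖r x‖ = 1) (hfix : ∀ x, ‖x‖ = 1 → r x = x) : False := by
  borelize E
  set μ : Measure E := Measure.addHaar
  set B := Metric.closedBall (0 : E) 1
  set k : E → E := fun x ↦ r x - x
  have hk : ContDiff ℝ 1 k := hr.sub contDiff_id
  obtain ⟨t₀, ht₀, hint⟩ := exists_forall_setIntegral_det_id_add_smul_fderiv μ (R := 1) hk
    fun x hx ↦ by simp [k, hfix x hx]
  obtain ⟨s, hs, hscard⟩ := (Set.Icc_infinite ht₀).exists_subset_card_eq
    (Module.finrank ℝ E + 1)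
  have hinterp : ∀ p : Polynomial ℝ, p.natDegree ≤ Module.finrank ℝ E →
      p.eval 1 = ∑ i ∈ s, (Lagrange.basis s id i).eval 1 * p.eval i := by
    intro p hp
    conv_lhs => rw [Lagrange.eq_interpolate (s := s) (v := id) (f := p) Function.injective_id.injOn
      (by
        rw [hscard]
        exact Polynomial.degree_le_natDegree.trans_lt (by exact_mod_cast Nat.lt_succ_of_le hp))]
    simp [Lagrange.interpolate_apply, Polynomial.eval_finsetSum, mul_comm]
  have hdet : ∀ x, ∑ i ∈ s, (Lagrange.basis s id i).eval 1 *
      (ContinuousLinearMap.id ℝ E + i • fderiv ℝ k x).det = 0 := by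
    intro x
    obtain ⟨p, hp, hpe⟩ := exists_polynomial_eval_eq_det_id_add_smul (fderiv ℝ k x)
    simp_rw [← hpe]
    rw [← hinterp p hp, hpe]
    have hrd := (hr.differentiable one_ne_zero x).hasFDerivAt
    have h1 : ContinuousLinearMap.id ℝ E + (1 : ℝ) • fderiv ℝ k x = fderiv ℝ r x := by
      have : fderiv ℝ k x = fderiv ℝ r x - ContinuousLinearMap.id ℝ E :=
        (hrd.sub (hasFDerivAt_id x)).fderiv
      rw [this]
      simp
    rw [h1]
    by_contra hne
    have hsurj : Function.Surjective (fderiv ℝ r x) :=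
      (LinearEquiv.ofIsUnitDet (v := Module.finBasis ℝ E) (v' := Module.finBasis ℝ E)
        (f := (fderiv ℝ r x : E →ₗ[ℝ] E))
        (by rw [LinearMap.det_toMatrix]; exact isUnit_iff_ne_zero.2 hne)).surjective
    obtain ⟨v, hv⟩ := hsurj (r x)
    have hd := (hrd.inner ℝ hrd).fderiv
    have hconst : (fun y ↦ inner ℝ (r y) (r y)) = fun _ ↦ (1 : ℝ) := by
      ext y
      rw [real_inner_self_eq_norm_sq, hnorm, one_pow]
    rw [hconst] at hd
    have := congrArg (fun L : E →L[ℝ] ℝ ↦ L v) hd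
    norm_num [hv, hnorm] at this
  have hcont : ∀ i : ℝ, Continuous fun x ↦ (ContinuousLinearMap.id ℝ E + i • fderiv ℝ k x).det :=
    fun i ↦ ContinuousLinearMap.continuous_det.comp
      (continuous_const.add ((hk.continuous_fderiv one_ne_zero).const_smul i))
  have hsum : ∑ i ∈ s, (Lagrange.basis s id i).eval 1 * μ.real B = 0 := by
    have h1 : ∫ x in B, ∑ i ∈ s, (Lagrange.basis s id i).eval 1 *
      (ContinuousLinearMap.id ℝ E + i • fderiv ℝ k x).det ∂μ = 0 := by simp [hdet]
    rw [integral_finsetSum] at h1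
    · rw [← h1]
      refine Finset.sum_congr rfl fun i hi ↦ ?_
      rw [integral_const_mul, hint i (hs hi)]
    · intro i _
      exact (((hcont i).continuousOn.integrableOn_compact
        (isCompact_closedBall (0 : E) 1))).const_mul _
  have hone := hinterp 1 (by simp)
  simp only [Polynomial.eval_one, mul_one] at hone
  rw [← Finset.sum_mul, ← hone, one_mul] at hsum
  have hpos : 0 < μ.real B := ENNReal.toReal_pos
    (Metric.measure_closedBall_pos μ _ one_pos).ne' measure_closedBall_lt_top.ne
  exact hpos.ne' hsum

theorem exists_zero_of_contDiff_of_dist_le {E : Type*} [NormedAddCommGroup E]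
    [InnerProductSpace ℝ E] [FiniteDimensional ℝ E] {H : E → E} (hH : ContDiff ℝ 1 H)
    (hclose : ∀ x, ‖x‖ ≤ 1 → ‖H x - x‖ < 1 / 2) : ∃ x, H x = 0 := by
  by_contra! hne
  let χ : ContDiffBump (0 : E) := ⟨1 / 2, 1, by norm_num, by norm_num⟩
  set F : E → E := fun x ↦ x + χ x • (H x - x)
  have hF : ContDiff ℝ 1 F := contDiff_id.add (χ.contDiff.smul (hH.sub contDiff_id))
  have hFout : ∀ x, 1 ≤ ‖x‖ → F x = x := fun x hx ↦ by
    simp [F, χ.zero_of_le_dist (x := x) (by simpa using hx)]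
  have hF0 : ∀ x, F x ≠ 0 := by
    intro x h
    rcases le_or_gt ‖x‖ (1 / 2) with hx | hx
    · have : F x = H x := by simp [F, χ.one_of_mem_closedBall (x := x) (mem_closedBall_zero_iff.2 hx)]
      exact hne x (this ▸ h)
    rcases le_or_gt ‖x‖ 1 with hx1 | hx1
    · have h1 : ‖x‖ = ‖χ x • (H x - x)‖ := by
        rw [← norm_neg (χ x • (H x - x)), ← eq_neg_of_add_eq_zero_left h]
      rw [norm_smul, Real.norm_of_nonneg χ.nonneg] at h1
      nlinarith [hclose x hx1, χ.le_one (x := x), χ.nonneg (x := x), norm_nonneg (H x - x)]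
    · rw [hFout x hx1.le] at h
      simp [h] at hx1
      linarith
  refine not_exists_contDiff_retraction_sphere (r := fun x ↦ ‖F x‖⁻¹ • F x)
    (((hF.norm ℝ hF0).inv fun x ↦ norm_ne_zero_iff.2 (hF0 x)).smul hF) (fun x ↦ ?_)
    fun x hx ↦ by simp [hFout x hx.ge, hx]
  rw [norm_smul, norm_inv, norm_norm, inv_mul_cancel₀ (norm_ne_zero_iff.2 (hF0 x))]

open Module in
theorem not_injOn_closedBall_of_finrank_lt {E F : Type} [NormedAddCommGroup E]
    [InnerProductSpace ℝ E] [FiniteDimensional ℝ E] [NormedAddCommGroup F]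
    [NormedSpace ℝ F] [FiniteDimensional ℝ F] (hEF : finrank ℝ F < finrank ℝ E)
    {f : E → F} (hf : ContinuousOn f (Metric.closedBall 0 1)) :
    ¬ Set.InjOn f (Metric.closedBall 0 1) := by
  intro hinj
  have : CompactSpace (Metric.closedBall (0 : E) 1) :=
    isCompact_iff_compactSpace.1 (isCompact_closedBall _ _)
  have hemb := hf.domRestrict.isClosedEmbedding hinj.injective
  obtain ⟨g, hg⟩ := ContinuousMap.exists_extension hemb
    ⟨((↑) : Metric.closedBall (0 : E) 1 → E), continuous_subtype_val⟩
  obtain ⟨f', hf'⟩ := ContinuousMap.exists_restrict_eq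
    (Metric.isClosed_closedBall (x := (0 : E)) (ε := 1)) ⟨_, hf.domRestrict⟩
  have hgf : ∀ x ∈ Metric.closedBall (0 : E) 1, g (f' x) = x := fun x hx ↦ by
    have h1 := DFunLike.congr_fun hg ⟨x, hx⟩
    have h2 := DFunLike.congr_fun hf' ⟨x, hx⟩
    simp at h1 h2
    rw [h2, h1]
  obtain ⟨p, hp, hpg, -⟩ := g.continuous.exists_contDiff_approx (ε := fun _ ↦ 1 / 8) 1
    continuous_const (by norm_num)
  obtain ⟨q, hqp, hq⟩ := (hp.dense_compl_range_of_finrank_lt_finrank hEF).exists_dist_lt 0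
    (ε := 1 / 8) (by norm_num)
  have hqne : ∀ x, p (f' x) - q ≠ 0 := fun x h ↦ hqp ⟨f' x, sub_eq_zero.1 h⟩
  have hcont : Continuous fun x ↦ p (f' x) - q :=
    (hp.continuous.comp f'.continuous).sub continuous_const
  obtain ⟨H, hH, hHp, -⟩ := hcont.exists_contDiff_approx
    (ε := fun x ↦ min ‖p (f' x) - q‖ (1 / 8)) 1 (hcont.norm.min continuous_const)
    fun x ↦ lt_min (norm_pos_iff.2 (hqne x)) (by norm_num)
  obtain ⟨x, hx⟩ := exists_zero_of_contDiff_of_dist_le hH fun x hx ↦ by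
    have h1 := (hHp x).trans_le (min_le_right _ _)
    have h2 := hpg (f' x)
    rw [hgf x (by simpa using hx)] at h2
    rw [dist_eq_norm] at h1 h2
    rw [dist_zero_left] at hq
    calc ‖H x - x‖ = ‖(H x - (p (f' x) - q)) + (p (f' x) - x) - q‖ := by congr 1; abel
      _ ≤ ‖H x - (p (f' x) - q)‖ + ‖p (f' x) - x‖ + ‖q‖ :=
        (norm_sub_le _ _).trans (by gcongr; exact norm_add_le _ _)
      _ < 1 / 2 := by linarith
  have := (hHp x).trans_le (min_le_left _ _)
  rw [hx, dist_zero_left] at this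
  exact lt_irrefl _ this

theorem exists_injOn_closedBall_mem_spaceOf {K : Set (Finset ℕ)} {s : Finset ℕ} (hs : s ∈ K)
    {d : ℕ} (hcard : s.card = d + 1) :
    ∃ ψ : EuclideanSpace ℝ (Fin d) → ℕ → ℝ, Continuous ψ ∧ Function.Injective ψ ∧
      ∀ x ∈ Metric.closedBall (0 : EuclideanSpace ℝ (Fin d)) 1, ψ x ∈ spaceOf K := by
  let e : s ≃ Fin (d + 1) := s.equivFinOfCardEq hcard
  let c : ℝ := 1 / (d + 1)
  have hc : 0 < c := by positivity
  have hcd : (d + 1) * c = 1 := by simp only [c]; field_simp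
  let w : EuclideanSpace ℝ (Fin d) → Fin (d + 1) → ℝ := fun x ↦
    Fin.cons (c - c ^ 2 * ∑ i, x i) fun i ↦ c + c ^ 2 * x i
  have hwsum : ∀ x, ∑ j, w x j = 1 := fun x ↦ by
    simp only [w, Fin.sum_univ_succ, Fin.cons_zero, Fin.cons_succ, Finset.sum_add_distrib,
      ← Finset.mul_sum, Finset.sum_const, Finset.card_univ, Fintype.card_fin, nsmul_eq_mul]
    linarith
  have hw0 : ∀ x ∈ Metric.closedBall (0 : EuclideanSpace ℝ (Fin d)) 1, ∀ j, 0 ≤ w x j := by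
    intro x hx j
    have habs : ∀ i, |x i| ≤ 1 := fun i ↦
      (PiLp.norm_apply_le x i).trans (mem_closedBall_zero_iff.1 hx)
    refine Fin.cases ?_ (fun i ↦ ?_) j
    · have : ∑ i, x i ≤ d := by
        simpa using Finset.sum_le_sum fun i (_ : i ∈ Finset.univ) ↦ (le_abs_self _).trans (habs i)
      simp only [w, Fin.cons_zero]
      nlinarith [mul_le_mul_of_nonneg_left this (sq_nonneg c)]
    · have h1 := neg_le_of_abs_le (habs i)
      have hc1 : c ≤ 1 := by
        have : 0 ≤ (d : ℝ) * c := by positivity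
        linarith
      simp only [w, Fin.cons_succ]
      nlinarith [mul_le_mul_of_nonneg_left h1 (sq_nonneg c)]
  have hwcont : ∀ j, Continuous fun x ↦ w x j := by
    refine Fin.cases ?_ fun i ↦ ?_
    · simp only [w, Fin.cons_zero]
      fun_prop
    · simp only [w, Fin.cons_succ]
      fun_prop
  let ψ : EuclideanSpace ℝ (Fin d) → ℕ → ℝ := fun x n ↦
    if h : n ∈ s then w x (e ⟨n, h⟩) else 0
  have hψ : ∀ x j, ψ x (e.symm j) = w x j := fun x j ↦ by simp [ψ]
  refine ⟨ψ, continuous_pi fun n ↦ ?_, fun x y hxy ↦ ?_, fun x hx ↦ ⟨fun n ↦ ?_, s, hs, ?_, ?_⟩⟩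
  · by_cases h : n ∈ s
    · simpa only [ψ, h, dif_pos] using hwcont (e ⟨n, h⟩)
    · simpa only [ψ, h, dif_neg, not_false_eq_true] using continuous_const
  · ext i
    have h1 : w x i.succ = w y i.succ := by rw [← hψ, ← hψ, hxy]
    simpa [w, hc.ne'] using h1
  · by_cases h : n ∈ s
    · simpa only [ψ, h, dif_pos] using hw0 x hx _
    · simp [ψ, h]
  · intro n hn
    by_contra h
    exact hn (by simp [ψ, h])
  · rw [← hwsum x, ← Finset.sum_coe_sort, ← e.symm.sum_comp]
    exact Finset.sum_congr rfl fun j _ ↦ hψ x j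

theorem IsBall.card_le {d : ℕ} {K : Set (Finset ℕ)} (hb : IsBall d K) (hc : IsComplex K)
    {s : Finset ℕ} (hs : s ∈ K) : s.card ≤ d + 1 := by
  by_contra! hlt
  obtain ⟨t, hts, ht⟩ := Finset.exists_subset_card_eq (show d + 1 + 1 ≤ s.card from hlt)
  obtain ⟨ψ, hcont, hinj, hmem⟩ := exists_injOn_closedBall_mem_spaceOf (hc s hs t hts) ht
  obtain ⟨φ⟩ := hb
  let f : EuclideanSpace ℝ (Fin (d + 1)) → EuclideanSpace ℝ (Fin d) := fun x ↦
    open Classical in if h : ψ x ∈ spaceOf K then φ ⟨ψ x, h⟩ else 0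
  have hf : ∀ x : Metric.closedBall (0 : EuclideanSpace ℝ (Fin (d + 1))) 1,
      f x = φ ⟨ψ x, hmem x x.2⟩ := fun x ↦ dif_pos (hmem x x.2)
  refine not_injOn_closedBall_of_finrank_lt (f := f) (by simp) ?_ ?_
  · rw [continuousOn_iff_continuous_domRestrict]
    have : (Metric.closedBall (0 : EuclideanSpace ℝ (Fin (d + 1))) 1).domRestrict f =
        fun x : Metric.closedBall (0 : EuclideanSpace ℝ (Fin (d + 1))) 1 ↦
          (φ ⟨ψ x, hmem x x.2⟩ : EuclideanSpace ℝ (Fin d)) := funext hf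
    rw [this]
    fun_prop
  · intro x hx y hy hxy
    rw [hf ⟨x, hx⟩, hf ⟨y, hy⟩] at hxy
    exact hinj (congrArg Subtype.val (φ.injective (Subtype.ext hxy)))

theorem sum_neg_one_pow_mul_choose_sub_succ (d n j : ℕ) (hjd : j ≤ d) :
    ∑ i ∈ Finset.range (j + 1),
        (-1) ^ (j - i) * ((d + 1 - i).choose (j - i) : ℤ) * ((n + 1).choose i : ℤ) =
      ∑ i ∈ Finset.range (j + 1),
        (-1) ^ (j - i) * ((d - i).choose (j - i) : ℤ) * (n.choose i : ℤ) := by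
  cases j with
  | zero => simp
  | succ j =>
    have h1 : ∑ i ∈ Finset.range (j + 2),
        (-1) ^ (j + 1 - i) * ((d + 1 - i).choose (j + 1 - i) : ℤ) * ((n + 1).choose i : ℤ) =
        ∑ i ∈ Finset.range (j + 2),
          (-1) ^ (j + 1 - i) * ((d + 1 - i).choose (j + 1 - i) : ℤ) * (n.choose i : ℤ) +
        ∑ i ∈ Finset.range (j + 1),
          (-1) ^ (j - i) * ((d - i).choose (j - i) : ℤ) * (n.choose i : ℤ) := by
      rw [Finset.sum_range_succ', Finset.sum_range_succ' _ (j + 1), add_right_comm,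
        ← Finset.sum_add_distrib]
      simp only [Nat.choose_zero_right, Nat.add_sub_add_right, Nat.choose_succ_succ' n]
      congr 1
      refine Finset.sum_congr rfl fun i _ ↦ ?_
      push_cast
      ring
    have h2 : ∑ i ∈ Finset.range (j + 2),
          (-1) ^ (j + 1 - i) * ((d + 1 - i).choose (j + 1 - i) : ℤ) * (n.choose i : ℤ) =
        ∑ i ∈ Finset.range (j + 2),
          (-1) ^ (j + 1 - i) * ((d - i).choose (j + 1 - i) : ℤ) * (n.choose i : ℤ) -
        ∑ i ∈ Finset.range (j + 1),
          (-1) ^ (j - i) * ((d - i).choose (j - i) : ℤ) * (n.choose i : ℤ) := by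
      rw [Finset.sum_range_succ, Finset.sum_range_succ _ (j + 1), add_sub_right_comm,
        ← Finset.sum_sub_distrib]
      congr 1
      · refine Finset.sum_congr rfl fun i hi ↦ ?_
        have hij : i ≤ j := Nat.lt_succ_iff.1 (Finset.mem_range.1 hi)
        rw [Nat.sub_add_comm hij, Nat.sub_add_comm (show i ≤ d by omega), Nat.choose_succ_succ']
        push_cast
        ring
      · simp
    rw [h1, h2, sub_add_cancel]

theorem sum_neg_one_pow_mul_choose_sub_mul_choose (d n j : ℕ) (hjd : j ≤ d) (hdn : d ≤ n) :
    ∑ i ∈ Finset.range (j + 1), (-1) ^ (j - i) * ((d - i).choose (j - i) : ℤ) * (n.choose i : ℤ) =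
      (n - d + j - 1).choose j := by
  induction d, hjd using Nat.le_induction generalizing n with
  | base =>
    rw [Nat.sub_add_cancel hdn]
    rcases n with _ | n
    · obtain rfl : j = 0 := by omega
      simp
    · have h := Int.alternating_sum_range_choose_eq_choose (n := n) (m := j)
      have hsq : ((-1 : ℤ) ^ j) * (-1) ^ j = 1 := by rw [← mul_pow]; simp
      calc _ = (-1) ^ j * ∑ i ∈ Finset.range (j + 1), (-1) ^ i * ((n + 1).choose i : ℤ) := by
            rw [Finset.mul_sum]
            refine Finset.sum_congr rfl fun i hi ↦ ?_
            have hij : i ≤ j := Nat.lt_succ_iff.1 (Finset.mem_range.1 hi)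
            obtain ⟨m, rfl⟩ := Nat.exists_eq_add_of_le hij
            have hsq' : ((-1 : ℤ) ^ i) * (-1) ^ i = 1 := by rw [← mul_pow]; simp
            rw [Nat.add_sub_cancel_left, Nat.choose_self, pow_add]
            linear_combination (-(-1 : ℤ) ^ m * ((n + 1).choose i : ℤ)) * hsq'
        _ = _ := by rw [h, ← mul_assoc, hsq, one_mul, Nat.add_sub_cancel]
  | succ d hjd ih =>
    obtain ⟨n, rfl⟩ : ∃ m, n = m + 1 := ⟨n - 1, by omega⟩
    rw [sum_neg_one_pow_mul_choose_sub_succ d n j hjd, ih n (by omega), Nat.add_sub_add_right]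

theorem fnum_eq_card_filter {K : Set (Finset ℕ)} (hc : IsComplex K)
    (hfin : (vertexSet K).Finite) (i : ℕ) [DecidablePred (· ∈ K)] :
    fnum K i = ((hfin.toFinset.powersetCard i).filter (· ∈ K)).card := by
  rw [fnum, Nat.subtype_card]
  intro s
  simp only [Finset.mem_filter, Finset.mem_powersetCard, and_comm (a := s ∈ K)]
  refine ⟨fun h ↦ ⟨h.1.2, h.2⟩, fun h ↦ ⟨⟨fun v hv ↦ ?_, h.1⟩, h.2⟩⟩
  exact hfin.mem_toFinset.2 (hc s h.2 {v} (Finset.singleton_subset_iff.2 hv))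

theorem fnum_eq_choose_iff {K : Set (Finset ℕ)} (hc : IsComplex K)
    (hfin : (vertexSet K).Finite) (i : ℕ) :
    fnum K i = (vertexSet K).ncard.choose i ↔
      ∀ τ : Finset ℕ, ↑τ ⊆ vertexSet K → τ.card = i → τ ∈ K := by
  classical
  rw [fnum_eq_card_filter hc hfin, Set.ncard_eq_toFinset_card _ hfin, ← Finset.card_powersetCard,
    Finset.card_filter_eq_iff]
  simp only [Finset.mem_powersetCard, and_imp, ← Finset.coe_subset, Set.Finite.coe_toFinset]

theorem nbrly_iff_forall_fnum_eq {K : Set (Finset ℕ)} (hc : IsComplex K)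
    (hfin : (vertexSet K).Finite) (s : ℕ) :
    Nbrly s (vertexSet K) K ↔ ∀ i ≤ s, fnum K i = (vertexSet K).ncard.choose i := by
  simp only [fnum_eq_choose_iff hc hfin]
  exact ⟨fun h i hi τ hτ hτi ↦ h τ hτ (hτi.trans_le hi), fun h τ hτ hs ↦ h _ hs τ hτ rfl⟩

theorem forall_hnum_eq_iff_forall_fnum_eq (d s : ℕ) (K : Set (Finset ℕ)) (a : ℕ → ℕ) :
    (∀ j ≤ s, hnum d K j = ∑ i ∈ Finset.range (j + 1),
      (-1) ^ (j - i) * ((d - i).choose (j - i) : ℤ) * (a i : ℤ)) ↔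
    ∀ i ≤ s, fnum K i = a i := by
  constructor
  · intro h j
    induction j using Nat.strong_induction_on with
    | _ j ih =>
      intro hj
      have h1 := h j hj
      rw [hnum, Finset.sum_range_succ, Finset.sum_range_succ, Finset.sum_congr rfl
        fun i hi ↦ by rw [ih i (Finset.mem_range.1 hi) ((Finset.mem_range.1 hi).le.trans hj)]] at h1
      simpa using h1
  · intro h j hj
    exact Finset.sum_congr rfl fun i hi ↦ by
      rw [h i ((Nat.lt_succ_iff.1 (Finset.mem_range.1 hi)).trans hj)]

theorem hnum_of_lt {d j : ℕ} (hdj : d < j) (K : Set (Finset ℕ)) : hnum d K j = fnum K j := by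
  rw [hnum, Finset.sum_range_succ, Finset.sum_eq_zero fun i hi ↦ ?_]
  · simp
  · have hij := Finset.mem_range.1 hi
    rw [Nat.choose_eq_zero_of_lt (show d - i < j - i by omega)]
    simp

/-- Stanley's characterization: a PL `(d-1)`-ball `Δ` with `n` vertices is
`i_0`-neighborly iff `h_i(Δ) = C(n-d+i-1, i)` for all `i ≤ i_0`. -/
theorem neighborly_iff_hvector (d n i0 : ℕ) (hd : 1 ≤ d) (hn : d ≤ n)
    (K : Set (Finset ℕ)) (hc : IsComplex K) (hfin : K.Finite)
    (hb : IsBall (d - 1) K) (hv : (vertexSet K).ncard = n) :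
    Nbrly i0 (vertexSet K) K ↔
      ∀ i ≤ i0, hnum d K i = (Nat.choose (n - d + i - 1) i : ℤ) := by
  have hvfin : (vertexSet K).Finite := Set.finite_of_ncard_pos (by omega)
  have hdim : ∀ s ∈ K, s.card ≤ d := fun s hs ↦ by
    have := hb.card_le hc hs
    omega
  have hfnum : ∀ i, d < i → fnum K i = 0 := fun i hi ↦ by
    have : IsEmpty {s : Finset ℕ // s ∈ K ∧ s.card = i} :=
      ⟨fun s ↦ by have := hdim s s.2.1; have := s.2.2; omega⟩
    exact Nat.card_of_isEmpty
  rw [nbrly_iff_forall_fnum_eq hc hvfin, hv]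
  by_cases hcase : i0 ≤ d
  · rw [← forall_hnum_eq_iff_forall_fnum_eq d]
    refine forall₂_congr fun j hj ↦ ?_
    rw [sum_neg_one_pow_mul_choose_sub_mul_choose d n j (hj.trans hcase) hn]
  rcases hn.eq_or_lt with rfl | hlt
  · have key : (∀ i ≤ i0, fnum K i = d.choose i) ↔ ∀ i ≤ d, fnum K i = d.choose i := by
      refine ⟨fun h i hi ↦ h i (by omega), fun h i _ ↦ ?_⟩
      rcases le_or_gt i d with hi | hi
      · exact h i hi
      · rw [hfnum i hi, Nat.choose_eq_zero_of_lt hi]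
    have key' : (∀ i ≤ i0, hnum d K i = (Nat.choose (d - d + i - 1) i : ℤ)) ↔
        ∀ i ≤ d, hnum d K i = (Nat.choose (d - d + i - 1) i : ℤ) := by
      refine ⟨fun h i hi ↦ h i (by omega), fun h i _ ↦ ?_⟩
      rcases le_or_gt i d with hi | hi
      · exact h i hi
      · rw [hnum_of_lt hi, hfnum i hi, Nat.choose_eq_zero_of_lt (by omega)]
    rw [key, key', ← forall_hnum_eq_iff_forall_fnum_eq d]
    refine forall₂_congr fun j hj ↦ ?_
    rw [sum_neg_one_pow_mul_choose_sub_mul_choose d d j hj le_rfl]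
  · have hpos : n.choose (d + 1) ≠ 0 := (Nat.choose_pos hlt).ne'
    refine iff_of_false (fun h ↦ hpos ?_) fun h ↦ hpos ?_
    · rw [← h (d + 1) (by omega), hfnum _ (by omega)]
    · have h1 := h (d + 1) (by omega)
      rw [hnum_of_lt (by omega), hfnum _ (by omega),
        show n - d + (d + 1) - 1 = n by omega] at h1
      exact_mod_cast h1.symm
end

section
/- A PL (d-1)-ball Δ is (r-1)-stacked if and only if h_i(Δ) = 0 for all i ≥ r. -/
namespace StackedBall

/-- Formal sums of elements of `ι` with coefficients modulo two. -/
abbrev Chain (ι : Type*) := ι →₀ ZMod 2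

/-- The basis chain of a generator. -/
noncomputable abbrev gen {ι : Type*} (i : ι) : Chain ι := Finsupp.single i 1

/-- Linear extension of a map defined on generators. -/
noncomputable abbrev lin {ι M : Type*} [AddCommGroup M] [Module (ZMod 2) M] (f : ι → M) :
    Chain ι →ₗ[ZMod 2] M := Finsupp.linearCombination (ZMod 2) f

/-- Chains supported on a set of generators. -/
noncomputable abbrev supp {ι : Type*} (S : Set ι) : Submodule (ZMod 2) (Chain ι) :=
  Finsupp.supported (ZMod 2) (ZMod 2) S

section general

variable {ι M : Type*} [AddCommGroup M] [Module (ZMod 2) M]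

theorem lin_gen (f : ι → M) (i : ι) : lin f (gen i) = f i := by simp

theorem chain_hom_ext {f g : Chain ι →ₗ[ZMod 2] M} (h : ∀ i, f (gen i) = g (gen i)) : f = g :=
  Finsupp.lhom_ext' fun i => LinearMap.ext_ring (h i)

theorem gen_mem_supp {S : Set ι} {i : ι} (h : i ∈ S) : gen i ∈ supp S :=
  Finsupp.single_mem_supported _ _ h

theorem supp_induction {S : Set ι} {W : Submodule (ZMod 2) M} (T : Chain ι →ₗ[ZMod 2] M)
    (h : ∀ i ∈ S, T (gen i) ∈ W) {z : Chain ι} (hz : z ∈ supp S) : T z ∈ W := by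
  have : supp S ≤ W.comap T := by
    rw [supp, Finsupp.supported_eq_span_single, Submodule.span_le]
    rintro _ ⟨i, hi, rfl⟩
    exact h i hi
  exact this hz

theorem supp_eqOn {S : Set ι} {T T' : Chain ι →ₗ[ZMod 2] M}
    (h : ∀ i ∈ S, T (gen i) = T' (gen i)) {z : Chain ι} (hz : z ∈ supp S) : T z = T' z := by
  have := supp_induction (W := ⊥) (T - T') (S := S)
    (fun i hi => by simp [h i hi, -Finsupp.smul_single]) hz
  simpa [sub_eq_zero] using this

theorem supp_mono {S T : Set ι} (h : S ⊆ T) : supp S ≤ supp T := Finsupp.supported_mono h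

/-- The method of acyclic carriers: a partial solution `D` of `∂ D = D b + T`. -/
theorem exists_carried (b : Chain ι →ₗ[ZMod 2] Chain ι) (hbb : ∀ c, b (b c) = 0)
    (δ : M →ₗ[ZMod 2] M) (rk : ι → ℕ) (P : Set ι)
    (W : ι → Submodule (ZMod 2) M)
    (hb : ∀ i ∈ P, b (gen i) ∈ supp {j | j ∈ P ∧ rk j < rk i ∧ W j ≤ W i})
    (T : Chain ι →ₗ[ZMod 2] M) (hT : ∀ i ∈ P, T (gen i) ∈ W i)
    (hTb : ∀ i ∈ P, δ (T (gen i)) = T (b (gen i)))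
    (hW : ∀ i ∈ P, rk i ≠ 0 → ∀ z ∈ W i, δ z = 0 → ∃ w ∈ W i, δ w = z)
    (u : ι → M) (hu : ∀ i ∈ P, rk i = 0 → u i ∈ W i ∧ δ (u i) = T (gen i)) (n : ℕ) :
    ∃ D : Chain ι →ₗ[ZMod 2] M, ∀ i ∈ P, rk i < n →
      D (gen i) ∈ W i ∧ δ (D (gen i)) = D (b (gen i)) + T (gen i) ∧
        (rk i = 0 → D (gen i) = u i) := by
  classical
  induction n with
  | zero => exact ⟨0, fun i _ h => absurd h (by omega)⟩
  | succ n ih =>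
    obtain ⟨D, hD⟩ := ih
    have key : ∀ i, ∃ w, i ∈ P → rk i = n →
        w ∈ W i ∧ δ w = D (b (gen i)) + T (gen i) ∧ (rk i = 0 → w = u i) := by
      intro i
      by_cases hi : i ∈ P
      swap
      · exact ⟨0, fun h => absurd h hi⟩
      by_cases hin : rk i = n
      swap
      · exact ⟨0, fun _ h => absurd h hin⟩
      by_cases h0 : rk i = 0
      · have hbz : b (gen i) = 0 := by
          have := hb i hi
          rw [Finsupp.mem_supported] at this
          rw [← Finsupp.support_eq_empty, ← Finset.coe_eq_empty]
          exact Set.eq_empty_of_subset_empty fun j hj => by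
            have := (this hj).2.1
            omega
        exact ⟨u i, fun _ _ => ⟨(hu i hi h0).1, by rw [hbz]; simp [hu i hi h0], fun _ => rfl⟩⟩
      · have h1 : D (b (gen i)) ∈ W i := supp_induction D
          (fun j hj => hj.2.2 (hD j hj.1 (by have := hj.2.1; omega)).1) (hb i hi)
        have h2 : δ (D (b (gen i))) = T (b (gen i)) := by
          have := supp_eqOn (T := δ ∘ₗ D) (T' := D ∘ₗ b + T)
            (fun j (hj : j ∈ {j | j ∈ P ∧ rk j < rk i ∧ W j ≤ W i}) =>
              (hD j hj.1 (by have := hj.2.1; omega)).2.1) (hb i hi)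
          simp only [LinearMap.comp_apply, LinearMap.add_apply] at this
          rw [this, hbb, map_zero, zero_add]
        obtain ⟨w, hw, hw'⟩ := hW i hi h0 (D (b (gen i)) + T (gen i))
          (add_mem h1 (hT i hi)) (by
            rw [map_add, h2, hTb i hi]
            exact ZModModule.add_self _)
        exact ⟨w, fun _ _ => ⟨hw, hw', fun h => absurd h h0⟩⟩
    choose w hw using key
    refine ⟨lin fun i => if rk i < n then D (gen i) else w i, fun i hi hin => ?_⟩
    have hbi : lin (fun i => if rk i < n then D (gen i) else w i) (b (gen i)) = D (b (gen i)) := by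
      refine supp_eqOn (fun j hj => ?_) (hb i hi)
      have h3 : rk j < n := by have := hj.2.1; omega
      rw [lin_gen, if_pos h3]
    rw [hbi, lin_gen]
    by_cases h : rk i < n
    · rw [if_pos h]
      exact hD i hi h
    · rw [if_neg h]
      exact hw i hi (by omega)

end general

section lists

variable {X Y : Type*}

/-- Prepending a point to all lists of a chain. -/
noncomputable def cons (x : X) : Chain (List X) →ₗ[ZMod 2] Chain (List X) :=
  lin fun l => gen (x :: l)

theorem cons_gen (x : X) (l : List X) : cons x (gen l) = gen (x :: l) := lin_gen _ _

/-- Boundary of a list: the sum of all lists with one entry omitted. -/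
noncomputable def listBdry : List X → Chain (List X)
  | [] => 0
  | x :: l => gen l + cons x (listBdry l)

/-- Boundary operator on chains of lists. -/
noncomputable def dL : Chain (List X) →ₗ[ZMod 2] Chain (List X) := lin listBdry

theorem dL_nil : dL (gen ([] : List X)) = 0 := lin_gen _ _

theorem dL_cons (x : X) (l : List X) : dL (gen (x :: l)) = gen l + cons x (dL (gen l)) := by
  simp only [dL, lin_gen]; rfl

theorem dL_cons' (x : X) (c : Chain (List X)) : dL (cons x c) = c + cons x (dL c) := by
  have : dL ∘ₗ cons x = LinearMap.id + cons x ∘ₗ dL :=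
    chain_hom_ext fun l => by simp [cons_gen, dL_cons, -Finsupp.smul_single]
  exact LinearMap.congr_fun this c

theorem dL_dL (c : Chain (List X)) : dL (dL c) = 0 := by
  have : dL ∘ₗ dL = (0 : Chain (List X) →ₗ[ZMod 2] _) := chain_hom_ext fun l => by
    induction l with
    | nil => simp [dL_nil]
    | cons x l ih =>
      simp only [LinearMap.comp_apply, LinearMap.zero_apply] at ih ⊢
      rw [dL_cons, map_add, dL_cons', ih, map_zero, add_zero]
      exact ZModModule.add_self _
  exact LinearMap.congr_fun this c

/-- The map on chains of lists induced by a map of points. -/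
noncomputable def push (f : X → Y) : Chain (List X) →ₗ[ZMod 2] Chain (List Y) :=
  lin fun l => gen (l.map f)

theorem push_gen (f : X → Y) (l : List X) : push f (gen l) = gen (l.map f) := lin_gen _ _

theorem push_cons (f : X → Y) (x : X) (c : Chain (List X)) :
    push f (cons x c) = cons (f x) (push f c) := by
  have : push f ∘ₗ cons x = cons (f x) ∘ₗ push f :=
    chain_hom_ext fun l => by simp [cons_gen, push_gen, -Finsupp.smul_single]
  exact LinearMap.congr_fun this c

theorem dL_push (f : X → Y) (c : Chain (List X)) : dL (push f c) = push f (dL c) := by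
  have : dL ∘ₗ push f = push f ∘ₗ dL := chain_hom_ext fun l => by
    induction l with
    | nil => simp [dL_nil, push_gen]
    | cons x l ih =>
      simp only [LinearMap.comp_apply, push_gen] at ih ⊢
      rw [List.map_cons, dL_cons, dL_cons, ih, map_add, push_cons, push_gen]
  exact LinearMap.congr_fun this c

/-- The prism over a list, connecting its images under two maps. -/
noncomputable def listPrism (f g : X → Y) : List X → Chain (List Y)
  | [] => 0
  | x :: l => gen (f x :: g x :: l.map g) + cons (f x) (listPrism f g l)

/-- The prism operator between two maps of points. -/
noncomputable def prism (f g : X → Y) : Chain (List X) →ₗ[ZMod 2] Chain (List Y) :=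
  lin (listPrism f g)

theorem prism_gen_cons (f g : X → Y) (x : X) (l : List X) :
    prism f g (gen (x :: l)) = gen (f x :: g x :: l.map g) + cons (f x) (prism f g (gen l)) := by
  simp only [prism, lin_gen]; rfl

theorem prism_cons (f g : X → Y) (x : X) (c : Chain (List X)) :
    prism f g (cons x c) = cons (f x) (cons (g x) (push g c)) + cons (f x) (prism f g c) := by
  have : prism f g ∘ₗ cons x =
      cons (f x) ∘ₗ cons (g x) ∘ₗ push g + cons (f x) ∘ₗ prism f g :=
    chain_hom_ext fun l => by
      simp [cons_gen, push_gen, prism_gen_cons, -Finsupp.smul_single]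
  exact LinearMap.congr_fun this c

theorem dL_prism (f g : X → Y) (c : Chain (List X)) :
    dL (prism f g c) = prism f g (dL c) + (push f c + push g c) := by
  have : dL ∘ₗ prism f g = prism f g ∘ₗ dL + (push f + push g) := chain_hom_ext fun l => by
    induction l with
    | nil =>
      simp only [LinearMap.comp_apply, LinearMap.add_apply, dL_nil, push_gen, List.map_nil,
        map_zero, ZModModule.add_self]
      simp [prism, lin_gen, listPrism, -Finsupp.linearCombination_single]
    | cons x l ih =>
      simp only [LinearMap.comp_apply, LinearMap.add_apply] at ih ⊢
      have e1 : dL (gen (f x :: g x :: l.map g)) = gen (g x :: l.map g) +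
          (gen (f x :: l.map g) + cons (f x) (cons (g x) (push g (dL (gen l))))) := by
        rw [dL_cons, dL_cons, map_add, cons_gen, ← dL_push, push_gen]
      have e2 : prism f g (dL (gen (x :: l))) = prism f g (gen l) +
          (cons (f x) (cons (g x) (push g (dL (gen l)))) +
            cons (f x) (prism f g (dL (gen l)))) := by
        rw [dL_cons, map_add, prism_cons]
      rw [prism_gen_cons, map_add, dL_cons', ih, e1, e2]
      simp only [map_add, push_gen, cons_gen, List.map_cons]
      generalize gen (g x :: l.map g) = a1, gen (f x :: l.map g) = a2,
        gen (f x :: l.map f) = a3, cons (f x) (cons (g x) (push g (dL (gen l)))) = a4,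
        cons (f x) (prism f g (dL (gen l))) = a5, prism f g (gen l) = a6
      have := ZModModule.add_self a2
      calc _ = (a2 + a2) + (a6 + (a4 + a5) + (a3 + a1)) := by abel
        _ = _ := by rw [this, zero_add]
  exact LinearMap.congr_fun this c

/-- Lists all of whose entries are related by `R`. -/
def listsIn (A : Set X) (R : X → X → Prop) : Set (List X) :=
  {l | (∀ x ∈ l, x ∈ A) ∧ ∀ x ∈ l, ∀ y ∈ l, R x y}

theorem listBdry_mem (l : List X) :
    dL (gen l) ∈ supp {m | m.Sublist l ∧ m.length + 1 = l.length} := by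
  induction l with
  | nil => simp [dL_nil]
  | cons x l ih =>
    rw [dL_cons]
    refine add_mem (gen_mem_supp ⟨by simp, by simp⟩) (supp_induction _ (fun m hm => ?_) ih)
    rw [cons_gen]
    exact gen_mem_supp ⟨by simpa using hm.1, by simpa using hm.2⟩

theorem prism_gen_mem (f g : X → Y) (l : List X) :
    prism f g (gen l) ∈ supp {m | (∀ y ∈ m, ∃ x ∈ l, y = f x ∨ y = g x)} := by
  induction l with
  | nil => simp [prism, listPrism]
  | cons x l ih =>
    rw [prism_gen_cons]
    refine add_mem (gen_mem_supp ?_) (supp_induction _ (fun m hm => ?_) ih)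
    · simp only [Set.mem_ofPred_eq, List.mem_cons, List.mem_map]
      grind
    · rw [cons_gen]
      refine gen_mem_supp ?_
      simp only [Set.mem_ofPred_eq, List.mem_cons] at hm ⊢
      grind

theorem push_mem {A : Set X} {R : X → X → Prop} {B : Set Y} {R' : Y → Y → Prop} (f : X → Y)
    (hA : ∀ x ∈ A, f x ∈ B) (hR : ∀ x ∈ A, ∀ y ∈ A, R x y → R' (f x) (f y))
    {c : Chain (List X)} (hc : c ∈ supp (listsIn A R)) : push f c ∈ supp (listsIn B R') := by
  refine supp_induction _ (fun l hl => ?_) hc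
  rw [push_gen]
  refine gen_mem_supp ⟨?_, ?_⟩ <;> simp only [List.mem_map]
  · rintro _ ⟨x, hx, rfl⟩; exact hA x (hl.1 x hx)
  · rintro _ ⟨x, hx, rfl⟩ _ ⟨y, hy, rfl⟩
    exact hR x (hl.1 x hx) y (hl.1 y hy) (hl.2 x hx y hy)

theorem prism_mem {A : Set X} {R : X → X → Prop} {B : Set Y} {R' : Y → Y → Prop} (f g : X → Y)
    (hf : ∀ x ∈ A, f x ∈ B) (hg : ∀ x ∈ A, g x ∈ B)
    (hR : ∀ x ∈ A, ∀ y ∈ A, R x y →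
      R' (f x) (f y) ∧ R' (f x) (g y) ∧ R' (g x) (f y) ∧ R' (g x) (g y))
    {c : Chain (List X)} (hc : c ∈ supp (listsIn A R)) : prism f g c ∈ supp (listsIn B R') := by
  refine supp_induction _ (fun l hl => ?_) hc
  refine supp_mono (T := listsIn B R') (fun m hm => ⟨fun y hy => ?_, fun y hy z hz => ?_⟩)
    (prism_gen_mem f g l)
  · obtain ⟨x, hx, rfl | rfl⟩ := hm y hy
    exacts [hf x (hl.1 x hx), hg x (hl.1 x hx)]
  · obtain ⟨x, hx, h1⟩ := hm y hy
    obtain ⟨x', hx', h2⟩ := hm z hz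
    have := hR x (hl.1 x hx) x' (hl.1 x' hx') (hl.2 x hx x' hx')
    grind

end lists

section grading

variable {ι : Type*}

open Classical in
/-- Projection of chains to a graded component. -/
noncomputable def proj (rk : ι → ℕ) (k : ℕ) : Chain ι →ₗ[ZMod 2] Chain ι :=
  lin fun i => if rk i = k then gen i else 0

theorem proj_mem (rk : ι → ℕ) (k : ℕ) {S : Set ι} {c : Chain ι} (hc : c ∈ supp S) :
    proj rk k c ∈ supp {i | i ∈ S ∧ rk i = k} := by
  refine supp_induction _ (fun i hi => ?_) hc
  rw [proj, lin_gen]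
  split_ifs with h
  · exact gen_mem_supp ⟨hi, h⟩
  · exact zero_mem _

theorem proj_eq_self (rk : ι → ℕ) (k : ℕ) {c : Chain ι} (hc : c ∈ supp {i | rk i = k}) :
    proj rk k c = c :=
  supp_eqOn (T' := LinearMap.id) (fun i (hi : rk i = k) => by simp [proj, hi]) hc

theorem proj_eq_zero (rk : ι → ℕ) (k : ℕ) {c : Chain ι} (hc : c ∈ supp {i | rk i ≠ k}) :
    proj rk k c = 0 :=
  supp_eqOn (T' := 0) (fun i (hi : rk i ≠ k) => by simp [proj, hi]) hc

theorem proj_comm (rk : ι → ℕ) (b : Chain ι →ₗ[ZMod 2] Chain ι)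
    (hb : ∀ i, b (gen i) ∈ supp {j | rk j + 1 = rk i}) (k : ℕ) (c : Chain ι) :
    b (proj rk (k + 1) c) = proj rk k (b c) := by
  have : b ∘ₗ proj rk (k + 1) = proj rk k ∘ₗ b := chain_hom_ext fun i => by
    simp only [LinearMap.comp_apply]
    by_cases h : rk i = k + 1
    · rw [proj_eq_self rk (k + 1) (gen_mem_supp h), proj_eq_self]
      exact supp_mono (fun j (hj : rk j + 1 = rk i) => by
        change rk j = k; omega) (hb i)
    · rw [proj_eq_zero rk (k + 1) (gen_mem_supp h), proj_eq_zero, map_zero]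
      exact supp_mono (fun j (hj : rk j + 1 = rk i) => by
        change rk j ≠ k; omega) (hb i)
  exact LinearMap.congr_fun this c

end grading

section finsets

/-- Boundary operator on chains of finite sets. -/
noncomputable def dS : Chain (Finset ℕ) →ₗ[ZMod 2] Chain (Finset ℕ) :=
  lin fun s => ∑ v ∈ s, gen (s.erase v)

theorem dS_gen (s : Finset ℕ) : dS (gen s) = ∑ v ∈ s, gen (s.erase v) := lin_gen _ _

theorem dS_gen_mem (s : Finset ℕ) : dS (gen s) ∈ supp {t | t ⊆ s ∧ t.card + 1 = s.card} := by
  rw [dS_gen]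
  exact sum_mem fun v hv => gen_mem_supp ⟨Finset.erase_subset _ _, Finset.card_erase_add_one hv⟩

theorem dS_gen_apply (s t : Finset ℕ) :
    dS (gen s) t = if t ⊆ s ∧ t.card + 1 = s.card then 1 else 0 := by
  rw [dS_gen, Finsupp.finsetSum_apply]
  simp only [Finsupp.single_apply]
  split_ifs with h
  · obtain ⟨v, hv⟩ := Finset.card_eq_one.1
      (show (s \ t).card = 1 by rw [Finset.card_sdiff_of_subset h.1]; omega)
    have hvs : v ∈ s ∧ v ∉ t := by
      have : v ∈ s \ t := by rw [hv]; simp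
      simpa using this
    rw [Finset.sum_eq_single v]
    · rw [if_pos]
      rw [← Finset.sdiff_singleton_eq_erase, ← hv]
      exact Finset.sdiff_sdiff_eq_self h.1
    · intro w hw hwv
      rw [if_neg]
      rintro rfl
      simp at hvs
      grind
    · intro h; exact absurd hvs.1 h
  · refine Finset.sum_eq_zero fun v hv => if_neg ?_
    rintro rfl
    exact h ⟨Finset.erase_subset _ _, Finset.card_erase_add_one hv⟩

/-- Adding a vertex to all sets of a chain. -/
noncomputable def ins (v : ℕ) : Chain (Finset ℕ) →ₗ[ZMod 2] Chain (Finset ℕ) :=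
  lin fun s => if v ∈ s then 0 else gen (insert v s)

theorem ins_gen (v : ℕ) (s : Finset ℕ) :
    ins v (gen s) = if v ∈ s then 0 else gen (insert v s) := lin_gen _ _

theorem dS_ins (v : ℕ) (c : Chain (Finset ℕ)) : dS (ins v c) = c + ins v (dS c) := by
  have : dS ∘ₗ ins v = LinearMap.id + ins v ∘ₗ dS := chain_hom_ext fun s => by
    simp only [LinearMap.comp_apply, LinearMap.add_apply, LinearMap.id_apply, ins_gen]
    split_ifs with h
    · rw [map_zero, dS_gen, map_sum, Finset.sum_eq_single v]
      · rw [ins_gen, if_neg (Finset.notMem_erase _ _), Finset.insert_erase h]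
        exact (ZModModule.add_self _).symm
      · intro w hw hwv
        rw [ins_gen, if_pos]
        exact Finset.mem_erase.2 ⟨hwv.symm, h⟩
      · exact fun h' => absurd h h'
    · rw [dS_gen, Finset.sum_insert h, Finset.erase_insert h, dS_gen, map_sum]
      congr 1
      refine Finset.sum_congr rfl fun w hw => ?_
      have hwv : v ≠ w := by rintro rfl; exact h hw
      rw [ins_gen, if_neg (fun h' => h (Finset.mem_of_mem_erase h')),
        Finset.erase_insert_of_ne hwv]
  exact LinearMap.congr_fun this c

/-- The chain of finite sets underlying a list; lists with repetitions are sent to zero. -/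
noncomputable def listSet : List ℕ → Chain (Finset ℕ)
  | [] => gen ∅
  | v :: l => ins v (listSet l)

/-- The chain map sending lists to finite sets. -/
noncomputable def toSets : Chain (List ℕ) →ₗ[ZMod 2] Chain (Finset ℕ) := lin listSet

theorem toSets_nil : toSets (gen []) = gen ∅ := lin_gen _ _

theorem toSets_cons (v : ℕ) (c : Chain (List ℕ)) : toSets (cons v c) = ins v (toSets c) := by
  have : toSets ∘ₗ cons v = ins v ∘ₗ toSets := chain_hom_ext fun l => by
    simp only [LinearMap.comp_apply, toSets, lin_gen, cons_gen]; rfl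
  exact LinearMap.congr_fun this c

theorem dS_toSets (c : Chain (List ℕ)) : dS (toSets c) = toSets (dL c) := by
  have : dS ∘ₗ toSets = toSets ∘ₗ dL := chain_hom_ext fun l => by
    induction l with
    | nil => simp [dL_nil, toSets_nil, dS, lin_gen, -Finsupp.linearCombination_single]
    | cons v l ih =>
      simp only [LinearMap.comp_apply] at ih ⊢
      rw [← cons_gen, toSets_cons, dS_ins, ih, dL_cons', map_add, toSets_cons]
  exact LinearMap.congr_fun this c

theorem toSets_gen_mem (l : List ℕ) :
    toSets (gen l) ∈ supp {s | s = l.toFinset ∧ s.card = l.length} := by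
  induction l with
  | nil => rw [toSets_nil]; exact gen_mem_supp (by simp)
  | cons v l ih =>
    rw [← cons_gen, toSets_cons]
    refine supp_induction _ (fun s hs => ?_) ih
    rw [ins_gen]
    split_ifs with h
    · exact zero_mem _
    · exact gen_mem_supp (by simp [← hs.1, h, hs.2])

theorem dS_dS (c : Chain (Finset ℕ)) : dS (dS c) = 0 := by
  have : dS ∘ₗ dS = (0 : Chain (Finset ℕ) →ₗ[ZMod 2] _) := chain_hom_ext fun s => by
    simp only [LinearMap.comp_apply, LinearMap.zero_apply]
    induction s using Finset.induction_on with
    | empty => simp [dS_gen]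
    | insert v s hv ih =>
      have h : gen (insert v s) = ins v (gen s) := by rw [ins_gen, if_neg hv]
      rw [h, dS_ins, map_add, dS_ins, ih, map_zero, add_zero]
      exact ZModModule.add_self _
  exact LinearMap.congr_fun this c

end finsets

/-- Faces of `K` with `k` elements. -/
def faces (K : Set (Finset ℕ)) (k : ℕ) : Set (Finset ℕ) := {s | s ∈ K ∧ s.card = k}

/-- Cycles of `K` on faces with `k` elements. -/
noncomputable def cyc (K : Set (Finset ℕ)) (k : ℕ) : Submodule (ZMod 2) (Chain (Finset ℕ)) :=
  supp (faces K k) ⊓ LinearMap.ker dS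

/-- Boundaries of `K` on faces with `k` elements. -/
noncomputable def bnd (K : Set (Finset ℕ)) (k : ℕ) : Submodule (ZMod 2) (Chain (Finset ℕ)) :=
  (supp (faces K (k + 1))).map dS

/-- Reduced mod two Betti number of `K`, indexed by the number of vertices of faces. -/
noncomputable def hdim (K : Set (Finset ℕ)) (k : ℕ) : ℤ :=
  (Module.finrank (ZMod 2) (cyc K k) : ℤ) - Module.finrank (ZMod 2) (bnd K k)

section homology

variable {K L : Set (Finset ℕ)}

theorem dS_mem (hK : IsComplex K) {k : ℕ} {c : Chain (Finset ℕ)}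
    (hc : c ∈ supp (faces K (k + 1))) : dS c ∈ supp (faces K k) := by
  refine supp_induction _ (fun s hs => ?_) hc
  refine supp_mono (T := faces K k) (fun t ht => ⟨hK s hs.1 t ht.1, ?_⟩) (dS_gen_mem s)
  have := ht.2; have := hs.2; omega

theorem bnd_le_cyc (hK : IsComplex K) (k : ℕ) : bnd K k ≤ cyc K k := by
  rintro _ ⟨c, hc, rfl⟩
  exact ⟨dS_mem hK hc, dS_dS c⟩

theorem mem_bnd_of_eq {k : ℕ} {z c : Chain (Finset ℕ)} (hz : z ∈ supp (faces K k))
    (hc : c ∈ supp K) (h : dS c = z) : z ∈ bnd K k := by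
  refine ⟨proj Finset.card (k + 1) c, proj_mem _ _ hc, ?_⟩
  rw [proj_comm _ _ (fun i => supp_mono (fun t ht => ht.2) (dS_gen_mem i)), h, proj_eq_self]
  exact supp_mono (fun s hs => hs.2) hz

theorem finite_supp {S : Set (Finset ℕ)} (h : S.Finite) : Module.Finite (ZMod 2) (supp S) := by
  have := h.to_subtype
  exact Module.Finite.equiv (Finsupp.supportedEquivFinsupp (M := ZMod 2) (R := ZMod 2) S).symm

theorem finrank_supp {S : Set (Finset ℕ)} (h : S.Finite) :
    Module.finrank (ZMod 2) (supp S) = Nat.card S := by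
  have := h.fintype
  rw [(Finsupp.supportedEquivFinsupp (M := ZMod 2) (R := ZMod 2) S).finrank_eq]
  simp

theorem faces_finite (hK : K.Finite) (k : ℕ) : (faces K k).Finite := hK.subset fun _ h => h.1

theorem finite_cyc (hK : K.Finite) (k : ℕ) : Module.Finite (ZMod 2) (cyc K k) := by
  have := finite_supp (faces_finite hK k)
  exact Submodule.finiteDimensional_of_le (inf_le_left : cyc K k ≤ supp (faces K k))

theorem fnum_succ (hK : K.Finite) (k : ℕ) :
    fnum K (k + 1) = Module.finrank (ZMod 2) (cyc K (k + 1)) +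
      Module.finrank (ZMod 2) (bnd K k) := by
  have := finite_supp (faces_finite hK (k + 1))
  let G : supp (faces K (k + 1)) →ₗ[ZMod 2] Chain (Finset ℕ) :=
    dS.domRestrict (supp (faces K (k + 1)))
  have h1 := LinearMap.finrank_range_add_finrank_ker G
  rw [finrank_supp (faces_finite hK _), LinearMap.range_domRestrict,
    LinearMap.ker_domRestrict] at h1
  change Module.finrank (ZMod 2) (bnd K k) + _ = fnum K (k + 1) at h1
  rw [← h1, add_comm]
  congr 1
  exact ((supp (faces K (k + 1))).equivSubtypeMap _).finrank_eq.trans (by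
    rw [Submodule.map_comap_subtype]; rfl)

theorem fnum_zero (hK : K.Finite) : fnum K 0 = Module.finrank (ZMod 2) (cyc K 0) := by
  have h : cyc K 0 = supp (faces K 0) := by
    refine inf_eq_left.2 fun z hz => ?_
    exact supp_eqOn (T' := 0) (fun s hs => by
      rw [Finset.card_eq_zero.1 hs.2, dS_gen]; simp) hz
  rw [h, finrank_supp (faces_finite hK _)]
  rfl

theorem bnd_eq_bot {k : ℕ} (h : ∀ s ∈ K, s.card ≤ k) : bnd K k = ⊥ := by
  have : faces K (k + 1) = ∅ := Set.eq_empty_of_forall_notMem fun s hs => by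
    have := h s hs.1; have := hs.2; omega
  simp [bnd, this]

/-- The Euler–Poincaré formula. -/
theorem euler_poincare (hK : K.Finite) {m : ℕ} (h : ∀ s ∈ K, s.card ≤ m) :
    ∑ k ∈ Finset.range (m + 1), (-1) ^ k * (fnum K k : ℤ) =
      ∑ k ∈ Finset.range (m + 1), (-1) ^ k * hdim K k := by
  have key : ∀ m, ∑ k ∈ Finset.range (m + 1), (-1) ^ k * (fnum K k : ℤ) =
      ∑ k ∈ Finset.range (m + 1), (-1) ^ k * hdim K k +
        (-1) ^ m * Module.finrank (ZMod 2) (bnd K m) := by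
    intro m
    induction m with
    | zero => simp [fnum_zero hK, hdim]
    | succ m ih =>
      rw [Finset.sum_range_succ, ih, Finset.sum_range_succ _ (m + 1), fnum_succ hK, hdim]
      push_cast
      ring
  rw [key, bnd_eq_bot h]
  simp

theorem hdim_le (hK : K.Finite) (hL : L.Finite) (hcL : IsComplex L) (hcK : IsComplex K) {k : ℕ}
    (F : Chain (Finset ℕ) →ₗ[ZMod 2] Chain (Finset ℕ)) (hF : ∀ z ∈ cyc K k, F z ∈ cyc L k)
    (hF' : ∀ z ∈ cyc K k, F z ∈ bnd L k → z ∈ bnd K k) : hdim K k ≤ hdim L k := by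
  have := finite_cyc hK k
  have := finite_cyc hL k
  let B : Submodule (ZMod 2) (cyc L k) := (bnd L k).comap (cyc L k).subtype
  let G : cyc K k →ₗ[ZMod 2] (cyc L k) ⧸ B := B.mkQ ∘ₗ F.restrict hF
  have h1 := LinearMap.finrank_range_add_finrank_ker G
  have h2 := Submodule.finrank_quotient_add_finrank B
  have h3 := Submodule.finrank_le (LinearMap.range G)
  have h4 : Module.finrank (ZMod 2) B = Module.finrank (ZMod 2) (bnd L k) :=
    (Submodule.comapSubtypeEquivOfLe (bnd_le_cyc hcL k)).finrank_eq
  have h5 : Module.finrank (ZMod 2) (LinearMap.ker G) ≤ Module.finrank (ZMod 2) (bnd K k) := by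
    rw [← (Submodule.comapSubtypeEquivOfLe (bnd_le_cyc hcK k)).finrank_eq]
    refine Submodule.finrank_mono fun z hz => ?_
    have : F z ∈ bnd L k := by simpa [G, B] using hz
    exact hF' z z.2 this
  unfold hdim
  omega

theorem cyc_le_bnd (hK : K.Finite) (hc : IsComplex K) {k : ℕ} (h : hdim K k = 0) :
    cyc K k ≤ bnd K k := by
  have := finite_cyc hK k
  refine (Submodule.eq_of_le_of_finrank_eq (bnd_le_cyc hc k) ?_).ge
  unfold hdim at h
  omega

theorem hdim_eq_zero (hc : IsComplex K) {k : ℕ} (h : cyc K k ≤ bnd K k) : hdim K k = 0 := by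
  rw [hdim, le_antisymm h (bnd_le_cyc hc k), sub_self]

end homology

section convex

variable {E : Type*} [AddCommGroup E] [Module ℝ E]

/-- Chains of lists of points of `A` that are pairwise `ε`-close. -/
noncomputable abbrev small (p : Seminorm ℝ E) (ε : ℝ) (A : Set E) :
    Submodule (ZMod 2) (Chain (List E)) :=
  supp (listsIn A fun x y => p (x - y) < ε)

theorem small_mono (p : Seminorm ℝ E) {ε ε' : ℝ} {A B : Set E} (h : ε ≤ ε') (hAB : A ⊆ B) :
    small p ε A ≤ small p ε' B :=
  supp_mono fun _ hl => ⟨fun x hx => hAB (hl.1 x hx),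
    fun x hx y hy => (hl.2 x hx y hy).trans_le h⟩

theorem exists_lt_forall_le (T : Finset ℝ) (ε : ℝ) : ∃ η < ε, ∀ t ∈ T, t < ε → t ≤ η := by
  induction T using Finset.induction_on with
  | empty => exact ⟨ε - 1, by linarith, by simp⟩
  | insert a T _ ih =>
    obtain ⟨η, hη, h⟩ := ih
    by_cases ha : a < ε
    · refine ⟨max η a, max_lt hη ha, fun t ht htε => ?_⟩
      rcases Finset.mem_insert.1 ht with rfl | ht
      · exact le_max_right _ _
      · exact (h t ht htε).trans (le_max_left _ _)
    · refine ⟨η, hη, fun t ht htε => ?_⟩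
      rcases Finset.mem_insert.1 ht with rfl | ht
      · exact absurd htε ha
      · exact h t ht htε

/-- Cycles of `ε`-small lists in a convex set bound. -/
theorem exists_small_of_convex (p : Seminorm ℝ E) {ε : ℝ} {C : Set E} (hC : Convex ℝ C)
    {x₀ : E} (hx₀ : x₀ ∈ C) (hε : 0 < ε) {z : Chain (List E)} (hz : z ∈ small p ε C)
    (hdz : dL z = 0) : ∃ w ∈ small p ε C, dL w = z := by
  classical
  let A : Finset E := z.support.biUnion List.toFinset
  have hA : ∀ l ∈ z.support, ∀ x ∈ l, x ∈ A := fun l hl x hx =>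
    Finset.mem_biUnion.2 ⟨l, hl, List.mem_toFinset.2 hx⟩
  have hAC : ∀ x ∈ A, x ∈ C := fun x hx => by
    obtain ⟨l, hl, hx⟩ := Finset.mem_biUnion.1 hx
    exact (hz hl).1 x (List.mem_toFinset.1 hx)
  obtain ⟨η, hη, hη'⟩ := exists_lt_forall_le ((A ×ˢ A).image fun q => p (q.1 - q.2)) ε
  have hzA : z ∈ supp (listsIn (A : Set E) fun x y => p (x - y) ≤ η) := by
    rw [Finsupp.mem_supported]
    intro l hl
    refine ⟨hA l hl, fun x hx y hy => hη' _ (Finset.mem_image.2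
      ⟨(x, y), Finset.mem_product.2 ⟨hA l hl x hx, hA l hl y hy⟩, rfl⟩) ((hz hl).2 x hx y hy)⟩
  obtain ⟨R, hR'⟩ := (A.image fun x => p (x - x₀)).exists_le
  have hR : ∀ x ∈ A, p (x - x₀) ≤ R := fun x hx => hR' _ (Finset.mem_image_of_mem _ hx)
  obtain ⟨m, hm⟩ := exists_nat_gt (max R 0 / (ε - η))
  have hm0 : (0 : ℝ) < m := lt_of_le_of_lt (div_nonneg (le_max_right _ _) (by linarith)) hm
  have hRm : max R 0 / m < ε - η := by
    rw [div_lt_iff₀ hm0]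
    rwa [div_lt_iff₀ (by linarith), mul_comm] at hm
  let H : ℕ → E → E := fun i x => (1 - (i : ℝ) / m) • x + ((i : ℝ) / m) • x₀
  have hHC : ∀ i ≤ m, ∀ x ∈ A, H i x ∈ C := fun i hi x hx => by
    have h1 : (i : ℝ) / m ≤ 1 := by
      rw [div_le_one hm0]; exact_mod_cast hi
    exact hC (hAC x hx) hx₀ (by linarith) (by positivity) (by ring)
  have hclose : ∀ i j, i + 1 ≤ m → (j = i ∨ j = i + 1) → ∀ x ∈ A, ∀ y ∈ A, p (x - y) ≤ η →
      p (H i x - H j y) < ε ∧ p (H j x - H i y) < ε := by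
    have key : ∀ i j, i + 1 ≤ m → (j = i ∨ j = i + 1) → ∀ x ∈ A, ∀ y ∈ A, p (x - y) ≤ η →
      p (H i x - H j y) < ε := by
      intro i j hi hj x hx y hy hxy
      have e : H i x - H j y = (1 - (i : ℝ) / m) • (x - y) + (((j : ℝ) - i) / m) • (y - x₀) := by
        simp only [H]
        module
      have h1 : (i : ℝ) / m ≤ 1 := by
        rw [div_le_one hm0]; exact_mod_cast (by omega : i ≤ m)
      have h0 : 0 ≤ (i : ℝ) / m := by positivity
      have h2 : 0 ≤ (j : ℝ) - i ∧ (j : ℝ) - i ≤ 1 := by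
        rcases hj with rfl | rfl <;> simp
      have h3 := hR y hy
      have h4 : p (y - x₀) ≤ max R 0 := h3.trans (le_max_left _ _)
      calc p (H i x - H j y)
          ≤ p ((1 - (i : ℝ) / m) • (x - y)) + p ((((j : ℝ) - i) / m) • (y - x₀)) := by
            rw [e]; exact map_add_le_add _ _ _
        _ = (1 - (i : ℝ) / m) * p (x - y) + (((j : ℝ) - i) / m) * p (y - x₀) := by
            rw [map_smul_eq_mul, map_smul_eq_mul, Real.norm_of_nonneg (by linarith),
              Real.norm_of_nonneg (div_nonneg h2.1 hm0.le)]
        _ ≤ 1 * p (x - y) + (1 / m) * max R 0 := by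
            have := apply_nonneg p (x - y)
            have := apply_nonneg p (y - x₀)
            gcongr
            · linarith
            · exact h2.2
        _ < ε := by
            have : (1 / (m : ℝ)) * max R 0 = max R 0 / m := by ring
            linarith
    intro i j hi hj x hx y hy hxy
    refine ⟨key i j hi hj x hx y hy hxy, ?_⟩
    rw [map_sub_rev]
    exact key i j hi hj y hy x hx (by rwa [map_sub_rev])
  have hpush : ∀ i ≤ m, ∃ w ∈ small p ε C, dL w = z + push (H i) z := by
    intro i
    induction i with
    | zero =>
      refine fun _ => ⟨0, zero_mem _, ?_⟩
      have : push (H 0) z = z := by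
        have h : push (H 0) = LinearMap.id := chain_hom_ext fun l => by
          simp [push_gen, H]
        rw [h]; rfl
      rw [this, ZModModule.add_self, map_zero]
    | succ i ih =>
      intro hi
      obtain ⟨w, hw, hdw⟩ := ih (by omega)
      refine ⟨w + prism (H i) (H (i + 1)) z, add_mem hw ?_, ?_⟩
      · refine prism_mem _ _ (hHC i (by omega)) (hHC (i + 1) hi) (fun x hx y hy hxy => ?_) hzA
        have h1 := hclose i i hi (Or.inl rfl) x hx y hy hxy
        have h2 := hclose i (i + 1) hi (Or.inr rfl) x hx y hy hxy
        refine ⟨h1.1, h2.1, h2.2, ?_⟩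
        have e : H (i + 1) x - H (i + 1) y = (1 - ((i + 1 : ℕ) : ℝ) / m) • (x - y) := by
          simp only [H]
          module
        have h3 : ((i + 1 : ℕ) : ℝ) / m ≤ 1 := by
          rw [div_le_one hm0]; exact_mod_cast hi
        have h4 : 0 ≤ ((i + 1 : ℕ) : ℝ) / m := by positivity
        rw [e, map_smul_eq_mul, Real.norm_of_nonneg (by linarith)]
        have := apply_nonneg p (x - y)
        nlinarith
      · rw [map_add, hdw, dL_prism, hdz, map_zero, zero_add]
        have := ZModModule.add_self (push (H i) z)
        calc _ = z + (push (H i) z + push (H i) z) + push (H (i + 1)) z := by abel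
          _ = _ := by rw [this, add_zero]
  obtain ⟨w, hw, hdw⟩ := hpush m le_rfl
  have hH : ∀ x, H m x = x₀ := fun x => by simp [H, div_self hm0.ne']
  refine ⟨w + cons x₀ (push (H m) z), add_mem hw ?_, ?_⟩
  · have hc : push (H m) z ∈ supp (listsIn {x₀} fun _ _ => True) :=
      push_mem (A := A) _ (fun x _ => hH x) (fun _ _ _ _ _ => trivial) hzA
    refine supp_induction _ (fun l hl => ?_) hc
    rw [cons_gen]
    have : ∀ x ∈ x₀ :: l, x = x₀ := by
      intro x hx
      rcases List.mem_cons.1 hx with rfl | hx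
      · rfl
      · exact hl.1 x hx
    refine gen_mem_supp ⟨fun x hx => by rwa [this x hx], fun x hx y hy => ?_⟩
    rw [this x hx, this y hy]
    change p (x₀ - x₀) < ε
    rw [sub_self, map_zero]
    exact hε
  · rw [map_add, hdw, dL_cons', dL_push, hdz, map_zero, map_zero, add_zero, add_assoc,
      ZModModule.add_self, add_zero]

end convex

/-- The geometric simplex with vertex set `s`. -/
def simplex (s : Finset ℕ) : Set (ℕ → ℝ) :=
  {x | (∀ i, 0 ≤ x i) ∧ (∀ i, x i ≠ 0 → i ∈ s) ∧ ∑ i ∈ s, x i = 1}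

section simplex

variable {s t : Finset ℕ} {K : Set (Finset ℕ)}

theorem mem_spaceOf {x : ℕ → ℝ} : x ∈ spaceOf K ↔ ∃ s ∈ K, x ∈ simplex s :=
  ⟨fun ⟨h, s, hs, h1, h2⟩ => ⟨s, hs, h, h1, h2⟩, fun ⟨s, hs, h, h1, h2⟩ => ⟨h, s, hs, h1, h2⟩⟩

theorem mem_simplex_of_subset {x : ℕ → ℝ} (hx : x ∈ simplex t) (h : ∀ i, x i ≠ 0 → i ∈ s) :
    x ∈ simplex s := by
  refine ⟨hx.1, h, ?_⟩
  have h1 : ∑ i ∈ s ∪ t, x i = ∑ i ∈ s, x i :=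
    (Finset.sum_subset Finset.subset_union_left fun i _ hi => by
      by_contra h0; exact hi (h i h0)).symm
  have h2 : ∑ i ∈ s ∪ t, x i = ∑ i ∈ t, x i :=
    (Finset.sum_subset Finset.subset_union_right fun i _ hi => by
      by_contra h0; exact hi (hx.2.1 i h0)).symm
  rw [← h1, h2, hx.2.2]

theorem simplex_mono (h : s ⊆ t) : simplex s ⊆ simplex t := fun _ hx =>
  mem_simplex_of_subset hx fun i hi => h (hx.2.1 i hi)

theorem convex_simplex (s : Finset ℕ) : Convex ℝ (simplex s) := by
  intro x hx y hy a b ha hb hab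
  refine ⟨fun i => ?_, fun i hi => ?_, ?_⟩
  · have := hx.1 i; have := hy.1 i
    simp only [Pi.add_apply, Pi.smul_apply, smul_eq_mul]
    positivity
  · by_contra h
    have h1 : x i = 0 := by by_contra h0; exact h (hx.2.1 i h0)
    have h2 : y i = 0 := by by_contra h0; exact h (hy.2.1 i h0)
    simp [h1, h2] at hi
  · simp only [Pi.add_apply, Pi.smul_apply, smul_eq_mul, Finset.sum_add_distrib, ← Finset.mul_sum,
      hx.2.2, hy.2.2]
    linarith

theorem single_mem_simplex {v : ℕ} (h : v ∈ s) : Pi.single v 1 ∈ simplex s := by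
  refine ⟨fun i => ?_, fun i hi => ?_, ?_⟩
  · by_cases hi : i = v
    · subst hi; simp
    · simp [hi]
  · by_cases hiv : i = v
    · exact hiv ▸ h
    · simp [hiv] at hi
  · rw [Finset.sum_eq_single_of_mem v h (fun i _ hi => by simp [hi])]
    simp

theorem simplex_empty : simplex ∅ = ∅ := Set.eq_empty_of_forall_notMem fun x hx => by
  have := hx.2.2
  simp at this

theorem simplex_subset_spaceOf (h : s ∈ K) : simplex s ⊆ spaceOf K :=
  fun _ hx => mem_spaceOf.2 ⟨s, h, hx⟩

theorem simplex_eq (s : Finset ℕ) : simplex s = (Set.univ.pi fun _ : ℕ => Set.Icc (0 : ℝ) 1) ∩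
    ((⋂ i ∈ {i | i ∉ s}, {x | x i = 0}) ∩ {x | ∑ i ∈ s, x i = 1}) := by
  ext x
  simp only [simplex, Set.mem_inter_iff, Set.mem_pi, Set.mem_Icc, Set.mem_iInter,
    Set.mem_ofPred_eq, Set.mem_univ, forall_true_left]
  constructor
  · rintro ⟨h1, h2, h3⟩
    have h4 : ∀ i ∉ s, x i = 0 := fun i hi => by by_contra h0; exact hi (h2 i h0)
    refine ⟨fun i => ⟨h1 i, ?_⟩, h4, h3⟩
    by_cases hi : i ∈ s
    · rw [← h3]; exact Finset.single_le_sum (fun j _ => h1 j) hi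
    · rw [h4 i hi]; exact zero_le_one
  · rintro ⟨h1, h2, h3⟩
    exact ⟨fun i => (h1 i).1, fun i hi => by by_contra h; exact hi (h2 i h), h3⟩

theorem isCompact_simplex (s : Finset ℕ) : IsCompact (simplex s) := by
  rw [simplex_eq]
  refine (isCompact_univ_pi fun _ => isCompact_Icc).inter_right (IsClosed.inter ?_ ?_)
  · exact isClosed_biInter fun i _ => isClosed_eq (continuous_apply i) continuous_const
  · exact isClosed_eq (continuous_finsetSum _ fun i _ => continuous_apply i) continuous_const

theorem isCompact_spaceOf (hK : K.Finite) : IsCompact (spaceOf K) := by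
  have : spaceOf K = ⋃ s ∈ K, simplex s := by
    ext x; simp [mem_spaceOf]
  rw [this]
  exact hK.isCompact_biUnion fun s _ => isCompact_simplex s

/-- The sum of the absolute values of the first `m` coordinates. -/
noncomputable def l1 (m : ℕ) : Seminorm ℝ (ℕ → ℝ) :=
  Seminorm.of (fun x => ∑ i ∈ Finset.range m, |x i|)
    (fun x y => by
      rw [← Finset.sum_add_distrib]
      exact Finset.sum_le_sum fun i _ => abs_add_le _ _)
    (fun a x => by simp [abs_mul, Finset.mul_sum])

theorem abs_le_l1 {m i : ℕ} (h : i < m) (x : ℕ → ℝ) : |x i| ≤ l1 m x :=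
  Finset.single_le_sum (f := fun i => |x i|) (fun _ _ => abs_nonneg _) (Finset.mem_range.2 h)

theorem continuous_l1 (m : ℕ) : Continuous (l1 m) := by
  change Continuous fun x : ℕ → ℝ => ∑ i ∈ Finset.range m, |x i|
  fun_prop

end simplex

section subdivision

variable {K : Set (Finset ℕ)}

/-- Lists of points of a simplex of the same length as its vertex set, with small mesh. -/
def fineLists (p : Seminorm ℝ (ℕ → ℝ)) (ε : ℝ) (s : Finset ℕ) : Set (List (ℕ → ℝ)) :=
  {l | l ∈ listsIn (simplex s) (fun x y => p (x - y) < ε) ∧ l.length = s.card}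

/-- A chain map subdividing the faces of `K` into simplices of mesh less than `ε`. -/
structure IsSubdivision (K : Set (Finset ℕ)) (p : Seminorm ℝ (ℕ → ℝ)) (ε : ℝ)
    (S : Chain (Finset ℕ) →ₗ[ZMod 2] Chain (List (ℕ → ℝ))) : Prop where
  mem : ∀ s ∈ K, S (gen s) ∈ supp (fineLists p ε s)
  comm : ∀ s ∈ K, dL (S (gen s)) = S (dS (gen s))
  empty : S (gen ∅) = gen []

theorem exists_subdivision (hK : IsComplex K) (hfin : K.Finite) (p : Seminorm ℝ (ℕ → ℝ)) {ε : ℝ}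
    (hε : 0 < ε) : ∃ S, IsSubdivision K p ε S := by
  obtain ⟨n, hn'⟩ := (hfin.image Finset.card).bddAbove
  have hn : ∀ s ∈ K, s.card < n + 1 := fun s hs =>
    Nat.lt_succ_of_le (hn' (Set.mem_image_of_mem _ hs))
  have hb : ∀ s ∈ K, dS (gen s) ∈ supp {t | t ∈ K ∧ t.card < s.card ∧
      small p ε (simplex t) ≤ small p ε (simplex s)} := by
    intro s hs
    refine supp_mono (fun t ht => ?_) (dS_gen_mem s)
    exact ⟨hK s hs t ht.1, by have := ht.2; omega, small_mono p le_rfl (simplex_mono ht.1)⟩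
  obtain ⟨D, hD⟩ := exists_carried dS dS_dS dL Finset.card K (fun s => small p ε (simplex s))
    hb 0 (fun _ _ => zero_mem _) (fun _ _ => by simp)
    (fun s _ h z hz hdz => by
      obtain ⟨v, hv⟩ := Finset.card_ne_zero.1 h
      exact exists_small_of_convex p (convex_simplex s) (single_mem_simplex hv) hε hz hdz)
    (fun _ => gen []) (fun _ _ _ => ⟨gen_mem_supp ⟨by simp, by simp⟩, by simp [dL_nil]⟩) (n + 1)
  have hlen : ∀ l : List (ℕ → ℝ), dL (gen l) ∈ supp {m | m.length + 1 = l.length} :=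
    fun l => supp_mono (fun m hm => hm.2) (listBdry_mem l)
  let S : Chain (Finset ℕ) →ₗ[ZMod 2] Chain (List (ℕ → ℝ)) :=
    lin fun s => if s = ∅ then gen [] else proj List.length s.card (D (gen s))
  have hSe : S (gen ∅) = gen [] := by simp only [S, lin_gen, if_pos]
  have hS : ∀ s ∈ K, S (gen s) = proj List.length s.card (D (gen s)) := by
    intro s hs
    simp only [S, lin_gen]
    split_ifs with h
    · subst h
      rw [(hD _ hs (by simp)).2.2 (by simp), proj_eq_self]
      exact gen_mem_supp rfl
    · rfl
  refine ⟨S, fun s hs => ?_, fun s hs => ?_, hSe⟩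
  · rw [hS s hs]
    exact proj_mem _ _ (hD s hs (hn s hs)).1
  · obtain ⟨k, hk⟩ | h0 : (∃ k, s.card = k + 1) ∨ s.card = 0 := by
      rcases h : s.card with _ | k
      · exact Or.inr rfl
      · exact Or.inl ⟨k, rfl⟩
    · rw [hS s hs, hk, proj_comm _ _ hlen,
        (hD s hs (hn s hs)).2.1, LinearMap.zero_apply, add_zero]
      refine supp_eqOn (T := proj List.length k ∘ₗ D) (fun t ht => ?_) (dS_gen_mem s)
      rw [LinearMap.comp_apply, hS t (hK s hs t ht.1)]
      congr 2
      have := ht.2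
      omega
    · rw [Finset.card_eq_zero.1 h0, hSe, dL_nil, dS_gen]
      simp

variable {p : Seminorm ℝ (ℕ → ℝ)} {ε : ℝ} {S : Chain (Finset ℕ) →ₗ[ZMod 2] Chain (List (ℕ → ℝ))}

theorem IsSubdivision.mem_small (hS : IsSubdivision K p ε S) {z : Chain (Finset ℕ)}
    {s : Finset ℕ} (hz : z ∈ supp {t | t ∈ K ∧ t ⊆ s}) : S z ∈ small p ε (simplex s) :=
  supp_induction S (fun t ht => small_mono p le_rfl (simplex_mono ht.2)
    (supp_mono (fun _ hl => hl.1) (hS.mem t ht.1))) hz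

theorem IsSubdivision.mem_small_spaceOf (hS : IsSubdivision K p ε S) {z : Chain (Finset ℕ)}
    (hz : z ∈ supp K) : S z ∈ small p ε (spaceOf K) :=
  supp_induction S (fun t ht => small_mono p le_rfl (simplex_subset_spaceOf ht)
    (supp_mono (fun _ hl => hl.1) (hS.mem t ht))) hz

theorem IsSubdivision.mem_length (hS : IsSubdivision K p ε S) {k : ℕ} {z : Chain (Finset ℕ)}
    (hz : z ∈ supp (faces K k)) : S z ∈ supp {l | l.length = k} :=
  supp_induction S (fun t ht => (supp_mono (fun _ hl => hl.2.trans ht.2) (hS.mem t ht.1))) hz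

theorem IsSubdivision.dL_eq (hS : IsSubdivision K p ε S) {z : Chain (Finset ℕ)}
    (hz : z ∈ supp K) : dL (S z) = S (dS z) :=
  supp_eqOn (T := dL ∘ₗ S) (T' := S ∘ₗ dS) hS.comm hz

end subdivision

section vertices

open Classical in
/-- An index at which the coordinate of `x` is at least `θ`. -/
noncomputable def vtx (θ : ℝ) (x : ℕ → ℝ) : ℕ := if h : ∃ v, θ ≤ x v then h.choose else 0

variable {K : Set (Finset ℕ)} {M : ℕ} {s : Finset ℕ} {x y : ℕ → ℝ} {θ : ℝ}

theorem le_vtx (hs : s ⊆ Finset.range M) (hθ : M * θ < 1) (hx : x ∈ simplex s) :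
    θ ≤ x (vtx θ x) := by
  have h : ∃ v, θ ≤ x v := by
    by_contra! h
    rcases s.eq_empty_or_nonempty with rfl | hne
    · simp [simplex_empty] at hx
    have h0 : ∀ i, 0 ≤ x i := hx.1
    have h1 : ∑ i ∈ s, x i < ∑ i ∈ s, θ := Finset.sum_lt_sum_of_nonempty hne fun i _ => h i
    rw [hx.2.2, Finset.sum_const, nsmul_eq_mul] at h1
    have h2 : (s.card : ℝ) ≤ M := by
      have := Finset.card_le_card hs
      rw [Finset.card_range] at this
      exact_mod_cast this
    have h3 : 0 < θ := (h0 0).trans_lt (h 0)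
    nlinarith
  rw [vtx, dif_pos h]
  exact h.choose_spec

theorem vtx_mem (hs : s ⊆ Finset.range M) (h0 : 0 < θ) (hθ : M * θ < 1) (hx : x ∈ simplex s) :
    vtx θ x ∈ s :=
  hx.2.1 _ (h0.trans_le (le_vtx hs hθ hx)).ne'

/-- The chain map sending small lists of points to faces. -/
noncomputable def toFaces (θ : ℝ) : Chain (List (ℕ → ℝ)) →ₗ[ZMod 2] Chain (Finset ℕ) :=
  toSets ∘ₗ push (vtx θ)

theorem dS_toFaces (c : Chain (List (ℕ → ℝ))) : dS (toFaces θ c) = toFaces θ (dL c) := by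
  simp only [toFaces, LinearMap.comp_apply, dS_toSets, dL_push]

theorem toFaces_gen_mem (l : List (ℕ → ℝ)) :
    toFaces θ (gen l) ∈ supp {s | s = (l.map (vtx θ)).toFinset ∧ s.card = l.length} := by
  rw [toFaces, LinearMap.comp_apply, push_gen]
  simpa only [List.length_map] using toSets_gen_mem (l.map (vtx θ))

theorem toFaces_nil : toFaces θ (gen []) = gen ∅ := by
  rw [toFaces, LinearMap.comp_apply, push_gen, List.map_nil, toSets_nil]

theorem toFaces_card {k : ℕ} {c : Chain (List (ℕ → ℝ))} (hc : c ∈ supp {l | l.length = k}) :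
    toFaces θ c ∈ supp {s | s.card = k} :=
  supp_induction _ (fun l hl => supp_mono (fun _ hs => hs.2.trans hl) (toFaces_gen_mem l)) hc

theorem toFaces_mem (hK : IsComplex K) (hM : ∀ s ∈ K, s ⊆ Finset.range M) (he : ∅ ∈ K)
    (h0 : 0 < θ) (hθ : M * θ < 1) {c : Chain (List (ℕ → ℝ))}
    (hc : c ∈ small (l1 M) θ (spaceOf K)) : toFaces θ c ∈ supp K := by
  refine supp_induction _ (fun l hl => ?_) hc
  refine supp_mono (fun t ht => ?_) (toFaces_gen_mem l)
  rw [ht.1]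
  rcases l with _ | ⟨x, l⟩
  · simpa using he
  obtain ⟨s, hs, hxs⟩ := mem_spaceOf.1 (hl.1 x (by simp))
  refine hK s hs _ fun v hv => ?_
  obtain ⟨y, hy, rfl⟩ := List.mem_map.1 (List.mem_toFinset.1 hv)
  obtain ⟨t, ht, hyt⟩ := mem_spaceOf.1 (hl.1 y hy)
  have h1 := le_vtx (hM t ht) hθ hyt
  have h2 := Finset.mem_range.1 (hM t ht (vtx_mem (hM t ht) h0 hθ hyt))
  have h3 : l1 M (y - x) < θ := hl.2 y hy x (by simp)
  have h4 := abs_le_l1 h2 (y - x)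
  refine hxs.2.1 _ fun h5 => ?_
  rw [Pi.sub_apply, h5, sub_zero] at h4
  have := le_abs_self (y (vtx θ y))
  linarith

theorem toFaces_subdivision (hK : IsComplex K) (hM : ∀ s ∈ K, s ⊆ Finset.range M)
    (h0 : 0 < θ) (hθ : M * θ < 1) {p : Seminorm ℝ (ℕ → ℝ)} {ε : ℝ}
    {S : Chain (Finset ℕ) →ₗ[ZMod 2] Chain (List (ℕ → ℝ))} (hS : IsSubdivision K p ε S)
    {z : Chain (Finset ℕ)} (hz : z ∈ supp K) : toFaces θ (S z) = z := by
  have key : ∀ n, ∀ s ∈ K, s.card = n → toFaces θ (S (gen s)) = gen s := by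
    intro n
    induction n with
    | zero =>
      intro s _ hn
      rw [Finset.card_eq_zero.1 hn, hS.empty, toFaces_nil]
    | succ n ih =>
      intro s hs hn
      have h1 : toFaces θ (S (gen s)) ∈ supp {s} := by
        refine supp_induction (S := fineLists p ε s) _ (fun l hl => ?_) (hS.mem s hs)
        refine supp_mono (fun t ht => ?_) (toFaces_gen_mem l)
        refine Finset.eq_of_subset_of_card_le (fun v hv => ?_) (by rw [ht.2, hl.2])
        rw [ht.1] at hv
        obtain ⟨y, hy, rfl⟩ := List.mem_map.1 (List.mem_toFinset.1 hv)
        exact vtx_mem (hM s hs) h0 hθ (hl.1.1 y hy)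
      have h2 : dS (toFaces θ (S (gen s))) = dS (gen s) := by
        rw [dS_toFaces, hS.comm s hs]
        exact supp_eqOn (T := toFaces θ ∘ₗ S) (T' := LinearMap.id)
          (fun t ht => ih t (hK s hs t ht.1) (by have := ht.2; omega)) (dS_gen_mem s)
      rw [supp, Finsupp.supported_eq_span_single, Set.image_singleton,
      Submodule.mem_span_singleton] at h1
      obtain ⟨a, ha⟩ := h1
      rw [← ha] at h2 ⊢
      rcases (by decide : ∀ a : ZMod 2, a = 0 ∨ a = 1) a with rfl | rfl
      · exfalso
        obtain ⟨v, hv⟩ : s.Nonempty := Finset.card_pos.1 (by omega)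
        have := congrArg (fun c => c (s.erase v)) h2
        simp only [dS_gen_apply, zero_smul, map_zero] at this
        rw [if_pos ⟨Finset.erase_subset _ _, Finset.card_erase_add_one hv⟩] at this
        exact zero_ne_one this
      · exact one_smul _ _
  exact supp_eqOn (T := toFaces θ ∘ₗ S) (T' := LinearMap.id) (fun s hs => key _ s hs rfl) hz

end vertices

section truncation

variable {K : Set (Finset ℕ)} {M : ℕ} {s : Finset ℕ} {x y : ℕ → ℝ} {δ : ℝ}

/-- The indices of the coordinates of `x` exceeding `δ`. -/
noncomputable def big (M : ℕ) (δ : ℝ) (x : ℕ → ℝ) : Finset ℕ :=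
  {i ∈ Finset.range M | δ < x i}

/-- Lowering all coordinates by `δ` and renormalizing. -/
noncomputable def trunc (M : ℕ) (δ : ℝ) (x : ℕ → ℝ) (i : ℕ) : ℝ :=
  max (x i - δ) 0 / ∑ j ∈ Finset.range M, max (x j - δ) 0

theorem sum_range_eq (hs : s ⊆ Finset.range M) (hx : x ∈ simplex s) :
    ∑ i ∈ Finset.range M, x i = 1 :=
  (mem_simplex_of_subset hx fun i hi => hs (hx.2.1 i hi)).2.2

theorem le_sum_trunc (hs : s ⊆ Finset.range M) (hx : x ∈ simplex s) :
    1 - M * δ ≤ ∑ j ∈ Finset.range M, max (x j - δ) 0 := by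
  calc 1 - M * δ = ∑ j ∈ Finset.range M, (x j - δ) := by
        rw [Finset.sum_sub_distrib, sum_range_eq hs hx]; simp
    _ ≤ _ := Finset.sum_le_sum fun i _ => le_max_left _ _

theorem trunc_mem (hs : s ⊆ Finset.range M) (hδ : 0 ≤ δ) (hMδ : M * δ < 1) (hx : x ∈ simplex s) :
    trunc M δ x ∈ simplex (big M δ x) := by
  have h := le_sum_trunc (δ := δ) hs hx
  have hpos : 0 < ∑ j ∈ Finset.range M, max (x j - δ) 0 := by linarith
  have hsupp : ∀ i, trunc M δ x i ≠ 0 → i ∈ big M δ x := by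
    intro i hi
    have h1 : δ < x i := by
      by_contra! h1
      exact hi (by rw [trunc, max_eq_right (by linarith), zero_div])
    exact Finset.mem_filter.2 ⟨hs (hx.2.1 i (hδ.trans_lt h1).ne'), h1⟩
  refine mem_simplex_of_subset (t := Finset.range M)
    ⟨fun i => div_nonneg (le_max_right _ _) hpos.le,
      fun i hi => (Finset.mem_filter.1 (hsupp i hi)).1, ?_⟩ hsupp
  simp only [trunc]
  rw [← Finset.sum_div, div_self hpos.ne']

theorem l1_sub_trunc (hs : s ⊆ Finset.range M) (hδ : 0 ≤ δ) (hMδ : M * δ < 1)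
    (hx : x ∈ simplex s) : l1 M (x - trunc M δ x) ≤ 2 * (M * δ) := by
  have h := le_sum_trunc (δ := δ) hs hx
  set Y := ∑ j ∈ Finset.range M, max (x j - δ) 0 with hY
  have hpos : 0 < Y := by linarith
  have hx0 : ∀ i, 0 ≤ x i := hx.1
  have hY1 : Y ≤ 1 := by
    rw [← sum_range_eq hs hx]
    exact Finset.sum_le_sum fun i _ => max_le (by linarith) (hx0 i)
  have hi : ∀ i ∈ Finset.range M, |(x - trunc M δ x) i| ≤
      (x i - max (x i - δ) 0) + max (x i - δ) 0 * (1 / Y - 1) := by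
    intro i _
    have e : (x - trunc M δ x) i =
        (x i - max (x i - δ) 0) - max (x i - δ) 0 * (1 / Y - 1) := by
      simp only [Pi.sub_apply, trunc, ← hY]
      ring
    have h1 : 0 ≤ x i - max (x i - δ) 0 := sub_nonneg.2 (max_le (by linarith) (hx0 i))
    have h2 : 0 ≤ max (x i - δ) 0 * (1 / Y - 1) := mul_nonneg (le_max_right _ _) (by
      rw [sub_nonneg, le_div_iff₀ hpos]; linarith)
    rw [e]
    exact abs_le.2 ⟨by linarith, by linarith⟩
  calc l1 M (x - trunc M δ x) ≤ ∑ i ∈ Finset.range M,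
        ((x i - max (x i - δ) 0) + max (x i - δ) 0 * (1 / Y - 1)) := Finset.sum_le_sum hi
    _ = (1 - Y) + Y * (1 / Y - 1) := by
        rw [Finset.sum_add_distrib, Finset.sum_sub_distrib, ← Finset.sum_mul, sum_range_eq hs hx]
    _ = 2 * (1 - Y) := by field_simp; ring
    _ ≤ _ := by linarith

end truncation

section approximation

variable {L : Set (Finset ℕ)} {M : ℕ} {θ ε : ℝ}

/-- Small cycles are homologous, through small chains, to subdivided simplicial cycles. -/
theorem exists_small_homology (hL : IsComplex L) (hM : ∀ s ∈ L, s ⊆ Finset.range M) (he : ∅ ∈ L)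
    (h0 : 0 < θ) (hθ : M * θ < 1) (hε : 0 < ε)
    {S : Chain (Finset ℕ) →ₗ[ZMod 2] Chain (List (ℕ → ℝ))} (hS : IsSubdivision L (l1 M) ε S) :
    ∃ δ > 0, ∀ c ∈ small (l1 M) δ (spaceOf L), dL c = 0 →
      ∃ u ∈ small (l1 M) ε (spaceOf L), dL u = c + S (toFaces θ c) := by
  classical
  obtain ⟨δ, hδ, hδθ, hMδ, hδε⟩ : ∃ δ > 0, δ < θ ∧ M * δ < 1 ∧ δ + 4 * (M * δ) < ε := by
    refine ⟨min (θ / 2) (ε / (2 * (1 + 4 * M))), by positivity, ?_, ?_, ?_⟩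
    · exact (min_le_left _ _).trans_lt (by linarith)
    · have : (M : ℝ) * min (θ / 2) (ε / (2 * (1 + 4 * M))) ≤ M * θ := by
        gcongr
        exact (min_le_left _ _).trans (by linarith)
      linarith
    · have h1 : min (θ / 2) (ε / (2 * (1 + 4 * M))) ≤ ε / (2 * (1 + 4 * M)) := min_le_right _ _
      have h2 : ε / (2 * (1 + 4 * (M : ℝ))) * (1 + 4 * M) = ε / 2 := by field_simp
      nlinarith
  refine ⟨δ, hδ, fun c hc hdc => ?_⟩
  let r := trunc M δ
  let Φ : List (ℕ → ℝ) → Finset ℕ := fun l => l.toFinset.biUnion (big M δ)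
  have hΦmono : ∀ {l m : List (ℕ → ℝ)}, m ⊆ l → Φ m ⊆ Φ l := fun {l m} h =>
    Finset.biUnion_subset_biUnion_of_subset_left _ fun x hx =>
      List.mem_toFinset.2 (h (List.mem_toFinset.1 hx))
  have hbig : ∀ {l : List (ℕ → ℝ)} {x}, x ∈ l → big M δ x ⊆ Φ l := fun hx =>
    Finset.subset_biUnion_of_mem (big M δ) (List.mem_toFinset.2 hx)
  let P := listsIn (spaceOf L) fun x y => l1 M (x - y) < δ
  have hΦ : ∀ l ∈ P, Φ l ∈ L := by
    intro l hl
    rcases l with _ | ⟨x, l⟩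
    · simpa [Φ] using he
    obtain ⟨s, hs, hxs⟩ := mem_spaceOf.1 (hl.1 x (by simp))
    refine hL s hs _ fun i hi => ?_
    obtain ⟨y, hy, hi⟩ := Finset.mem_biUnion.1 hi
    obtain ⟨hiM, hyi⟩ := Finset.mem_filter.1 hi
    have h3 : l1 M (y - x) < δ := hl.2 y (List.mem_toFinset.1 hy) x (by simp)
    have h4 := abs_le_l1 (Finset.mem_range.1 hiM) (y - x)
    refine hxs.2.1 i fun h5 => ?_
    rw [Pi.sub_apply, h5, sub_zero] at h4
    have := le_abs_self (y i)
    linarith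
  have hr : ∀ l ∈ P, ∀ x ∈ l, r x ∈ simplex (Φ l) := by
    intro l hl x hx
    obtain ⟨s, hs, hxs⟩ := mem_spaceOf.1 (hl.1 x hx)
    exact simplex_mono (hbig hx) (trunc_mem (hM s hs) hδ.le hMδ hxs)
  have hrd : ∀ x ∈ spaceOf L, l1 M (x - r x) ≤ 2 * (M * δ) := by
    intro x hx
    obtain ⟨s, hs, hxs⟩ := mem_spaceOf.1 hx
    exact l1_sub_trunc (hM s hs) hδ.le hMδ hxs
  have hclose : ∀ x ∈ spaceOf L, ∀ y ∈ spaceOf L, l1 M (x - y) < δ →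
      l1 M (x - y) < ε ∧ l1 M (x - r y) < ε ∧ l1 M (r x - y) < ε ∧ l1 M (r x - r y) < ε := by
    intro x hx y hy hxy
    have h1 := hrd x hx
    have h2 := hrd y hy
    have h1' := h1
    rw [map_sub_rev] at h1'
    have hp : (0 : ℝ) ≤ M * δ := by positivity
    have e1 : l1 M (x - r y) ≤ l1 M (x - y) + l1 M (y - r y) := by
      rw [← sub_add_sub_cancel x y (r y)]; exact map_add_le_add _ _ _
    have e2 : l1 M (r x - y) ≤ l1 M (r x - x) + l1 M (x - y) := by
      rw [← sub_add_sub_cancel (r x) x y]; exact map_add_le_add _ _ _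
    have e3 : l1 M (r x - r y) ≤ l1 M (r x - x) + l1 M (x - r y) := by
      rw [← sub_add_sub_cancel (r x) x (r y)]; exact map_add_le_add _ _ _
    exact ⟨by linarith, by linarith, by linarith, by linarith⟩
  let T : Chain (List (ℕ → ℝ)) →ₗ[ZMod 2] Chain (List (ℕ → ℝ)) := push r + S ∘ₗ toFaces θ
  have hface : ∀ l ∈ P, toFaces θ (gen l) ∈ supp {t | t ∈ L ∧ t ⊆ Φ l} := by
    intro l hl
    refine supp_mono (fun t ht => ?_) (toFaces_gen_mem l)
    have : t ⊆ Φ l := by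
      rw [ht.1]
      intro v hv
      obtain ⟨y, hy, rfl⟩ := List.mem_map.1 (List.mem_toFinset.1 hv)
      obtain ⟨t, ht, hyt⟩ := mem_spaceOf.1 (hl.1 y hy)
      exact hbig hy (Finset.mem_filter.2 ⟨hM t ht (vtx_mem (hM t ht) h0 hθ hyt),
        hδθ.trans_le (le_vtx (hM t ht) hθ hyt)⟩)
    exact ⟨hL _ (hΦ l hl) t this, this⟩
  have hb : ∀ l ∈ P, dL (gen l) ∈ supp {m | m ∈ P ∧ m.length < l.length ∧
      small (l1 M) ε (simplex (Φ m)) ≤ small (l1 M) ε (simplex (Φ l))} := by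
    intro l hl
    refine supp_mono (fun m hm => ?_) (listBdry_mem l)
    have hsub : m ⊆ l := hm.1.subset
    exact ⟨⟨fun x hx => hl.1 x (hsub hx), fun x hx y hy => hl.2 x (hsub hx) y (hsub hy)⟩,
      by have := hm.2; omega, small_mono _ le_rfl (simplex_mono (hΦmono hsub))⟩
  have hT : ∀ l ∈ P, T (gen l) ∈ small (l1 M) ε (simplex (Φ l)) := by
    intro l hl
    refine add_mem ?_ (hS.mem_small (hface l hl))
    rw [push_gen]
    refine gen_mem_supp ⟨fun z hz => ?_, fun z hz w hw => ?_⟩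
    · obtain ⟨x, hx, rfl⟩ := List.mem_map.1 hz
      exact hr l hl x hx
    · obtain ⟨x, hx, rfl⟩ := List.mem_map.1 hz
      obtain ⟨y, hy, rfl⟩ := List.mem_map.1 hw
      exact (hclose x (hl.1 x hx) y (hl.1 y hy) (hl.2 x hx y hy)).2.2.2
  have hTb : ∀ l ∈ P, dL (T (gen l)) = T (dL (gen l)) := by
    intro l hl
    simp only [T, LinearMap.add_apply, LinearMap.comp_apply, map_add, dL_push]
    rw [hS.dL_eq (supp_mono (fun t ht => ht.1) (hface l hl)), dS_toFaces]
  obtain ⟨n, hn⟩ := (c.support.image List.length).exists_le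
  obtain ⟨D, hD⟩ := exists_carried dL dL_dL dL List.length P
    (fun l => small (l1 M) ε (simplex (Φ l))) hb T hT hTb
    (fun l hl h z hz hdz => by
      obtain ⟨x, hx⟩ := List.exists_mem_of_length_pos (Nat.pos_of_ne_zero h)
      exact exists_small_of_convex _ (convex_simplex _) (hr l hl x hx) hε hz hdz)
    (fun _ => 0) (fun l _ h => by
      rw [List.length_eq_zero_iff.1 h]
      refine ⟨zero_mem _, ?_⟩
      simp only [T, LinearMap.add_apply, LinearMap.comp_apply, toFaces_nil, hS.empty, push_gen,
        List.map_nil, ZModModule.add_self, map_zero]) (n + 1)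
  have hc' : c ∈ supp {l | l ∈ P ∧ l.length < n + 1} := by
    rw [Finsupp.mem_supported]
    exact fun l hl => ⟨hc hl, Nat.lt_succ_of_le (hn _ (Finset.mem_image_of_mem _ hl))⟩
  refine ⟨prism id r c + D c, add_mem ?_ ?_, ?_⟩
  · refine prism_mem id r (fun x hx => hx) (fun x hx => ?_) hclose hc
    have hx' : [x] ∈ P := ⟨by simpa using hx, by simpa using hδ⟩
    exact simplex_subset_spaceOf (hΦ _ hx') (hr [x] hx' x (by simp))
  · refine supp_induction D (fun l hl => ?_) hc'
    exact small_mono _ le_rfl (simplex_subset_spaceOf (hΦ l hl.1)) (hD l hl.1 hl.2).1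
  · have h1 : dL (D c) = D (dL c) + T c :=
      supp_eqOn (T := dL ∘ₗ D) (T' := D ∘ₗ dL + T) (fun l hl => (hD l hl.1 hl.2).2.1) hc'
    have h2 : push id c = c := supp_eqOn (T := push id) (T' := LinearMap.id)
      (fun l _ => by simp [push_gen]) hc
    rw [map_add, h1, dL_prism, hdc, map_zero, map_zero, zero_add, zero_add, h2]
    simp only [T, LinearMap.add_apply, LinearMap.comp_apply]
    have := ZModModule.add_self (push r c)
    calc _ = c + (push r c + push r c) + S (toFaces θ c) := by abel
      _ = _ := by rw [this, add_zero]

end approximation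

theorem exists_modulus {Z : Type*} [TopologicalSpace Z] {T : Set Z} (hT : IsCompact T)
    {a b : Z → ℝ} (ha : ContinuousOn a T) (hb : ContinuousOn b T) {ε : ℝ}
    (h : ∀ z ∈ T, ε ≤ a z → 0 < b z) : ∃ δ > 0, ∀ z ∈ T, b z < δ → a z < ε := by
  obtain ⟨C, hC, hC'⟩ := continuousOn_iff_isClosed.1 ha (Set.Ici ε) isClosed_Ici
  have hcomp : IsCompact (C ∩ T) := hT.inter_left hC
  obtain ⟨δ, hδ, h1⟩ := hcomp.exists_forall_le' (hb.mono Set.inter_subset_right) (a := 0)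
    (fun z hz => h z hz.2 (hC' ▸ hz : z ∈ a ⁻¹' Set.Ici ε ∩ T).1)
  refine ⟨δ, hδ, fun z hz hbz => ?_⟩
  by_contra! hlt
  exact absurd (h1 z (hC' ▸ (⟨hlt, hz⟩ : z ∈ a ⁻¹' Set.Ici ε ∩ T))) (not_le.2 hbz)

section homotopy

variable {K L : Set (Finset ℕ)} {M : ℕ}

theorem eq_of_l1_eq_zero (hM : ∀ s ∈ K, s ⊆ Finset.range M) {x y : ℕ → ℝ} (hx : x ∈ spaceOf K)
    (hy : y ∈ spaceOf K) (h : l1 M (x - y) ≤ 0) : x = y := by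
  obtain ⟨s, hs, hx⟩ := mem_spaceOf.1 hx
  obtain ⟨t, ht, hy⟩ := mem_spaceOf.1 hy
  ext i
  by_cases hi : i < M
  · have := (abs_le_l1 hi (x - y)).trans h
    exact sub_eq_zero.1 (abs_eq_zero.1 (le_antisymm this (abs_nonneg _)))
  · have h1 : x i = 0 := by
      by_contra h0; exact hi (Finset.mem_range.1 (hM s hs (hx.2.1 i h0)))
    have h2 : y i = 0 := by
      by_contra h0; exact hi (Finset.mem_range.1 (hM t ht (hy.2.1 i h0)))
    rw [h1, h2]

theorem exists_unif (hK : K.Finite) (hM : ∀ s ∈ K, s ⊆ Finset.range M)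
    {H : ℝ → (ℕ → ℝ) → (ℕ → ℝ)}
    (hH : ContinuousOn (Function.uncurry H) (Set.Icc 0 1 ×ˢ spaceOf K)) {ε : ℝ} (hε : 0 < ε) :
    ∃ δ > 0, ∀ s ∈ Set.Icc (0 : ℝ) 1, ∀ t ∈ Set.Icc (0 : ℝ) 1, |s - t| < δ →
      ∀ x ∈ spaceOf K, ∀ y ∈ spaceOf K, l1 M (x - y) < δ → l1 M (H s x - H t y) < ε := by
  have hc : IsCompact (Set.Icc (0 : ℝ) 1 ×ˢ spaceOf K) := isCompact_Icc.prod (isCompact_spaceOf hK)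
  obtain ⟨δ, hδ, h⟩ := exists_modulus (hc.prod hc)
    (a := fun z => l1 M (Function.uncurry H z.1 - Function.uncurry H z.2))
    (b := fun z => |z.1.1 - z.2.1| + l1 M (z.1.2 - z.2.2)) (ε := ε)
    ((continuous_l1 M).comp_continuousOn
      ((hH.comp continuousOn_fst fun z hz => hz.1).sub
        (hH.comp continuousOn_snd fun z hz => hz.2)))
    (by
      have := continuous_l1 M
      fun_prop)
    (fun z hz hle => by
      by_contra! h0
      have h1 := abs_nonneg (z.1.1 - z.2.1)
      have h2 := apply_nonneg (l1 M) (z.1.2 - z.2.2)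
      have h3 : z.1.1 = z.2.1 := sub_eq_zero.1 (abs_eq_zero.1 (by linarith))
      have h4 := eq_of_l1_eq_zero hM hz.1.2 hz.2.2 (by linarith)
      rw [Prod.ext h3 h4, sub_self, map_zero] at hle
      linarith)
  refine ⟨δ / 2, by positivity, fun s hs t ht hst x hx y hy hxy =>
    h ((s, x), (t, y)) ⟨⟨hs, hx⟩, ⟨ht, hy⟩⟩ ?_⟩
  change |s - t| + l1 M (x - y) < δ
  linarith

theorem exists_homotopy_chain (hK : K.Finite) (hM : ∀ s ∈ K, s ⊆ Finset.range M)
    {H : ℝ → (ℕ → ℝ) → (ℕ → ℝ)}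
    (hH : ContinuousOn (Function.uncurry H) (Set.Icc 0 1 ×ˢ spaceOf K))
    (hm : ∀ t ∈ Set.Icc (0 : ℝ) 1, Set.MapsTo (H t) (spaceOf K) (spaceOf L))
    {ε : ℝ} (hε : 0 < ε) :
    ∃ δ > 0, ∀ c ∈ small (l1 M) δ (spaceOf K), dL c = 0 →
      ∃ u ∈ small (l1 M) ε (spaceOf L), dL u = push (H 0) c + push (H 1) c := by
  obtain ⟨δ, hδ, h⟩ := exists_unif hK hM hH hε
  refine ⟨δ, hδ, fun c hc hdc => ?_⟩
  obtain ⟨m, hm'⟩ := exists_nat_gt (1 / δ)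
  have hm0 : (0 : ℝ) < m := lt_trans (by positivity) hm'
  have hmδ : 1 / (m : ℝ) < δ := by
    rw [div_lt_iff₀ hm0]; rwa [div_lt_iff₀ hδ, mul_comm] at hm'
  have hI : ∀ i ≤ m, (i : ℝ) / m ∈ Set.Icc (0 : ℝ) 1 := fun i hi =>
    ⟨by positivity, by rw [div_le_one hm0]; exact_mod_cast hi⟩
  have key : ∀ i ≤ m, ∃ u ∈ small (l1 M) ε (spaceOf L),
      dL u = push (H 0) c + push (H (i / m)) c := by
    intro i
    induction i with
    | zero => exact fun _ => ⟨0, zero_mem _, by simp [ZModModule.add_self]⟩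
    | succ i ih =>
      intro hi
      obtain ⟨u, hu, hdu⟩ := ih (by omega)
      have h1 := hI i (by omega)
      have h2 := hI (i + 1) hi
      have h3 : |((i + 1 : ℕ) : ℝ) / m - i / m| < δ := by
        have : ((i + 1 : ℕ) : ℝ) / m - i / m = 1 / m := by push_cast; ring
        rw [this, abs_of_pos (by positivity)]
        exact hmδ
      refine ⟨u + prism (H (i / m)) (H ((i + 1 : ℕ) / m)) c, add_mem hu ?_, ?_⟩
      · refine prism_mem _ _ (hm _ h1) (hm _ h2) (fun x hx y hy hxy => ⟨?_, ?_, ?_, ?_⟩) hc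
        · exact h _ h1 _ h1 (by simpa using hδ) x hx y hy hxy
        · exact h _ h1 _ h2 (by rwa [abs_sub_comm]) x hx y hy hxy
        · exact h _ h2 _ h1 h3 x hx y hy hxy
        · exact h _ h2 _ h2 (by simpa using hδ) x hx y hy hxy
      · rw [map_add, hdu, dL_prism, hdc, map_zero, zero_add]
        have := ZModModule.add_self (push (H (i / m)) c)
        calc _ = push (H 0) c + (push (H (i / m)) c + push (H (i / m)) c) +
              push (H ((i + 1 : ℕ) / m)) c := by abel
          _ = _ := by rw [this, add_zero]
  obtain ⟨u, hu, hdu⟩ := key m le_rfl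
  exact ⟨u, hu, by rwa [div_self hm0.ne'] at hdu⟩

theorem hdim_le_of_homotopy (hK : IsComplex K) (hfK : K.Finite) (heK : ∅ ∈ K)
    (hL : IsComplex L) (hfL : L.Finite) (heL : ∅ ∈ L) {f g : (ℕ → ℝ) → (ℕ → ℝ)}
    (hf : ContinuousOn f (spaceOf K)) (hfm : Set.MapsTo f (spaceOf K) (spaceOf L))
    (hg : ContinuousOn g (spaceOf L)) (hgm : Set.MapsTo g (spaceOf L) (spaceOf K))
    {H : ℝ → (ℕ → ℝ) → (ℕ → ℝ)}
    (hH : ContinuousOn (Function.uncurry H) (Set.Icc 0 1 ×ˢ spaceOf K))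
    (hm : ∀ t ∈ Set.Icc (0 : ℝ) 1, Set.MapsTo (H t) (spaceOf K) (spaceOf K))
    (hH0 : ∀ x ∈ spaceOf K, H 0 x = x) (hH1 : ∀ x ∈ spaceOf K, H 1 x = g (f x)) (k : ℕ) :
    hdim K k ≤ hdim L k := by
  obtain ⟨M, hM⟩ : ∃ M, ∀ s ∈ K ∪ L, s ⊆ Finset.range M := by
    obtain ⟨M, hM⟩ := ((hfK.union hfL).image fun s => s.sup id).bddAbove
    refine ⟨M + 1, fun s hs i hi => Finset.mem_range.2 (Nat.lt_succ_of_le ?_)⟩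
    exact (Finset.le_sup (f := id) hi).trans (hM (Set.mem_image_of_mem _ hs))
  have hMK : ∀ s ∈ K, s ⊆ Finset.range M := fun s hs => hM s (Or.inl hs)
  have hML : ∀ s ∈ L, s ⊆ Finset.range M := fun s hs => hM s (Or.inr hs)
  obtain ⟨θ, hθ, hMθ⟩ : ∃ θ : ℝ, 0 < θ ∧ M * θ < 1 :=
    ⟨1 / (M + 1), by positivity, by rw [mul_one_div, div_lt_one (by positivity)]; linarith⟩
  have hconst : ∀ {A : Set (Finset ℕ)} {f : (ℕ → ℝ) → (ℕ → ℝ)}, ContinuousOn f (spaceOf A) →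
      ContinuousOn (Function.uncurry fun _ : ℝ => f) (Set.Icc 0 1 ×ˢ spaceOf A) := fun h =>
    h.comp continuousOn_snd fun z hz => hz.2
  have h01 : (0 : ℝ) ∈ Set.Icc (0 : ℝ) 1 := ⟨le_rfl, zero_le_one⟩
  have hunif : ∀ {A : Set (Finset ℕ)} {f : (ℕ → ℝ) → (ℕ → ℝ)}, A.Finite →
      (∀ s ∈ A, s ⊆ Finset.range M) → ContinuousOn f (spaceOf A) → ∀ ε > 0, ∃ δ > 0,
      ∀ x ∈ spaceOf A, ∀ y ∈ spaceOf A, l1 M (x - y) < δ → l1 M (f x - f y) < ε := by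
    intro A f hA hM hf ε hε
    obtain ⟨δ, hδ, h⟩ := exists_unif hA hM (hconst hf) hε
    exact ⟨δ, hδ, h 0 h01 0 h01 (by simpa using hδ)⟩
  obtain ⟨η, hη, hgη⟩ := hunif hfL hML hg θ hθ
  obtain ⟨SL, hSL⟩ := exists_subdivision hL hfL (l1 M) hη
  obtain ⟨δ, hδ, happrox⟩ := exists_small_homology hL hML heL hθ hMθ hη hSL
  obtain ⟨μ₁, hμ₁, hfμ⟩ := hunif hfK hMK hf (min δ θ) (lt_min hδ hθ)
  obtain ⟨μ₂, hμ₂, hHμ⟩ := exists_homotopy_chain hfK hMK hH hm hθ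
  obtain ⟨SK, hSK⟩ := exists_subdivision hK hfK (l1 M) (lt_min (lt_min hμ₁ hμ₂) hθ)
  have hSKle : ∀ {z}, z ∈ supp K → SK z ∈ small (l1 M) μ₁ (spaceOf K) ∧
      SK z ∈ small (l1 M) μ₂ (spaceOf K) ∧ SK z ∈ small (l1 M) θ (spaceOf K) := fun hz =>
    ⟨small_mono _ ((min_le_left _ _).trans (min_le_left _ _)) le_rfl (hSK.mem_small_spaceOf hz),
      small_mono _ ((min_le_left _ _).trans (min_le_right _ _)) le_rfl (hSK.mem_small_spaceOf hz),
      small_mono _ (min_le_right _ _) le_rfl (hSK.mem_small_spaceOf hz)⟩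
  have hcycK : ∀ {z}, z ∈ cyc K k → z ∈ supp K ∧ dL (SK z) = 0 := by
    intro z hz
    have h1 : z ∈ supp K := supp_mono (fun s hs => hs.1) hz.1
    exact ⟨h1, by rw [hSK.dL_eq h1, LinearMap.mem_ker.1 hz.2, map_zero]⟩
  have hpush : ∀ {z}, z ∈ supp K → push f (SK z) ∈ small (l1 M) (min δ θ) (spaceOf L) :=
    fun hz => push_mem f hfm hfμ (hSKle hz).1
  refine hdim_le hfK hfL hL hK (toFaces θ ∘ₗ push f ∘ₗ SK) (fun z hz => ⟨?_, ?_⟩)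
    (fun z hz hb => ?_)
  · have h1 : toFaces θ (push f (SK z)) ∈ supp L :=
      toFaces_mem hL hML heL hθ hMθ (small_mono _ (min_le_right _ _) le_rfl (hpush (hcycK hz).1))
    have h2 : push f (SK z) ∈ supp {l | l.length = k} :=
      supp_induction (push f) (fun l hl => by
        rw [push_gen]; exact gen_mem_supp (by simpa using hl)) (hSK.mem_length hz.1)
    have h3 := proj_mem Finset.card k h1
    rwa [proj_eq_self Finset.card k (toFaces_card h2)] at h3
  · change dS _ = 0
    rw [LinearMap.comp_apply, LinearMap.comp_apply, dS_toFaces, dL_push,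
      (hcycK hz).2, map_zero, map_zero]
  · obtain ⟨w, hw, hdw⟩ := hb
    obtain ⟨hzK, hdz⟩ := hcycK hz
    have hwL : w ∈ supp L := supp_mono (fun s hs => hs.1) hw
    obtain ⟨u, hu, hdu⟩ := happrox _ (small_mono _ (min_le_left _ _) le_rfl (hpush hzK))
      (by rw [dL_push, hdz, map_zero])
    have h1 : dL (u + SL w) = push f (SK z) := by
      rw [map_add, hdu, hSL.dL_eq hwL, hdw]
      simp only [LinearMap.comp_apply]
      rw [add_assoc, ZModModule.add_self, add_zero]
    have h2 : push g (u + SL w) ∈ small (l1 M) θ (spaceOf K) :=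
      push_mem g hgm hgη (add_mem hu (hSL.mem_small_spaceOf hwL))
    obtain ⟨v, hv, hdv⟩ := hHμ _ (hSKle hzK).2.1 hdz
    have h3 : push (H 0) (SK z) = SK z :=
      supp_eqOn (T := push (H 0)) (T' := LinearMap.id) (fun l hl => by
        rw [push_gen, LinearMap.id_apply, List.map_congr_left fun x hx => hH0 x (hl.1 x hx),
          List.map_id']) (hSK.mem_small_spaceOf hzK)
    have h4 : push (H 1) (SK z) = push g (push f (SK z)) :=
      supp_eqOn (T := push (H 1)) (T' := push g ∘ₗ push f) (fun l hl => by
        rw [push_gen, LinearMap.comp_apply, push_gen, push_gen, List.map_map,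
          List.map_congr_left fun x hx => hH1 x (hl.1 x hx)]
        rfl) (hSK.mem_small_spaceOf hzK)
    refine mem_bnd_of_eq hz.1 (toFaces_mem hK hMK heK hθ hMθ (add_mem hv h2)) ?_
    rw [dS_toFaces, map_add, hdv, dL_push, h1, h3, h4, add_assoc, ZModModule.add_self, add_zero,
      toFaces_subdivision hK hMK hθ hMθ hSK hzK]

/-- Mod two Betti numbers are homotopy invariant. -/
theorem hdim_eq_of_homotopyEquiv (hK : IsComplex K) (hfK : K.Finite) (heK : ∅ ∈ K)
    (hL : IsComplex L) (hfL : L.Finite) (heL : ∅ ∈ L)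
    (e : ContinuousMap.HomotopyEquiv (spaceOf K) (spaceOf L)) (k : ℕ) : hdim K k = hdim L k := by
  classical
  have key : ∀ {K L : Set (Finset ℕ)}, IsComplex K → K.Finite → ∅ ∈ K → IsComplex L → L.Finite →
      ∅ ∈ L → ContinuousMap.HomotopyEquiv (spaceOf K) (spaceOf L) → hdim K k ≤ hdim L k := by
    intro K L hK hfK heK hL hfL heL e
    let ext {A B : Set (Finset ℕ)} (f : spaceOf A → spaceOf B) : (ℕ → ℝ) → (ℕ → ℝ) :=
      fun x => if h : x ∈ spaceOf A then f ⟨x, h⟩ else x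
    have hext : ∀ {A B : Set (Finset ℕ)} (f : spaceOf A → spaceOf B) (x : spaceOf A),
        ext f x = f x := fun f x => dif_pos x.2
    have hc : ∀ {A B : Set (Finset ℕ)} (f : C(spaceOf A, spaceOf B)),
        ContinuousOn (ext f) (spaceOf A) := by
      intro A B f
      rw [continuousOn_iff_continuous_domRestrict]
      have : (spaceOf A).domRestrict (ext f) = fun x => (f x : ℕ → ℝ) := funext (hext f)
      rw [this]
      fun_prop
    have hmaps : ∀ {A B : Set (Finset ℕ)} (f : spaceOf A → spaceOf B),
        Set.MapsTo (ext f) (spaceOf A) (spaceOf B) := by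
      intro A B f x hx
      rw [hext f ⟨x, hx⟩]
      exact (f ⟨x, hx⟩).2
    obtain ⟨H⟩ := e.left_inv.symm
    let G : ℝ → (ℕ → ℝ) → (ℕ → ℝ) := fun t =>
      ext fun x => H (Set.projIcc 0 1 zero_le_one t, x)
    refine hdim_le_of_homotopy hK hfK heK hL hfL heL (hc e.toFun) (hmaps e.toFun) (hc e.invFun)
      (hmaps e.invFun) (H := G) ?_
      (fun t _ => hmaps fun x => H (Set.projIcc 0 1 zero_le_one t, x))
      (fun x hx => ?_) (fun x hx => ?_) k
    · rw [continuousOn_iff_continuous_domRestrict]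
      have : (Set.Icc (0 : ℝ) 1 ×ˢ spaceOf K).domRestrict (Function.uncurry G) = fun z =>
          (H (Set.projIcc 0 1 zero_le_one z.1.1, ⟨z.1.2, z.2.2⟩) : ℕ → ℝ) :=
        funext fun z =>
          hext (fun x => H (Set.projIcc 0 1 zero_le_one z.1.1, x)) ⟨z.1.2, z.2.2⟩
      rw [this]
      fun_prop
    · have := hext (fun x => H (Set.projIcc 0 1 zero_le_one 0, x)) ⟨x, hx⟩
      refine this.trans ?_
      rw [Set.projIcc_left]
      exact congrArg Subtype.val (H.apply_zero ⟨x, hx⟩)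
    · have := hext (fun x => H (Set.projIcc 0 1 zero_le_one 1, x)) ⟨x, hx⟩
      refine this.trans ?_
      rw [Set.projIcc_right]
      refine (congrArg Subtype.val (H.apply_one ⟨x, hx⟩)).trans ?_
      rw [hext e.toFun ⟨x, hx⟩, hext e.invFun]
      rfl
  exact le_antisymm (key hK hfK heK hL hfL heL e) (key hL hfL heL hK hfK heK e.symm)

end homotopy

open ContinuousMap

section segments

variable {E F X : Type*} [AddCommGroup E] [Module ℝ E] [TopologicalSpace E]
  [IsTopologicalAddGroup E] [ContinuousSMul ℝ E] [AddCommGroup F] [Module ℝ F] [TopologicalSpace F]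
  [IsTopologicalAddGroup F] [ContinuousSMul ℝ F] [TopologicalSpace X]

theorem homotopic_of_segment {A : Set E} (f g : C(X, A))
    (h : ∀ x, segment ℝ (f x : E) (g x) ⊆ A) : f.Homotopic g := by
  have hmem : ∀ (t : unitInterval) (x : X),
      (1 - (t : ℝ)) • (f x : E) + (t : ℝ) • (g x : E) ∈ A := fun t x =>
    h x ⟨1 - t, t, sub_nonneg.2 t.2.2, t.2.1, by ring, rfl⟩
  exact ⟨{
    toFun := fun z => ⟨_, hmem z.1 z.2⟩
    continuous_toFun := by fun_prop
    map_zero_left := fun x => Subtype.ext (by simp)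
    map_one_left := fun x => Subtype.ext (by simp) }⟩

theorem homotopyEquiv_of_segment {A : Set E} {B : Set F} {f : E → F} {g : F → E}
    (hf : ContinuousOn f A) (hfm : Set.MapsTo f A B) (hg : ContinuousOn g B)
    (hgm : Set.MapsTo g B A) (hA : ∀ x ∈ A, segment ℝ x (g (f x)) ⊆ A)
    (hB : ∀ y ∈ B, segment ℝ y (f (g y)) ⊆ B) : Nonempty (HomotopyEquiv A B) := by
  let f' : C(A, B) := ⟨hfm.restrict, hf.mapsToRestrict hfm⟩
  let g' : C(B, A) := ⟨hgm.restrict, hg.mapsToRestrict hgm⟩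
  exact ⟨⟨f', g', (homotopic_of_segment (ContinuousMap.id A) (g'.comp f') fun x => hA x x.2).symm,
    (homotopic_of_segment (ContinuousMap.id B) (f'.comp g') fun x => hB x x.2).symm⟩⟩

end segments

/-- The faces of `K` not containing `τ`. -/
def del (K : Set (Finset ℕ)) (τ : Finset ℕ) : Set (Finset ℕ) := {s | s ∈ K ∧ ¬ τ ⊆ s}

theorem isComplex_del {K : Set (Finset ℕ)} (hK : IsComplex K) (τ : Finset ℕ) :
    IsComplex (del K τ) := fun s hs t ht =>
  ⟨hK s hs.1 t ht, fun h => hs.2 (h.trans ht)⟩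

theorem homotopyEquiv_del {K : Set (Finset ℕ)} (hK : IsComplex K) {τ : Finset ℕ} {p : ℕ → ℝ}
    (hp : p ∈ simplex τ) (hpτ : ∀ i ∈ τ, 0 < p i) :
    Nonempty (HomotopyEquiv (spaceOf K \ {p} : Set (ℕ → ℝ)) (spaceOf (del K τ))) := by
  have hne : τ.Nonempty := by
    rcases τ.eq_empty_or_nonempty with rfl | h
    · simp [simplex_empty] at hp
    · exact h
  have hp0 : ∀ i ∉ τ, p i = 0 := fun i hi => by
    by_contra h; exact hi (hp.2.1 i h)
  let m : (ℕ → ℝ) → ℝ := fun q => τ.inf' hne fun v => q v / p v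
  have hmc : Continuous m := Continuous.finset_inf'_apply hne fun v _ => by fun_prop
  let f : (ℕ → ℝ) → (ℕ → ℝ) := fun q => (1 - m q)⁻¹ • (q - m q • p)
  have hmle : ∀ q, ∀ v ∈ τ, m q * p v ≤ q v := fun q v hv => by
    have : m q ≤ q v / p v := Finset.inf'_le _ hv
    rwa [le_div_iff₀ (hpτ v hv)] at this
  have hm0 : ∀ q, (∀ i, 0 ≤ q i) → 0 ≤ m q := fun q hq =>
    Finset.le_inf' _ _ fun v hv => div_nonneg (hq v) (hpτ v hv).le
  have hmin : ∀ q, ∃ v ∈ τ, q v = m q * p v := fun q => by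
    obtain ⟨v, hv, h⟩ := Finset.exists_mem_eq_inf' hne fun v => q v / p v
    exact ⟨v, hv, by simp only [m]; rw [h, div_mul_cancel₀ _ (hpτ v hv).ne']⟩
  have hmz : ∀ q, (∀ i, 0 ≤ q i) → ∀ v ∈ τ, q v = 0 → m q = 0 := fun q hq v hv h => by
    have h1 := hmle q v hv
    have h2 := hm0 q hq
    have h3 := hpτ v hv
    rw [h] at h1
    nlinarith
  have hsum : ∀ {s : Finset ℕ} {q : ℕ → ℝ}, q ∈ simplex s →
      ∑ i ∈ s ∪ τ, (q i - m q * p i) = 1 - m q := by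
    intro s q hq
    rw [Finset.sum_sub_distrib, ← Finset.mul_sum,
      (simplex_mono Finset.subset_union_right hp).2.2,
      (simplex_mono Finset.subset_union_left hq).2.2, mul_one]
  have hnn : ∀ {s : Finset ℕ} {q : ℕ → ℝ}, q ∈ simplex s → ∀ i, 0 ≤ q i - m q * p i := by
    intro s q hq i
    by_cases hi : i ∈ τ
    · exact sub_nonneg.2 (hmle q i hi)
    · rw [hp0 i hi, mul_zero, sub_zero]; exact hq.1 i
  have hm1 : ∀ {s : Finset ℕ} {q : ℕ → ℝ}, q ∈ simplex s → q ≠ p → m q < 1 := by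
    intro s q hq hqp
    have h1 : 0 ≤ 1 - m q := by
      rw [← hsum hq]; exact Finset.sum_nonneg fun i _ => hnn hq i
    refine lt_of_le_of_ne (by linarith) fun h => hqp ?_
    have h2 := hsum hq
    rw [h, sub_self, Finset.sum_eq_zero_iff_of_nonneg (fun i _ => by
      have := hnn hq i; rwa [h] at this)] at h2
    ext i
    by_cases hi : i ∈ s ∪ τ
    · have := h2 i hi; linarith
    · rw [Finset.mem_union, not_or] at hi
      rw [hp0 i hi.2]
      by_contra h0
      exact hi.1 (hq.2.1 i h0)
  have hf : ∀ {s : Finset ℕ} {q : ℕ → ℝ}, q ∈ simplex s → q ≠ p →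
      ∃ v ∈ τ, f q v = 0 ∧ f q ∈ simplex (s.erase v) := by
    intro s q hq hqp
    have hlt := hm1 hq hqp
    have happ : ∀ i, f q i = (1 - m q)⁻¹ * (q i - m q * p i) := fun i => rfl
    obtain ⟨v, hv, hqv⟩ := hmin q
    have hfv : f q v = 0 := by rw [happ, hqv, sub_self, mul_zero]
    have hsupp : ∀ i, f q i ≠ 0 → i ∈ s := by
      intro i hi
      by_contra his
      have hqi : q i = 0 := by by_contra h0; exact his (hq.2.1 i h0)
      apply hi
      rw [happ, hqi]
      by_cases hiτ : i ∈ τ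
      · rw [hmz q hq.1 i hiτ hqi]; simp
      · rw [hp0 i hiτ]; simp
    refine ⟨v, hv, hfv, mem_simplex_of_subset (t := s ∪ τ) ⟨fun i => ?_, fun i hi =>
      Finset.mem_union_left _ (hsupp i hi), ?_⟩ fun i hi => Finset.mem_erase.2 ⟨?_, hsupp i hi⟩⟩
    · exact mul_nonneg (inv_nonneg.2 (by linarith)) (hnn hq i)
    · simp only [happ]
      rw [← Finset.mul_sum, hsum hq, inv_mul_cancel₀ (by linarith)]
    · rintro rfl; exact hi hfv
  have hfid : ∀ q ∈ spaceOf (del K τ), f q = q := by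
    intro q hq
    obtain ⟨s, hs, hqs⟩ := mem_spaceOf.1 hq
    obtain ⟨v, hv, hvs⟩ := Finset.not_subset.1 hs.2
    have : m q = 0 := hmz q hqs.1 v hv (by by_contra h0; exact hvs (hqs.2.1 v h0))
    simp [f, this]
  refine homotopyEquiv_of_segment (f := f) (g := id) ?_ ?_ continuousOn_id ?_ ?_ ?_
  · have hc : Continuous fun q : ℕ → ℝ => q - m q • p := by fun_prop
    have hc' : Continuous fun q : ℕ → ℝ => 1 - m q := by fun_prop
    refine ContinuousOn.smul (hc'.continuousOn.inv₀ ?_) hc.continuousOn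
    rintro q ⟨hq, hqp⟩
    obtain ⟨s, hs, hqs⟩ := mem_spaceOf.1 hq
    have := hm1 hqs hqp
    linarith
  · rintro q ⟨hq, hqp⟩
    obtain ⟨s, hs, hqs⟩ := mem_spaceOf.1 hq
    obtain ⟨v, hv, hfv, hmem⟩ := hf hqs hqp
    exact simplex_subset_spaceOf (K := del K τ) ⟨hK s hs _ (Finset.erase_subset _ _),
      fun h => Finset.notMem_erase _ _ (h hv)⟩ hmem
  · intro q hq
    obtain ⟨s, hs, hqs⟩ := mem_spaceOf.1 hq
    refine ⟨simplex_subset_spaceOf hs.1 hqs, ?_⟩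
    rintro rfl
    exact hs.2 fun i hi => hqs.2.1 i (hpτ i hi).ne'
  · rintro q ⟨hq, hqp⟩
    obtain ⟨s, hs, hqs⟩ := mem_spaceOf.1 hq
    obtain ⟨v, hv, hfv, hmem⟩ := hf hqs hqp
    have hlt := hm1 hqs hqp
    have hq0 := hm0 q hqs.1
    rintro x ⟨a, b, ha, hb, hab, rfl⟩
    refine ⟨simplex_subset_spaceOf hs (convex_simplex s hqs
      (simplex_mono (Finset.erase_subset _ _) hmem) ha hb hab), fun he => ?_⟩
    have h1 := congrFun he v
    have h2 : q v - m q * p v = 0 := by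
      have : f q v = (1 - m q)⁻¹ * (q v - m q * p v) := rfl
      rw [hfv] at this
      rcases mul_eq_zero.1 this.symm with h | h
      · rw [inv_eq_zero] at h; linarith
      · exact h
    simp only [Pi.add_apply, Pi.smul_apply, smul_eq_mul, id_eq, hfv, mul_zero, add_zero] at h1
    have h3 := hpτ v hv
    have h4 : a * m q < 1 := by nlinarith
    have : a * (m q * p v) = p v := by linear_combination h1 - a * h2
    nlinarith
  · intro q hq
    rw [id_eq, hfid q hq, segment_same]
    exact Set.singleton_subset_iff.2 hq

/-- The complex of all faces of a simplex. -/
def full (V : Finset ℕ) : Set (Finset ℕ) := {s | s ⊆ V}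

theorem isComplex_full (V : Finset ℕ) : IsComplex (full V) := fun _ hs _ ht => ht.trans hs

theorem finite_full (V : Finset ℕ) : (full V).Finite :=
  V.powerset.finite_toSet.subset fun _ hs => Finset.mem_coe.2 (Finset.mem_powerset.2 hs)

theorem spaceOf_full (V : Finset ℕ) : spaceOf (full V) = simplex V :=
  Set.Subset.antisymm (fun _ hx => by
    obtain ⟨s, hs, hx⟩ := mem_spaceOf.1 hx
    exact simplex_mono hs hx) (simplex_subset_spaceOf (K := full V) (Finset.Subset.refl V))

theorem exists_ins_full {V : Finset ℕ} {v : ℕ} (hv : v ∈ V) {k : ℕ} {z : Chain (Finset ℕ)}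
    (hz : z ∈ cyc (full V) k) : ins v z ∈ supp (faces (full V) (k + 1)) ∧ dS (ins v z) = z := by
  refine ⟨supp_induction _ (fun s hs => ?_) hz.1, ?_⟩
  · rw [ins_gen]
    split_ifs with h
    · exact zero_mem _
    · exact gen_mem_supp ⟨Finset.insert_subset hv hs.1, by
        rw [Finset.card_insert_of_notMem h, hs.2]⟩
  · rw [dS_ins, LinearMap.mem_ker.1 hz.2, map_zero, add_zero]

theorem hdim_full {V : Finset ℕ} (hV : V.Nonempty) (k : ℕ) : hdim (full V) k = 0 := by
  obtain ⟨v, hv⟩ := hV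
  exact hdim_eq_zero (isComplex_full V) fun z hz =>
    ⟨ins v z, (exists_ins_full hv hz).1, (exists_ins_full hv hz).2⟩

section models

variable {E F : Type*} [AddCommGroup E] [Module ℝ E] [TopologicalSpace E]
  [IsTopologicalAddGroup E] [ContinuousSMul ℝ E] [AddCommGroup F] [Module ℝ F] [TopologicalSpace F]
  [IsTopologicalAddGroup F] [ContinuousSMul ℝ F]

theorem homotopyEquiv_full_of_convex {A : Set E} (hA : Convex ℝ A) (hne : A.Nonempty) :
    Nonempty (HomotopyEquiv A (spaceOf (full {0}))) := by
  obtain ⟨a, ha⟩ := hne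
  have h0 : Pi.single 0 1 ∈ spaceOf (full {0}) :=
    simplex_subset_spaceOf (K := full {0}) (Finset.Subset.refl {0}) (single_mem_simplex (by simp))
  refine homotopyEquiv_of_segment (f := fun _ => Pi.single 0 1) (g := fun _ => a)
    continuousOn_const (fun _ _ => h0) continuousOn_const (fun _ _ => ha)
    (fun x hx => hA.segment_subset hx ha) (fun y hy => ?_)
  have : Convex ℝ (spaceOf (full {0})) := by
    rw [spaceOf_full]; exact convex_simplex _
  exact this.segment_subset hy h0

theorem homotopyEquiv_compl_zero {A : Set E} (hA : Convex ℝ A) {p : E}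
    (φ : F →ₗ[ℝ] E) (hφ : Continuous φ) (ψ : E →ₗ[ℝ] F) (hψ : Continuous ψ)
    (hψφ : ∀ y, ψ (φ y) = y) (hφψ : ∀ q ∈ A, φ (ψ (q - p)) = q - p) (r : F → ℝ)
    (hr : Continuous r) (hr0 : ∀ y, 0 < r y) (hrA : ∀ y, p + r y • φ y ∈ A) :
    Nonempty (HomotopyEquiv (A \ {p} : Set E) ({0}ᶜ : Set F)) := by
  have hne : ∀ y, ψ y ≠ 0 → ∀ c : ℝ, 0 < c → p + c • y ≠ p := by
    intro y hy c hc h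
    have : c • y = 0 := by simpa using h
    rcases smul_eq_zero.1 this with h | h
    · exact hc.ne' h
    · exact hy (by rw [h, map_zero])
  have hψne : ∀ q ∈ A, q ≠ p → ψ (q - p) ≠ 0 := by
    intro q hq hqp h
    have := hφψ q hq
    rw [h, map_zero] at this
    exact hqp (sub_eq_zero.1 this.symm)
  refine homotopyEquiv_of_segment (f := fun q => ψ (q - p)) (g := fun y => p + r y • φ y)
    (by fun_prop) (fun q hq => hψne q hq.1 hq.2) (by fun_prop)
    (fun y hy => ⟨hrA y, hne _ (by rwa [hψφ]) _ (hr0 y)⟩) ?_ ?_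
  · rintro q ⟨hq, hqp⟩ x ⟨a, b, ha, hb, hab, rfl⟩
    refine ⟨hA hq (hrA _) ha hb hab, fun h => ?_⟩
    rw [hφψ q hq] at h
    have hr' := hr0 (ψ (q - p))
    refine hne (q - p) (hψne q hq hqp) (a + b * r (ψ (q - p))) ?_ ?_
    · rcases ha.eq_or_lt with h | h
      · have : b = 1 := by linarith
        rw [← h, this]; linarith
      · positivity
    · rw [Set.mem_singleton_iff] at h
      refine Eq.trans ?_ h
      have : b = 1 - a := by linarith
      rw [this]
      module
  · rintro y hy x ⟨a, b, ha, hb, hab, rfl⟩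
    have hr' := hr0 y
    change a • y + b • ψ (p + r y • φ y - p) ≠ 0
    rw [add_sub_cancel_left, map_smul, hψφ, smul_smul, ← add_smul]
    refine smul_ne_zero ?_ hy
    rcases ha.eq_or_lt with h | h
    · have : b = 1 := by linarith
      rw [← h, this]; linarith
    · positivity

end models

theorem homotopyEquiv_sdiff_of_homeomorph {X Y : Type*} [TopologicalSpace X] [TopologicalSpace Y]
    {A : Set X} {B : Set Y} (h : A ≃ₜ B) (a : A) :
    Nonempty (HomotopyEquiv (A \ {a.1} : Set X) (B \ {(h a).1} : Set Y)) :=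
  ⟨Homeomorph.toHomotopyEquiv {
    toFun := fun x => ⟨h ⟨x, x.2.1⟩, (h _).2, fun e => x.2.2 (by
      have := h.injective (Subtype.ext e)
      exact congrArg Subtype.val this)⟩
    invFun := fun y => ⟨h.symm ⟨y, y.2.1⟩, (h.symm _).2, fun e => y.2.2 (by
      have : h.symm ⟨y, y.2.1⟩ = a := Subtype.ext e
      have e' : (⟨y, y.2.1⟩ : B) = h a :=
        (h.apply_symm_apply _).symm.trans (congrArg h this)
      exact congrArg Subtype.val e')⟩
    left_inv := fun x => by simp
    right_inv := fun y => by simp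
    continuous_toFun := by fun_prop
    continuous_invFun := by fun_prop }⟩

section ball

variable {n : ℕ}

/-- The boundary complex of the standard `n`-simplex. -/
def simplexBdry (n : ℕ) : Set (Finset ℕ) :=
  del (full (Finset.range (n + 1))) (Finset.range (n + 1))

theorem homotopyEquiv_ball_sdiff_interior {x : EuclideanSpace ℝ (Fin n)} (hx : ‖x‖ < 1) :
    Nonempty (HomotopyEquiv (Metric.closedBall (0 : EuclideanSpace ℝ (Fin n)) 1 \ {x} : Set _)
      ({0}ᶜ : Set (EuclideanSpace ℝ (Fin n)))) := by
  refine homotopyEquiv_compl_zero (convex_closedBall 0 1)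
    LinearMap.id continuous_id LinearMap.id continuous_id (fun _ => rfl) (fun _ _ => rfl)
    (fun y => (1 - ‖x‖) / (1 + ‖y‖)) ?_ (fun y => ?_) (fun y => ?_)
  · refine continuous_const.div (by fun_prop) fun y => ?_
    positivity
  · have := norm_nonneg y
    exact div_pos (by linarith) (by linarith)
  · rw [mem_closedBall_zero_iff, LinearMap.id_apply]
    have h0 := norm_nonneg y
    calc ‖x + ((1 - ‖x‖) / (1 + ‖y‖)) • y‖ ≤ ‖x‖ + ‖((1 - ‖x‖) / (1 + ‖y‖)) • y‖ := norm_add_le _ _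
      _ = ‖x‖ + (1 - ‖x‖) * (‖y‖ / (1 + ‖y‖)) := by
          rw [norm_smul, Real.norm_of_nonneg (div_nonneg (by linarith) (by linarith))]
          ring
      _ ≤ ‖x‖ + (1 - ‖x‖) * 1 := by
          have : ‖y‖ / (1 + ‖y‖) ≤ 1 := by rw [div_le_one (by linarith)]; linarith
          have h1 : 0 ≤ 1 - ‖x‖ := by linarith
          gcongr
      _ = 1 := by ring

theorem homotopyEquiv_ball_sdiff_boundary {x : EuclideanSpace ℝ (Fin n)} (hx : ‖x‖ = 1) :
    Nonempty (HomotopyEquiv (Metric.closedBall (0 : EuclideanSpace ℝ (Fin n)) 1 \ {x} : Set _)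
      (spaceOf (full {0}))) := by
  have h : x ∈ Set.extremePoints ℝ (Metric.closedBall (0 : EuclideanSpace ℝ (Fin n)) 1) :=
    StrictConvexSpace.sphere_subset_extremePoints_closedBall 0 one_ne_zero (by simpa using hx)
  refine homotopyEquiv_full_of_convex
    ((convex_closedBall 0 1).mem_extremePoints_iff_convex_sdiff.1 h).2 ⟨0, by simp, ?_⟩
  rintro rfl
  simp at hx

/-- Extending a vector by a last coordinate so that the sum of the coordinates is zero. -/
noncomputable def extendZeroSum (n : ℕ) : EuclideanSpace ℝ (Fin n) →ₗ[ℝ] (ℕ → ℝ) where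
  toFun y i := if h : i < n then y ⟨i, h⟩ else if i = n then -∑ j, y j else 0
  map_add' y z := by
    ext i
    simp only [Pi.add_apply, PiLp.add_apply, Finset.sum_add_distrib]
    split_ifs <;> ring
  map_smul' a y := by
    ext i
    simp only [Pi.smul_apply, PiLp.smul_apply, smul_eq_mul, RingHom.id_apply, ← Finset.mul_sum]
    split_ifs <;> ring

/-- The first `n` coordinates. -/
noncomputable def firstCoords (n : ℕ) : (ℕ → ℝ) →ₗ[ℝ] EuclideanSpace ℝ (Fin n) where
  toFun x := WithLp.toLp 2 fun i => x i
  map_add' _ _ := rfl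
  map_smul' _ _ := rfl

theorem sum_extendZeroSum (y : EuclideanSpace ℝ (Fin n)) :
    ∑ i ∈ Finset.range (n + 1), extendZeroSum n y i = 0 := by
  rw [Finset.sum_range_succ, Finset.sum_range]
  simp [extendZeroSum]

theorem homotopyEquiv_simplexBdry :
    Nonempty (HomotopyEquiv ({0}ᶜ : Set (EuclideanSpace ℝ (Fin n))) (spaceOf (simplexBdry n))) := by
  let c : ℝ := 1 / (n + 1)
  have hc : 0 < c := by positivity
  let b : ℕ → ℝ := fun i => if i ∈ Finset.range (n + 1) then c else 0
  have hbi : ∀ i ∈ Finset.range (n + 1), b i = c := fun i hi => if_pos hi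
  have hsum : ∑ i ∈ Finset.range (n + 1), b i = 1 := by
    rw [Finset.sum_congr rfl hbi]
    simp only [Finset.sum_const, Finset.card_range, nsmul_eq_mul, c]
    push_cast
    field_simp
  have hb : b ∈ simplex (Finset.range (n + 1)) := by
    refine ⟨fun i => ?_, fun i hi => ?_, hsum⟩
    · simp only [b]; split_ifs <;> linarith
    · by_contra h; exact hi (if_neg h)
  obtain ⟨e₁⟩ := homotopyEquiv_del (isComplex_full (Finset.range (n + 1))) hb
    (fun i hi => by rw [hbi i hi]; exact hc)
  rw [spaceOf_full] at e₁
  obtain ⟨e₂⟩ := homotopyEquiv_compl_zero (convex_simplex (Finset.range (n + 1))) (p := b)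
    (extendZeroSum n)
    (by
      refine continuous_pi fun i => ?_
      change Continuous fun y : EuclideanSpace ℝ (Fin n) =>
        if h : i < n then y ⟨i, h⟩ else if i = n then -∑ j, y j else 0
      split_ifs <;> fun_prop)
    (firstCoords n)
    (by
      change Continuous fun x : ℕ → ℝ => WithLp.toLp 2 fun i : Fin n => x i
      fun_prop)
    (fun y => by
      ext i
      change (if h : (i : ℕ) < n then y ⟨i, h⟩ else _) = _
      rw [dif_pos i.2])
    (fun q hq => by
      ext i
      have h1 : ∑ i ∈ Finset.range (n + 1), (q - b) i = 0 := by
        simp only [Pi.sub_apply]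
        rw [Finset.sum_sub_distrib, hq.2.2, hsum, sub_self]
      have h2 : extendZeroSum n (firstCoords n (q - b)) i =
        if h : i < n then (q - b) i else if i = n then -∑ j : Fin n, (q - b) j else 0 := rfl
      rw [h2]
      split_ifs with h3 h4
      · rfl
      · rw [Finset.sum_range_succ, Finset.sum_range] at h1
        rw [h4]
        linarith
      · have h5 : i ∉ Finset.range (n + 1) := by simp; omega
        have h6 : q i = 0 := by by_contra h0; exact h5 (hq.2.1 i h0)
        have h7 : b i = 0 := by by_contra h0; exact h5 (hb.2.1 i h0)
        rw [Pi.sub_apply, h6, h7, sub_zero])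
    (fun y => c / (1 + ∑ i, |y i|))
    (by
      refine continuous_const.div (by fun_prop) fun y => ?_
      positivity)
    (fun y => by positivity)
    (fun y => by
      have hle : ∀ i, |extendZeroSum n y i| ≤ ∑ i, |y i| := by
        intro i
        have h2 : extendZeroSum n y i =
          if h : i < n then y ⟨i, h⟩ else if i = n then -∑ j, y j else 0 := rfl
        rw [h2]
        split_ifs with h3 h4
        · exact Finset.single_le_sum (f := fun i => |y i|) (fun _ _ => abs_nonneg _)
            (Finset.mem_univ _)
        · rw [abs_neg]; exact Finset.abs_sum_le_sum_abs _ _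
        · rw [abs_zero]; positivity
      have hpos : 0 < 1 + ∑ i, |y i| := by positivity
      have hout : ∀ i ∉ Finset.range (n + 1), extendZeroSum n y i = 0 := by
        intro i hi
        have h2 : extendZeroSum n y i =
          if h : i < n then y ⟨i, h⟩ else if i = n then -∑ j, y j else 0 := rfl
        rw [Finset.mem_range] at hi
        rw [h2, dif_neg (by omega), if_neg (by omega)]
      refine ⟨fun i => ?_, fun i hi => ?_, ?_⟩
      · simp only [Pi.add_apply, Pi.smul_apply, smul_eq_mul]
        by_cases hi : i ∈ Finset.range (n + 1)
        · rw [hbi i hi]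
          have h1 := neg_abs_le (extendZeroSum n y i)
          have h2 := hle i
          have h3 : c / (1 + ∑ i, |y i|) * (1 + ∑ i, |y i|) = c := by field_simp
          have h4 : 0 < c / (1 + ∑ i, |y i|) := by positivity
          nlinarith
        · rw [hout i hi, mul_zero, add_zero]; exact hb.1 i
      · by_contra h
        simp only [Pi.add_apply, Pi.smul_apply, smul_eq_mul, hout i h] at hi
        exact h (hb.2.1 i (by simpa using hi))
      · simp only [Pi.add_apply, Pi.smul_apply, smul_eq_mul]
        rw [Finset.sum_add_distrib, ← Finset.mul_sum, sum_extendZeroSum, hsum, mul_zero, add_zero])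
  exact ⟨e₂.symm.trans e₁⟩

end ball

section ball

variable {n : ℕ} {K : Set (Finset ℕ)}

theorem exists_pos_mem_simplex {τ : Finset ℕ} (hτ : τ.Nonempty) :
    ∃ p ∈ simplex τ, ∀ i ∈ τ, 0 < p i := by
  have hc : (0 : ℝ) < (τ.card : ℝ)⁻¹ := by
    have := hτ.card_pos
    positivity
  refine ⟨fun i => if i ∈ τ then (τ.card : ℝ)⁻¹ else 0, ⟨fun i => ?_, fun i hi => ?_, ?_⟩,
    fun i hi => ?_⟩
  · dsimp only; split_ifs <;> linarith
  · by_contra h; exact hi (if_neg h)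
  · rw [Finset.sum_congr rfl fun i hi => if_pos hi, Finset.sum_const, nsmul_eq_mul,
      mul_inv_cancel₀ (by simpa using hτ.ne_empty)]
  · dsimp only; rwa [if_pos hi]

theorem empty_mem_of_mem (hc : IsComplex K) {τ : Finset ℕ} (hτ : τ ∈ K) : ∅ ∈ K :=
  hc τ hτ ∅ (Finset.empty_subset τ)

theorem empty_mem_del (hc : IsComplex K) {τ : Finset ℕ} (hτ : τ ∈ K) (hne : τ.Nonempty) :
    ∅ ∈ del K τ :=
  ⟨empty_mem_of_mem hc hτ, fun h => hne.ne_empty (Finset.subset_empty.1 h)⟩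

theorem finite_del (hfin : K.Finite) (τ : Finset ℕ) : (del K τ).Finite :=
  hfin.subset fun _ h => h.1

theorem empty_mem_of_isBall (hc : IsComplex K) (hb : IsBall n K) : ∅ ∈ K := by
  obtain ⟨h⟩ := hb
  obtain ⟨s, hs, -⟩ := mem_spaceOf.1 (h.symm ⟨0, by simp⟩).2
  exact empty_mem_of_mem hc hs

theorem hdim_of_isBall (hc : IsComplex K) (hfin : K.Finite) (hb : IsBall n K) (k : ℕ) :
    hdim K k = 0 := by
  have he := empty_mem_of_isBall hc hb
  obtain ⟨h⟩ := hb
  obtain ⟨e⟩ := homotopyEquiv_full_of_convex (convex_closedBall (0 : EuclideanSpace ℝ (Fin n)) 1)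
    ⟨0, by simp⟩
  rw [hdim_eq_of_homotopyEquiv hc hfin he (isComplex_full {0}) (finite_full {0})
    (Finset.empty_subset {0}) (h.toHomotopyEquiv.trans e), hdim_full (by simp)]

theorem nonempty_of_mem_simplex {τ : Finset ℕ} {p : ℕ → ℝ} (hp : p ∈ simplex τ) : τ.Nonempty := by
  rcases τ.eq_empty_or_nonempty with rfl | h
  · simp [simplex_empty] at hp
  · exact h

theorem hdim_del_of_norm_eq_one (hc : IsComplex K) (hfin : K.Finite)
    (h : spaceOf K ≃ₜ Metric.closedBall (0 : EuclideanSpace ℝ (Fin n)) 1) {τ : Finset ℕ}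
    (hτ : τ ∈ K) {p : spaceOf K} (hp : p.1 ∈ simplex τ) (hpτ : ∀ i ∈ τ, 0 < p.1 i)
    (hn : ‖(h p).1‖ = 1) (k : ℕ) : hdim (del K τ) k = 0 := by
  obtain ⟨e₁⟩ := homotopyEquiv_del hc hp hpτ
  obtain ⟨e₂⟩ := homotopyEquiv_sdiff_of_homeomorph h p
  obtain ⟨e₃⟩ := homotopyEquiv_ball_sdiff_boundary hn
  rw [hdim_eq_of_homotopyEquiv (isComplex_del hc τ) (finite_del hfin τ)
    (empty_mem_del hc hτ (nonempty_of_mem_simplex hp)) (isComplex_full {0}) (finite_full {0})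
    (Finset.empty_subset {0}) (e₁.symm.trans (e₂.trans e₃)), hdim_full (by simp)]

theorem hdim_del_of_norm_lt_one (hc : IsComplex K) (hfin : K.Finite)
    (h : spaceOf K ≃ₜ Metric.closedBall (0 : EuclideanSpace ℝ (Fin n)) 1) {τ : Finset ℕ}
    (hτ : τ ∈ K) {p : spaceOf K} (hp : p.1 ∈ simplex τ) (hpτ : ∀ i ∈ τ, 0 < p.1 i)
    (hn : ‖(h p).1‖ < 1) (k : ℕ) : hdim (del K τ) k = hdim (simplexBdry n) k := by
  obtain ⟨e₁⟩ := homotopyEquiv_del hc hp hpτ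
  obtain ⟨e₂⟩ := homotopyEquiv_sdiff_of_homeomorph h p
  obtain ⟨e₃⟩ := homotopyEquiv_ball_sdiff_interior hn
  obtain ⟨e₄⟩ := homotopyEquiv_simplexBdry (n := n)
  exact hdim_eq_of_homotopyEquiv (isComplex_del hc τ) (finite_del hfin τ)
    (empty_mem_del hc hτ (nonempty_of_mem_simplex hp))
    (isComplex_del (isComplex_full _) _) (finite_del (finite_full _) _)
    (empty_mem_del (isComplex_full _) (Finset.Subset.refl _) (by simp))
    (e₁.symm.trans (e₂.trans (e₃.trans e₄))) k

theorem hdim_del_of_isBall (hc : IsComplex K) (hfin : K.Finite) (hb : IsBall n K) {τ : Finset ℕ}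
    (hτ : τ ∈ K) (hne : τ.Nonempty) :
    (∀ k, hdim (del K τ) k = 0) ∨ ∀ k, hdim (del K τ) k = hdim (simplexBdry n) k := by
  obtain ⟨h⟩ := hb
  obtain ⟨p, hp, hpτ⟩ := exists_pos_mem_simplex hne
  let q : spaceOf K := ⟨p, simplex_subset_spaceOf hτ hp⟩
  rcases (mem_closedBall_zero_iff.1 (h q).2).eq_or_lt with hn | hn
  · exact .inl (hdim_del_of_norm_eq_one hc hfin h hτ (p := q) hp hpτ hn)
  · exact .inr (hdim_del_of_norm_lt_one hc hfin h hτ (p := q) hp hpτ hn)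

theorem hdim_del_of_subset (hc : IsComplex K) (hfin : K.Finite) (hb : IsBall n K)
    {τ ρ : Finset ℕ} (hρ : ρ ∈ K) (hτρ : τ ⊆ ρ) (hne : τ.Nonempty)
    (hbd : ¬ ∀ k, hdim (del K ρ) k = hdim (simplexBdry n) k) (k : ℕ) : hdim (del K τ) k = 0 := by
  obtain ⟨h⟩ := hb
  obtain ⟨y, hy, hyτ⟩ := exists_pos_mem_simplex hne
  obtain ⟨x, hx, hxρ⟩ := exists_pos_mem_simplex (hne.mono hτρ)
  have hy' := simplex_mono hτρ hy
  let t : ℕ → ℝ := fun m => 1 / ((m : ℝ) + 1)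
  have ht0 : ∀ m, 0 < t m := fun m => by positivity
  have ht1 : ∀ m, t m ≤ 1 := fun m => by
    simp only [t]
    rw [div_le_one (by positivity)]
    linarith [(Nat.cast_nonneg m : (0 : ℝ) ≤ m)]
  have hmem : ∀ m, (1 - t m) • y + t m • x ∈ simplex ρ := fun m =>
    convex_simplex ρ hy' hx (sub_nonneg.2 (ht1 m)) (ht0 m).le (by ring)
  let u : ℕ → spaceOf K := fun m => ⟨_, simplex_subset_spaceOf hρ (hmem m)⟩
  let q : spaceOf K := ⟨y, simplex_subset_spaceOf hρ hy'⟩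
  have hu : ∀ m, ‖(h (u m)).1‖ = 1 := fun m => by
    refine le_antisymm (mem_closedBall_zero_iff.1 (h (u m)).2) (not_lt.1 fun hn => hbd ?_)
    refine hdim_del_of_norm_lt_one hc hfin h hρ (p := u m) (hmem m) (fun i hi => ?_) hn
    exact add_pos_of_nonneg_of_pos (mul_nonneg (sub_nonneg.2 (ht1 m)) (hy.1 i))
      (mul_pos (ht0 m) (hxρ i hi))
  have hlim : Filter.Tendsto u Filter.atTop (nhds q) := by
    refine tendsto_subtype_rng.2 ?_
    have h1 : Filter.Tendsto t Filter.atTop (nhds 0) := tendsto_one_div_add_atTop_nhds_zero_nat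
    have h2 : Continuous fun a : ℝ => (1 - a) • y + a • x := by fun_prop
    have h3 := (h2.tendsto 0).comp h1
    simp only [sub_zero, one_smul, zero_smul, add_zero] at h3
    exact h3
  have hq : Filter.Tendsto (fun m => ‖(h (u m)).1‖) Filter.atTop (nhds ‖(h q).1‖) :=
    ((continuous_norm.comp (continuous_subtype_val.comp h.continuous)).tendsto q).comp hlim
  simp only [hu] at hq
  exact hdim_del_of_norm_eq_one hc hfin h (hc ρ hρ τ hτρ) (p := q) hy hyτ
    (tendsto_nhds_unique hq tendsto_const_nhds) k

end ball

section sphere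

theorem mem_simplexBdry {n : ℕ} {s : Finset ℕ} :
    s ∈ simplexBdry n ↔ s ⊆ Finset.range (n + 1) ∧ s ≠ Finset.range (n + 1) :=
  and_congr_right fun h => not_congr ⟨fun h' => h.antisymm h', fun h' => h'.ge⟩

theorem hdim_simplexBdry_of_ne {n k : ℕ} (h : k ≠ n) : hdim (simplexBdry n) k = 0 := by
  have h1 : faces (simplexBdry n) k ⊆ faces (full (Finset.range (n + 1))) k :=
    fun s hs => ⟨hs.1.1, hs.2⟩
  have h2 : faces (full (Finset.range (n + 1))) (k + 1) ⊆ faces (simplexBdry n) (k + 1) := by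
    refine fun s hs => ⟨mem_simplexBdry.2 ⟨hs.1, fun e => h ?_⟩, hs.2⟩
    have h3 := hs.2
    rw [e, Finset.card_range] at h3
    omega
  refine hdim_eq_zero (isComplex_del (isComplex_full _) _) fun z hz => ?_
  have hz' : z ∈ cyc (full (Finset.range (n + 1))) k := ⟨supp_mono h1 hz.1, hz.2⟩
  obtain ⟨h3, h4⟩ := exists_ins_full (v := 0) (by simp) hz'
  exact ⟨ins 0 z, supp_mono h2 h3, h4⟩

end sphere

open Finset

section euler

variable {K L : Set (Finset ℕ)}

/-- The reduced Euler characteristic, up to sign. -/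
noncomputable def chi (K : Set (Finset ℕ)) : ℤ := ∑ᶠ s ∈ K, (-1) ^ s.card

theorem chi_eq_sum (hK : K.Finite) : chi K = ∑ s ∈ hK.toFinset, (-1) ^ s.card :=
  finsum_mem_eq_finite_toFinset_sum _ hK

theorem fnum_eq_card (hK : K.Finite) (k : ℕ) : fnum K k = #{s ∈ hK.toFinset | s.card = k} := by
  refine (Set.ncard_eq_toFinset_card _ (faces_finite hK k)).trans (congrArg _ ?_)
  ext s
  simp [faces]

theorem sum_card_eq (hK : K.Finite) {m : ℕ} (h : ∀ s ∈ K, s.card ≤ m) (g : ℕ → ℤ) :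
    ∑ s ∈ hK.toFinset, g s.card = ∑ k ∈ range (m + 1), g k * fnum K k := by
  rw [← sum_fiberwise_of_maps_to (t := range (m + 1)) (g := Finset.card)
    (fun s hs => mem_range_succ_iff.2 (h s (hK.mem_toFinset.1 hs)))]
  refine sum_congr rfl fun k _ => ?_
  rw [fnum_eq_card hK, sum_congr rfl (g := fun _ => g k) fun _ hs => by rw [(mem_filter.1 hs).2],
    sum_const, nsmul_eq_mul, mul_comm]

theorem exists_card_le (hK : K.Finite) : ∃ m, ∀ s ∈ K, s.card ≤ m :=
  ⟨hK.toFinset.sup Finset.card, fun _ hs => le_sup (f := Finset.card) (hK.mem_toFinset.2 hs)⟩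

theorem chi_eq_of_hdim_eq (hK : K.Finite) (hL : L.Finite) (h : ∀ k, hdim K k = hdim L k) :
    chi K = chi L := by
  obtain ⟨a, ha⟩ := exists_card_le hK
  obtain ⟨b, hb⟩ := exists_card_le hL
  have ha' : ∀ s ∈ K, s.card ≤ a + b := fun s hs => (ha s hs).trans (Nat.le_add_right _ _)
  have hb' : ∀ s ∈ L, s.card ≤ a + b := fun s hs => (hb s hs).trans (Nat.le_add_left _ _)
  rw [chi_eq_sum hK, chi_eq_sum hL, sum_card_eq hK ha', sum_card_eq hL hb',
    euler_poincare hK ha', euler_poincare hL hb']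
  simp only [h]

theorem hdim_empty (k : ℕ) : hdim ∅ k = 0 := by
  refine hdim_eq_zero (fun _ hs => absurd hs (Set.notMem_empty _)) fun z hz => ?_
  have h : faces ∅ k = ∅ := Set.eq_empty_of_forall_notMem fun _ hs => hs.1
  have hz' := hz.1
  simp only [h, supp, Finsupp.supported_empty] at hz'
  rw [hz']
  exact zero_mem _

theorem chi_empty : chi ∅ = 0 := finsum_mem_empty

theorem chi_of_hdim_eq_zero (hK : K.Finite) (h : ∀ k, hdim K k = 0) : chi K = 0 := by
  rw [chi_eq_of_hdim_eq hK Set.finite_empty fun k => by rw [h, hdim_empty], chi_empty]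

theorem sum_superset (hK : K.Finite) (τ : Finset ℕ) :
    ∑ s ∈ hK.toFinset with τ ⊆ s, (-1 : ℤ) ^ s.card = chi K - chi (del K τ) := by
  rw [chi_eq_sum hK, chi_eq_sum (finite_del hK τ), eq_sub_iff_add_eq,
    ← sum_filter_add_sum_filter_not hK.toFinset (τ ⊆ ·)]
  congr 1
  refine sum_congr ?_ fun _ _ => rfl
  ext s
  simp [del]

theorem chi_simplexBdry (n : ℕ) : chi (simplexBdry n) = (-1) ^ n := by
  have h := sum_superset (finite_full (range (n + 1))) (range (n + 1))
  have h0 : chi (full (range (n + 1))) = 0 :=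
    chi_of_hdim_eq_zero (finite_full _) fun k => hdim_full (by simp) k
  rw [h0, sum_eq_single_of_mem (range (n + 1)), card_range, pow_succ] at h
  · change _ = 0 - chi (simplexBdry n) at h
    linarith
  · simp [full]
  · intro s hs hne
    simp only [mem_filter, Set.Finite.mem_toFinset] at hs
    exact absurd (Subset.antisymm hs.1 hs.2) hne

end euler

section star

variable {K : Set (Finset ℕ)} {n : ℕ} {τ : Finset ℕ}

theorem eq_zero_of_star (hc : IsComplex K) (hfin : K.Finite) {k : ℕ} (hK : hdim K (k + 1) = 0)
    (hτ : hdim (del K τ) k = 0) (htop : ∀ s ∈ K, τ ⊆ s → s.card ≤ k + 1) {z : Chain (Finset ℕ)}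
    (hz : z ∈ supp (faces K (k + 1))) (hzτ : z ∈ supp {s | τ ⊆ s})
    (hdz : dS z ∈ supp (del K τ)) : z = 0 := by
  have h1 : dS z ∈ cyc (del K τ) k := by
    refine ⟨?_, dS_dS z⟩
    have := Submodule.mem_inf.2 ⟨hdz, dS_mem hc hz⟩
    rw [supp, supp, ← Finsupp.supported_inter] at this
    have hsub : del K τ ∩ faces K k ⊆ faces (del K τ) k := fun s hs => ⟨hs.1, hs.2.2⟩
    exact supp_mono hsub this
  obtain ⟨w, hw, hwz⟩ := cyc_le_bnd (finite_del hfin τ) (isComplex_del hc τ) hτ h1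
  have hsub : faces (del K τ) (k + 1) ⊆ faces K (k + 1) := fun s hs => ⟨hs.1.1, hs.2⟩
  have hwK : w ∈ supp (faces K (k + 1)) := supp_mono hsub hw
  have h2 : z + w ∈ cyc K (k + 1) := by
    refine ⟨add_mem hz hwK, ?_⟩
    change dS _ = 0
    rw [map_add, hwz]
    exact ZModModule.add_self _
  obtain ⟨u, hu, huz⟩ := cyc_le_bnd hfin hc hK h2
  have hsub' : faces K (k + 1 + 1) ⊆ faces (del K τ) (k + 1 + 1) := by
    refine fun s hs => ⟨⟨hs.1, fun h => ?_⟩, hs.2⟩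
    have h3 := htop s hs.1 h
    have h4 := hs.2
    omega
  have h3 : z + w ∈ supp (del K τ) := by
    rw [← huz]
    exact supp_mono (S := faces (del K τ) (k + 1)) (fun s hs => hs.1)
      (dS_mem (isComplex_del hc τ) (supp_mono hsub' hu))
  have h4 : z ∈ supp (del K τ) := by
    have h5 : w ∈ supp (del K τ) :=
      supp_mono (S := faces (del K τ) (k + 1)) (fun s hs => hs.1) hw
    simpa using sub_mem h3 h5
  have h5 := Submodule.mem_inf.2 ⟨h4, hzτ⟩
  rw [supp, supp, ← Finsupp.supported_inter] at h5
  have h6 : del K τ ∩ {s | τ ⊆ s} = ∅ :=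
    Set.eq_empty_of_forall_notMem fun s hs => hs.1.2 hs.2
  simpa [h6] using h5

theorem hdim_del_dichotomy (hc : IsComplex K) (hfin : K.Finite) (hb : IsBall n K) (hτ : τ ∈ K) :
    (∀ k, hdim (del K τ) k = 0) ∨ ∀ k, hdim (del K τ) k = hdim (simplexBdry n) k := by
  rcases τ.eq_empty_or_nonempty with rfl | hne
  · have h : del K ∅ = ∅ := Set.eq_empty_of_forall_notMem fun s hs => hs.2 (Finset.empty_subset s)
    exact .inl fun k => by rw [h, hdim_empty]
  · exact hdim_del_of_isBall hc hfin hb hτ hne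

theorem card_eq_of_maximal (hc : IsComplex K) (hfin : K.Finite) (hb : IsBall n K) (hτ : τ ∈ K)
    (hmax : ∀ s ∈ K, τ ⊆ s → s = τ) : τ.card = n + 1 := by
  by_contra hne
  have hpos : gen τ ≠ (0 : Chain (Finset ℕ)) := by simp
  rcases τ.eq_empty_or_nonempty with rfl | hτ0
  · have h1 : gen ∅ ∈ cyc K 0 := ⟨gen_mem_supp ⟨hτ, rfl⟩, by
      change dS _ = 0
      rw [dS_gen, Finset.sum_empty]⟩
    obtain ⟨u, hu, hu'⟩ := cyc_le_bnd hfin hc (hdim_of_isBall hc hfin hb 0) h1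
    have h2 : faces K (0 + 1) = ∅ := Set.eq_empty_of_forall_notMem fun s hs => by
      have h3 := hs.2
      rw [hmax s hs.1 (Finset.empty_subset s)] at h3
      simp at h3
    have hu0 : u = 0 := by simpa [h2] using hu
    rw [hu0, map_zero] at hu'
    exact hpos hu'.symm
  · obtain ⟨k, hk⟩ : ∃ k, τ.card = k + 1 := Nat.exists_eq_succ_of_ne_zero hτ0.card_pos.ne'
    have hdel : hdim (del K τ) k = 0 := by
      rcases hdim_del_dichotomy hc hfin hb hτ with h | h
      · exact h k
      · rw [h, hdim_simplexBdry_of_ne (by omega)]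
    refine hpos (eq_zero_of_star hc hfin (hdim_of_isBall hc hfin hb (k + 1)) hdel
      (fun s hs h => by rw [hmax s hs h, hk]) (gen_mem_supp ⟨hτ, hk⟩)
      (gen_mem_supp (Finset.Subset.refl τ)) ?_)
    have hsub : {t | t ⊆ τ ∧ t.card + 1 = τ.card} ⊆ del K τ := by
      refine fun t ht => ⟨hc τ hτ t ht.1, fun h => ?_⟩
      have h1 := Finset.card_le_card h
      have h2 := ht.2
      omega
    exact supp_mono hsub (dS_gen_mem τ)

theorem exists_facet (hc : IsComplex K) (hfin : K.Finite) (hb : IsBall n K) (hτ : τ ∈ K) :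
    ∃ s ∈ K, τ ⊆ s ∧ s.card = n + 1 := by
  obtain ⟨s, hτs, hs⟩ := hfin.exists_le_maximal hτ
  exact ⟨s, hs.1, hτs, card_eq_of_maximal hc hfin hb hs.1 fun t ht hst => hs.eq_of_ge ht hst⟩

theorem card_le_of_isBall (hc : IsComplex K) (hfin : K.Finite) (hb : IsBall n K) (hτ : τ ∈ K) :
    τ.card ≤ n + 1 := by
  obtain ⟨s, -, h, hs⟩ := exists_facet hc hfin hb hτ
  exact hs ▸ Finset.card_le_card h

/-- The Euler characteristic detecting whether a face of an `n`-ball lies in the interior. -/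
noncomputable def interiorIndex (n : ℕ) (K : Set (Finset ℕ)) (τ : Finset ℕ) : ℤ :=
  (-1) ^ n * chi (del K τ)

theorem interiorIndex_eq_zero (hfin : K.Finite) (h : ∀ k, hdim (del K τ) k = 0) :
    interiorIndex n K τ = 0 := by
  rw [interiorIndex, chi_of_hdim_eq_zero (finite_del hfin τ) h, mul_zero]

theorem interiorIndex_eq_one (hfin : K.Finite)
    (h : ∀ k, hdim (del K τ) k = hdim (simplexBdry n) k) : interiorIndex n K τ = 1 := by
  rw [interiorIndex, chi_eq_of_hdim_eq (finite_del hfin τ) (finite_del (finite_full _) _) h]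
  change _ * chi (simplexBdry n) = 1
  rw [chi_simplexBdry, ← mul_pow]
  simp

theorem interiorIndex_eq_sum (hc : IsComplex K) (hfin : K.Finite) (hb : IsBall n K)
    (τ : Finset ℕ) : interiorIndex n K τ =
      (-1) ^ (n + 1) * ∑ s ∈ hfin.toFinset with τ ⊆ s, (-1 : ℤ) ^ s.card := by
  rw [sum_superset, chi_of_hdim_eq_zero hfin (hdim_of_isBall hc hfin hb), interiorIndex]
  ring

theorem interiorIndex_ridge (hc : IsComplex K) (hfin : K.Finite) (hb : IsBall n K) (hτ : τ ∈ K)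
    (hn : τ.card = n) :
    interiorIndex n K τ = #{s ∈ hfin.toFinset | s.card = n + 1 ∧ τ ⊆ s} - 1 := by
  have h : {s ∈ hfin.toFinset | τ ⊆ s} =
      insert τ {s ∈ hfin.toFinset | s.card = n + 1 ∧ τ ⊆ s} := by
    ext s
    simp only [mem_filter, Set.Finite.mem_toFinset, mem_insert]
    constructor
    · rintro ⟨hs, hτs⟩
      by_cases h : s.card = n + 1
      · exact .inr ⟨hs, h, hτs⟩
      · have := card_le_of_isBall hc hfin hb hs
        exact .inl (Finset.eq_of_subset_of_card_le hτs (by omega)).symm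
    · rintro (rfl | h)
      · exact ⟨hτ, Subset.refl _⟩
      · exact ⟨h.1, h.2.2⟩
  rw [interiorIndex_eq_sum hc hfin hb, h, sum_insert (by simp; omega), hn,
    sum_congr rfl (g := fun _ => (-1) ^ (n + 1)) fun s hs => by rw [(mem_filter.1 hs).2.1],
    sum_const, nsmul_eq_mul]
  have h1 : ((-1 : ℤ) ^ n) * (-1) ^ n = 1 := by rw [← mul_pow]; simp
  rw [pow_succ]
  linear_combination (#{s ∈ hfin.toFinset | s.card = n + 1 ∧ τ ⊆ s} - 1) * h1

theorem mem_bdry_iff (hfin : K.Finite) : τ ∈ bdry n K ↔ ∃ ρ ∈ K, τ ⊆ ρ ∧ ρ.card = n ∧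
    #{s ∈ hfin.toFinset | s.card = n + 1 ∧ ρ ⊆ s} = 1 := by
  refine exists_congr fun ρ => and_congr_right fun _ => and_congr_right fun _ =>
    and_congr_right fun _ => ?_
  rw [card_eq_one, singleton_iff_unique_mem]
  simp

theorem interiorIndex_mem (hc : IsComplex K) (hfin : K.Finite) (hb : IsBall n K) (hτ : τ ∈ K) :
    interiorIndex n K τ = 0 ∨ interiorIndex n K τ = 1 :=
  (hdim_del_dichotomy hc hfin hb hτ).imp (interiorIndex_eq_zero hfin) (interiorIndex_eq_one hfin)

theorem mem_bdry_iff_interiorIndex (hc : IsComplex K) (hfin : K.Finite) (hb : IsBall n K)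
    (hτ : τ ∈ K) : τ ∈ bdry n K ↔ interiorIndex n K τ = 0 := by
  rw [mem_bdry_iff hfin]
  constructor
  · rintro ⟨ρ, hρ, hτρ, hcard, h1⟩
    have hρ0 : interiorIndex n K ρ = 0 := by
      rw [interiorIndex_ridge hc hfin hb hρ hcard, h1]; simp
    have hbd : ¬ ∀ k, hdim (del K ρ) k = hdim (simplexBdry n) k := fun h => by
      rw [interiorIndex_eq_one hfin h] at hρ0
      exact one_ne_zero hρ0
    rcases τ.eq_empty_or_nonempty with rfl | hne
    · rw [interiorIndex_eq_sum hc hfin hb, sum_superset,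
        chi_of_hdim_eq_zero hfin (hdim_of_isBall hc hfin hb)]
      have h : del K ∅ = ∅ :=
        Set.eq_empty_of_forall_notMem fun s hs => hs.2 (Finset.empty_subset s)
      rw [h, chi_empty]
      simp
    · exact interiorIndex_eq_zero hfin (hdim_del_of_subset hc hfin hb hρ hτρ hne hbd)
  · intro h0
    by_contra! hno
    have hdel : ∀ k, hdim (del K τ) k = 0 := by
      rcases hdim_del_dichotomy hc hfin hb hτ with h | h
      · exact h
      · rw [interiorIndex_eq_one hfin h] at h0
        exact absurd h0 one_ne_zero
    obtain ⟨F, hF, hτF, hFn⟩ := exists_facet hc hfin hb hτ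
    have htwo : ∀ ρ ∈ K, τ ⊆ ρ → ρ.card = n →
        #{s ∈ hfin.toFinset | s.card = n + 1 ∧ ρ ⊆ s} = 2 := fun ρ hρ hτρ hcard => by
      have h1 := interiorIndex_ridge hc hfin hb hρ hcard
      have h2 := hno ρ hρ hτρ hcard
      rcases interiorIndex_mem hc hfin hb hρ with h | h <;> omega
    let z : Chain (Finset ℕ) := ∑ s ∈ hfin.toFinset with s.card = n + 1 ∧ τ ⊆ s, gen s
    have hz : z ∈ supp (faces K (n + 1)) := sum_mem fun s hs => by
      simp only [mem_filter, Set.Finite.mem_toFinset] at hs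
      exact gen_mem_supp ⟨hs.1, hs.2.1⟩
    have hz0 : z = 0 := by
      refine eq_zero_of_star hc hfin (hdim_of_isBall hc hfin hb (n + 1)) (hdel n)
        (fun s hs _ => card_le_of_isBall hc hfin hb hs) hz
        (sum_mem fun s hs => gen_mem_supp (mem_filter.1 hs).2.2) ?_
      have hdz := dS_mem hc hz
      refine (Finsupp.mem_supported _ _).2 fun ρ hρ => ?_
      have hρK : ρ ∈ faces K n := (Finsupp.mem_supported _ _).1 hdz hρ
      refine ⟨hρK.1, fun hτρ => Finsupp.mem_support_iff.1 hρ ?_⟩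
      rw [map_sum, Finsupp.finsetSum_apply]
      simp only [dS_gen_apply]
      rw [sum_boole, filter_filter]
      have h2 := htwo ρ hρK.1 hτρ hρK.2
      have h3 : {s ∈ hfin.toFinset | (s.card = n + 1 ∧ τ ⊆ s) ∧ ρ ⊆ s ∧ ρ.card + 1 = s.card} =
          {s ∈ hfin.toFinset | s.card = n + 1 ∧ ρ ⊆ s} := by
        refine filter_congr fun s _ => ⟨fun h => ⟨h.1.1, h.2.1⟩, fun h =>
          ⟨⟨h.1, hτρ.trans h.2⟩, h.2, by rw [hρK.2, h.1]⟩⟩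
      rw [h3, h2]
      rfl
    have hzF : z F = 1 := by
      rw [Finsupp.finsetSum_apply, sum_eq_single_of_mem F]
      · simp
      · simp [hF, hFn, hτF]
      · intro s _ hs
        exact Finsupp.single_eq_of_ne hs.symm
    rw [hz0] at hzF
    simp at hzF

end star

section numbers

theorem sum_choose_mul_choose {d i : ℕ} (hi : i ≤ d) (m : ℕ) :
    ∑ k ∈ range (m + 1), (-1 : ℤ) ^ k * (d - k).choose (m - k) * i.choose k =
      (d - i).choose m := by
  induction i generalizing d m with
  | zero =>
    rw [sum_eq_single_of_mem 0 (by simp)]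
    · simp
    · intro k _ hk
      rw [Nat.choose_eq_zero_of_lt (Nat.pos_of_ne_zero hk)]
      simp
  | succ i ih =>
    obtain ⟨d, rfl⟩ : ∃ e, d = e + 1 := ⟨d - 1, by omega⟩
    cases m with
    | zero => simp
    | succ m =>
      have h1 := ih (d := d + 1) (by omega) (m + 1)
      have h2 := ih (d := d) (by omega) m
      rw [sum_range_succ'] at h1 ⊢
      have h3 : (d + 1 - i).choose (m + 1) = (d - i).choose m + (d - i).choose (m + 1) := by
        rw [Nat.sub_add_comm (by omega), Nat.choose_succ_succ]
      have h4 : ∀ k, (i + 1).choose (k + 1) = i.choose k + i.choose (k + 1) :=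
        fun k => Nat.choose_succ_succ i k
      simp only [Nat.add_sub_add_right, h4, h3, Nat.choose_zero_right] at h1 ⊢
      push_cast at h1 ⊢
      simp only [mul_add, sum_add_distrib, pow_succ, mul_neg, neg_mul, mul_one,
        sum_neg_distrib] at h1 ⊢
      linarith

variable {K : Set (Finset ℕ)} {n : ℕ}

theorem sum_interiorIndex (hc : IsComplex K) (hfin : K.Finite) (hb : IsBall n K) (k : ℕ) :
    ∑ τ ∈ hfin.toFinset with τ.card = k, interiorIndex n K τ =
      (-1) ^ (n + 1) * ∑ i ∈ range (n + 1 + 1), (-1) ^ i * (i.choose k : ℤ) * fnum K i := by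
  rw [← sum_card_eq hfin (fun s hs => card_le_of_isBall hc hfin hb hs)
    (fun i => (-1) ^ i * (i.choose k : ℤ))]
  simp only [interiorIndex_eq_sum hc hfin hb]
  rw [← mul_sum]
  congr 1
  rw [sum_comm' (t' := hfin.toFinset)
    (s' := fun s => {τ ∈ hfin.toFinset | τ.card = k ∧ τ ⊆ s}) (by grind)]
  refine sum_congr rfl fun s hs => ?_
  rw [sum_const, nsmul_eq_mul, mul_comm, ← card_powersetCard]
  congr 3
  ext t
  simp only [mem_filter, Set.Finite.mem_toFinset, mem_powersetCard]
  exact ⟨fun h => ⟨h.2.2, h.2.1⟩, fun h => ⟨hc s (hfin.mem_toFinset.1 hs) t h.1, h.2, h.1⟩⟩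

theorem hnum_eq_sum (hc : IsComplex K) (hfin : K.Finite) (hb : IsBall n K) {m : ℕ}
    (hm : m ≤ n + 1) : hnum (n + 1) K (n + 1 - m) =
      ∑ k ∈ range (m + 1), (-1) ^ (m - k) * (n + 1 - k).choose (m - k) *
        ∑ τ ∈ hfin.toFinset with τ.card = k, interiorIndex n K τ := by
  have hterm : ∀ i ∈ range (n + 1 + 1), ∑ k ∈ range (m + 1), (-1 : ℤ) ^ (m - k) *
      (n + 1 - k).choose (m - k) * ((-1) ^ (n + 1) * ((-1) ^ i * (i.choose k : ℤ) * fnum K i)) =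
      (-1) ^ (m + n + 1 + i) * (n + 1 - i).choose m * fnum K i := fun i hi => by
    rw [← sum_choose_mul_choose (mem_range_succ_iff.1 hi) m, mul_sum, sum_mul]
    refine sum_congr rfl fun k hk => ?_
    have hk' := mem_range_succ_iff.1 hk
    have h1 : (-1 : ℤ) ^ (m - k) = (-1) ^ m * (-1) ^ k := by
      rw [← pow_add]
      exact neg_one_pow_congr (by grind)
    rw [h1]
    ring
  simp only [sum_interiorIndex hc hfin hb, mul_sum]
  rw [sum_comm, sum_congr rfl hterm, hnum]
  refine (sum_congr rfl fun i hi => ?_).trans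
    (sum_subset (range_mono (by omega)) fun i hi hi' => ?_)
  · have hi' := mem_range_succ_iff.1 hi
    have h1 : (n + 1 - i).choose (n + 1 - m - i) = (n + 1 - i).choose m := by
      rw [← Nat.choose_symm (by omega : m ≤ n + 1 - i)]
      congr 1
      omega
    have h2 : (-1 : ℤ) ^ (n + 1 - m - i) = (-1) ^ (m + n + 1 + i) :=
      neg_one_pow_congr (by grind)
    rw [h1, h2]
  · rw [mem_range] at hi hi'
    rw [Nat.choose_eq_zero_of_lt (by omega)]
    simp

theorem forall_hnum_eq_zero_iff (hc : IsComplex K) (hfin : K.Finite) (hb : IsBall n K) {m : ℕ}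
    (hm : m ≤ n + 1) : (∀ j ≤ m, hnum (n + 1) K (n + 1 - j) = 0) ↔
      ∀ k ≤ m, ∑ τ ∈ hfin.toFinset with τ.card = k, interiorIndex n K τ = 0 := by
  constructor
  · intro h k
    induction k using Nat.strong_induction_on with
    | _ k ih =>
      intro hk
      have h1 := h k hk
      rw [hnum_eq_sum hc hfin hb (hk.trans hm), sum_range_succ, sum_eq_zero fun j hj => by
        rw [ih j (mem_range.1 hj) ((mem_range.1 hj).le.trans hk), mul_zero]] at h1
      simpa using h1
  · intro h j hj
    rw [hnum_eq_sum hc hfin hb (hj.trans hm)]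
    exact sum_eq_zero fun k hk => by
      rw [h k ((mem_range_succ_iff.1 hk).trans hj), mul_zero]

theorem sum_interiorIndex_eq_zero_iff (hc : IsComplex K) (hfin : K.Finite) (hb : IsBall n K)
    (k : ℕ) : ∑ τ ∈ hfin.toFinset with τ.card = k, interiorIndex n K τ = 0 ↔
      ∀ τ ∈ K, τ.card = k → τ ∈ bdry n K := by
  rw [sum_eq_zero_iff_of_nonneg fun τ hτ => by
    rcases interiorIndex_mem hc hfin hb (hfin.mem_toFinset.1 (mem_filter.1 hτ).1) with h | h <;>
      simp [h]]
  simp only [mem_filter, Set.Finite.mem_toFinset, and_imp]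
  exact forall₃_congr fun τ hτ _ => (mem_bdry_iff_interiorIndex hc hfin hb hτ).symm

end numbers

end StackedBall

/-- A PL `(d-1)`-ball `Δ` is `(r-1)`-stacked iff `h_i(Δ) = 0` for all `i ≥ r`. -/
theorem stacked_iff_hvector (d r : ℕ) (hd : 1 ≤ d) (hr : 1 ≤ r)
    (K : Set (Finset ℕ)) (hc : IsComplex K) (hfin : K.Finite)
    (hb : IsBall (d - 1) K) :
    IsStacked (r - 1) (d - 1) K ↔ ∀ i, r ≤ i → i ≤ d → hnum d K i = 0 := by
  obtain ⟨n, rfl⟩ : ∃ n, d = n + 1 := ⟨d - 1, by omega⟩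
  rw [Nat.add_sub_cancel] at hb ⊢
  by_cases hrn : r ≤ n + 1
  · trans ∀ k ≤ n + 1 - r, ∀ τ ∈ K, τ.card = k → τ ∈ bdry n K
    · exact ⟨fun h k hk τ hτ hcard => h τ hτ (by omega),
        fun h τ hτ hcard => h τ.card (by omega) τ hτ rfl⟩
    simp only [← StackedBall.sum_interiorIndex_eq_zero_iff hc hfin hb]
    rw [← StackedBall.forall_hnum_eq_zero_iff hc hfin hb (by omega)]
    refine ⟨fun h i hri hi => ?_, fun h j hj => h _ (by omega) (by omega)⟩
    have := h (n + 1 - i) (by omega)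
    rwa [Nat.sub_sub_self hi] at this
  · exact ⟨fun _ i _ _ => by omega, fun _ τ _ h => by omega⟩
end
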